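/- arXiv:2311.15666 — 2 statements merged into one kernel-verified Lean document; each statement's English description precedes it below -/
import Mathlib

section
/- Σ_{n=0}^∞ (−1)^n (2n+1)^4 · sinh((2n+1)π/2) / cosh((2n+1)π/2)^4 = −Γ^4/(2^2 π^6) − Γ^12/(3·2^9 π^9) + Γ^12/(2^8 π^10), where Γ = Γ(1/4). -/
open Real

namespace SechSums

/-- Two-sided sequences decaying faster than any power. -/
def RapidDecay (α : ℤ → ℂ) : Prop :=
  ∀ k : ℕ, Summable fun n : ℤ => |(n : ℝ)| ^ k * ‖α n‖

lemma summable_abs_pow_mul_exp {δ : ℝ} (hδ : 0 < δ) (k : ℕ) :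
    Summable fun n : ℤ => |(n : ℝ)| ^ k * exp (-(δ * |(n : ℝ)|)) := by
  have h : Summable fun n : ℕ => (n : ℝ) ^ k * exp (-(δ * n)) := by
    have := Real.summable_pow_mul_exp_neg_nat_mul k hδ
    simpa [neg_mul] using this
  apply Summable.of_nat_of_neg
  · simpa using h
  · simpa using h

lemma RapidDecay.of_le_exp {α : ℤ → ℂ} {K δ : ℝ} (hδ : 0 < δ)
    (h : ∀ n, ‖α n‖ ≤ K * exp (-(δ * |(n : ℝ)|))) : RapidDecay α := by
  intro k
  refine Summable.of_nonneg_of_le (fun n => by positivity) (fun n => ?_)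
    ((summable_abs_pow_mul_exp hδ k).mul_left K)
  calc |(n : ℝ)| ^ k * ‖α n‖ ≤ |(n : ℝ)| ^ k * (K * exp (-(δ * |(n : ℝ)|))) := by
        gcongr; exact h n
    _ = _ := by ring

lemma RapidDecay.summable_norm {α : ℤ → ℂ} (h : RapidDecay α) : Summable fun n => ‖α n‖ := by
  simpa using h 0

lemma RapidDecay.summable {α : ℤ → ℂ} (h : RapidDecay α) : Summable α :=
  h.summable_norm.of_norm

lemma RapidDecay.of_le {α β : ℤ → ℂ} (K : ℝ) (h : RapidDecay β)
    (hα : ∀ n, ‖α n‖ ≤ K * ‖β n‖) : RapidDecay α := by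
  intro k
  refine Summable.of_nonneg_of_le (fun n => by positivity) (fun n => ?_) ((h k).mul_left K)
  calc |(n : ℝ)| ^ k * ‖α n‖ ≤ |(n : ℝ)| ^ k * (K * ‖β n‖) := by
        gcongr; exact hα n
    _ = _ := by ring

lemma RapidDecay.int_mul {α : ℤ → ℂ} (h : RapidDecay α) : RapidDecay fun n => (n : ℂ) * α n := by
  intro k
  refine (h (k + 1)).congr fun n => ?_
  rw [norm_mul, Complex.norm_intCast]
  ring

lemma RapidDecay.const_mul {α : ℤ → ℂ} (h : RapidDecay α) (a : ℂ) :
    RapidDecay fun n => a * α n :=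
  h.of_le ‖a‖ fun n => by rw [norm_mul]

lemma RapidDecay.add {α β : ℤ → ℂ} (h : RapidDecay α) (h' : RapidDecay β) :
    RapidDecay fun n => α n + β n := by
  intro k
  refine Summable.of_nonneg_of_le (fun n => by positivity) (fun n => ?_) ((h k).add (h' k))
  rw [← mul_add]
  gcongr
  exact norm_add_le _ _

lemma RapidDecay.affine_mul {α : ℤ → ℂ} (h : RapidDecay α) (a b : ℂ) :
    RapidDecay fun n => (a * n + b) * α n := by
  have := (h.int_mul.const_mul a).add (h.const_mul b)
  convert this using 2
  ring

lemma RapidDecay.shift {α : ℤ → ℂ} (h : RapidDecay α) (j : ℤ) :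
    RapidDecay fun n => α (n + j) := by
  intro k
  have hs : Summable fun n : ℤ => (|((n + j : ℤ) : ℝ)| + |(j : ℝ)|) ^ k * ‖α (n + j)‖ := by
    have : Summable fun n : ℤ => (|(n : ℝ)| + |(j : ℝ)|) ^ k * ‖α n‖ := by
      simp_rw [add_pow, Finset.sum_mul]
      refine summable_sum fun i _ => ?_
      refine ((h i).mul_left (|(j : ℝ)| ^ (k - i) * (k.choose i))).congr fun n => ?_
      ring
    exact this.comp_injective (add_left_injective j)
  refine Summable.of_nonneg_of_le (fun n => by positivity) (fun n => ?_) hs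
  gcongr
  push_cast
  calc |(n : ℝ)| = |((n : ℝ) + j) - j| := by ring_nf
    _ ≤ _ := abs_sub _ _

/-- The trigonometric series `∑ αₙ exp (i (2n + θ) v)`. -/
noncomputable def trigSeries (θ : ℤ) (α : ℤ → ℂ) (v : ℝ) : ℂ :=
  ∑' n : ℤ, α n * Complex.exp (Complex.I * (2 * n + θ) * v)

lemma norm_exp_phase (θ n : ℤ) (v : ℝ) :
    ‖Complex.exp (Complex.I * (2 * n + θ) * v)‖ = 1 := by
  have : Complex.I * (2 * n + θ) * v = (((2 * n + θ) * v : ℝ) : ℂ) * Complex.I := by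
    push_cast; ring
  rw [this, Complex.norm_exp_ofReal_mul_I]

lemma RapidDecay.summable_trig {α : ℤ → ℂ} (h : RapidDecay α) (θ : ℤ) (v : ℝ) :
    Summable fun n : ℤ => ‖α n * Complex.exp (Complex.I * (2 * n + θ) * v)‖ := by
  simpa [norm_mul, norm_exp_phase] using h.summable_norm

lemma RapidDecay.hasSum_trigSeries {α : ℤ → ℂ} (h : RapidDecay α) (θ : ℤ) (v : ℝ) :
    HasSum (fun n : ℤ => α n * Complex.exp (Complex.I * (2 * n + θ) * v)) (trigSeries θ α v) :=
  (h.summable_trig θ v).of_norm.hasSum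

lemma RapidDecay.hasDerivAt_trigSeries {α : ℤ → ℂ} (h : RapidDecay α) (θ : ℤ) (v : ℝ) :
    HasDerivAt (trigSeries θ α)
      (trigSeries θ (fun n => Complex.I * (2 * n + θ) * α n) v) v := by
  have h' : RapidDecay fun n => Complex.I * (2 * n + θ) * α n := by
    have := h.affine_mul (Complex.I * 2) (Complex.I * θ)
    convert this using 2
    ring
  refine hasDerivAt_tsum
    (g := fun (n : ℤ) (v : ℝ) => α n * Complex.exp (Complex.I * (2 * n + θ) * v))
    (g' := fun (n : ℤ) (v : ℝ) => Complex.I * (2 * n + θ) * α n *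
      Complex.exp (Complex.I * (2 * n + θ) * v))
    h'.summable_norm (y₀ := (0 : ℝ)) (fun n y => ?_) (fun n y => ?_) ?_ v
  · have h1 : HasDerivAt (fun v : ℝ => Complex.I * (2 * n + θ) * (v : ℂ))
        (Complex.I * (2 * n + θ) * 1) y := (hasDerivAt_id y).ofReal_comp.const_mul _
    have := (h1.cexp).const_mul (α n)
    exact this.congr_deriv (by ring)
  · rw [norm_mul, norm_exp_phase, mul_one]
  · exact (h.summable_trig θ 0).of_norm

lemma trigSeries_add {α β : ℤ → ℂ} (h : RapidDecay α) (h' : RapidDecay β) (θ : ℤ) (v : ℝ) :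
    trigSeries θ (fun n => α n + β n) v = trigSeries θ α v + trigSeries θ β v := by
  rw [trigSeries, trigSeries, trigSeries,
    ← (h.summable_trig θ v).of_norm.tsum_add (h'.summable_trig θ v).of_norm]
  exact tsum_congr fun n => by ring

lemma trigSeries_shift (α : ℤ → ℂ) (θ : ℤ) (j : ℤ) (v : ℝ) :
    trigSeries θ (fun n => α (n + j)) v = trigSeries (θ - 2 * j) α v := by
  rw [trigSeries, trigSeries, ← (Equiv.addRight j).tsum_eq
    (fun n : ℤ => α n * Complex.exp (Complex.I * (2 * n + (θ - 2 * j : ℤ)) * v))]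
  refine tsum_congr fun n => ?_
  simp only [Equiv.coe_addRight]
  congr 2
  push_cast
  ring

/-- Convolution of two-sided sequences. -/
noncomputable def conv (α β : ℤ → ℂ) (k : ℤ) : ℂ := ∑' m : ℤ, α m * β (k - m)

/-- The bijection `(k, m) ↦ (m, k - m)`. -/
def convEquiv : ℤ × ℤ ≃ ℤ × ℤ where
  toFun p := (p.2, p.1 - p.2)
  invFun p := (p.1 + p.2, p.1)
  left_inv p := by ext <;> simp
  right_inv p := by ext <;> simp

lemma summable_conv {α β : ℤ → ℂ} (h : Summable fun n => ‖α n‖) (h' : Summable fun n => ‖β n‖) :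
    Summable fun k => ‖conv α β k‖ := by
  have h2 : Summable fun p : ℤ × ℤ => ‖α p.2 * β (p.1 - p.2)‖ :=
    (convEquiv.summable_iff (f := fun p : ℤ × ℤ => ‖α p.1 * β p.2‖)).2 (h.mul_norm h')
  refine Summable.of_nonneg_of_le (fun _ => norm_nonneg _) (fun k => ?_) h2.prod
  exact norm_tsum_le_tsum_norm (h2.prod_factor k)

lemma trigSeries_mul {α β : ℤ → ℂ} (h : Summable fun n => ‖α n‖) (h' : Summable fun n => ‖β n‖)
    (θ φ : ℤ) (v : ℝ) :
    trigSeries θ α v * trigSeries φ β v = trigSeries (θ + φ) (conv α β) v := by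
  have h1 : Summable fun n : ℤ => ‖α n * Complex.exp (Complex.I * (2 * n + θ) * v)‖ := by
    simpa [norm_mul, norm_exp_phase] using h
  have h2 : Summable fun n : ℤ => ‖β n * Complex.exp (Complex.I * (2 * n + φ) * v)‖ := by
    simpa [norm_mul, norm_exp_phase] using h'
  have h3 := h1.mul_norm h2
  rw [trigSeries, trigSeries, tsum_mul_tsum_of_summable_norm h1 h2, ← convEquiv.tsum_eq,
    Summable.tsum_prod ((convEquiv.summable_iff).2 h3).of_norm, trigSeries]
  refine tsum_congr fun k => ?_
  rw [conv, ← tsum_mul_right]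
  refine tsum_congr fun m => ?_
  simp only [convEquiv, Equiv.coe_fn_mk]
  rw [mul_mul_mul_comm, ← Complex.exp_add]
  congr 2
  push_cast
  ring

lemma integral_trigSeries {γ : ℤ → ℂ} (h : Summable fun n => ‖γ n‖) :
    ∫ v in (0 : ℝ)..π, trigSeries 0 γ v = π * γ 0 := by
  have hs : HasSum (fun n : ℤ => ∫ v in (0 : ℝ)..π,
      γ n * Complex.exp (Complex.I * (2 * n + (0 : ℤ)) * v)) (∫ v in (0 : ℝ)..π, trigSeries 0 γ v) := by
    refine intervalIntegral.hasSum_integral_of_dominated_convergence (fun n _ => ‖γ n‖)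
      (fun n => ?_) (fun n => ?_) ?_ ?_ ?_
    · exact Continuous.aestronglyMeasurable (by fun_prop)
    · exact Filter.Eventually.of_forall fun v _ => by rw [norm_mul, norm_exp_phase, mul_one]
    · exact Filter.Eventually.of_forall fun v _ => h
    · exact intervalIntegrable_const
    · refine Filter.Eventually.of_forall fun v _ => ?_
      have h1 : Summable fun n : ℤ => ‖γ n * Complex.exp (Complex.I * (2 * n + (0 : ℤ)) * v)‖ := by
        simpa only [norm_mul, norm_exp_phase, mul_one] using h
      exact h1.of_norm.hasSum
  have hi : ∀ n : ℤ, n ≠ 0 → ∫ v in (0 : ℝ)..π,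
      γ n * Complex.exp (Complex.I * (2 * n + (0 : ℤ)) * v) = 0 := by
    intro n hn
    have hc : Complex.I * (2 * n + (0 : ℤ)) ≠ 0 := by
      simp [Complex.I_ne_zero, hn]
    rw [intervalIntegral.integral_const_mul, integral_exp_mul_complex hc]
    have : Complex.exp (Complex.I * (2 * n + (0 : ℤ)) * π) = 1 := by
      rw [Complex.exp_eq_one_iff]
      exact ⟨n, by push_cast; ring⟩
    rw [this]
    simp
  have h1 := hs.unique (hasSum_single 0 hi)
  rw [h1]
  simp

lemma inv_cosh_le (x : ℝ) : (cosh x)⁻¹ ≤ 2 * exp (-|x|) := by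
  rw [← cosh_abs x, cosh_eq, exp_neg, ← div_eq_mul_inv, inv_div]
  gcongr
  linarith [inv_pos.2 (exp_pos |x|)]

lemma inv_cosh_pos (x : ℝ) : 0 < (cosh x)⁻¹ := inv_pos.2 (cosh_pos x)

lemma inv_cosh_le_one (x : ℝ) : (cosh x)⁻¹ ≤ 1 := inv_le_one_of_one_le₀ (one_le_cosh x)

/-- The value `sech ((2n+1)y)`. -/
noncomputable def sc (y : ℝ) (n : ℤ) : ℝ := (cosh ((2 * n + 1) * y))⁻¹

/-- The value `csch (2my)`, with value `0` at `m = 0`. -/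
noncomputable def cs (y : ℝ) (m : ℤ) : ℝ := (sinh (2 * m * y))⁻¹

/-- The value `tanh ((2n+1)y)`. -/
noncomputable def th (y : ℝ) (n : ℤ) : ℝ := tanh ((2 * n + 1) * y)

lemma sc_pos (y : ℝ) (n : ℤ) : 0 < sc y n := inv_cosh_pos _

lemma sc_le_one (y : ℝ) (n : ℤ) : sc y n ≤ 1 := inv_cosh_le_one _

lemma sc_neg (y : ℝ) (n : ℤ) : sc y (-1 - n) = sc y n := by
  rw [sc, sc, ← cosh_neg]
  congr 2
  push_cast
  ring

lemma cs_neg (y : ℝ) (m : ℤ) : cs y (-m) = -cs y m := by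
  rw [cs, cs, ← inv_neg, ← sinh_neg]
  congr 2
  push_cast
  ring

lemma cs_zero (y : ℝ) : cs y 0 = 0 := by simp [cs]

lemma th_neg (y : ℝ) (n : ℤ) : th y (-1 - n) = -th y n := by
  rw [th, th, ← tanh_neg]
  congr 1
  push_cast
  ring

lemma abs_odd_ge (n : ℤ) : 2 * |(n : ℝ)| - 1 ≤ |2 * (n : ℝ) + 1| := by
  have := abs_sub_abs_le_abs_sub (2 * (n : ℝ)) (-1)
  rw [abs_mul, abs_neg, abs_one, abs_two, sub_neg_eq_add] at this
  exact this

lemma exp_odd_le {y : ℝ} (hy : 0 < y) (n : ℤ) :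
    exp (-|(2 * (n : ℝ) + 1) * y|) ≤ exp y * exp (-(2 * y * |(n : ℝ)|)) := by
  rw [← exp_add, exp_le_exp, abs_mul, abs_of_pos hy]
  nlinarith [abs_odd_ge n]

lemma rapidDecay_sc {y : ℝ} (hy : 0 < y) : RapidDecay fun n => (sc y n : ℂ) := by
  refine RapidDecay.of_le_exp (K := 2 * exp y) (δ := 2 * y) (by positivity) fun n => ?_
  rw [Complex.norm_real, norm_of_nonneg (sc_pos y n).le, mul_assoc]
  exact (inv_cosh_le _).trans (by gcongr; exact exp_odd_le hy n)

lemma sinh_two_mul_ne_zero {y : ℝ} (hy : 0 < y) {m : ℤ} (hm : m ≠ 0) : sinh (2 * m * y) ≠ 0 := by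
  rw [Ne, sinh_eq_zero]
  have : (m : ℝ) ≠ 0 := by exact_mod_cast hm
  positivity

lemma abs_cs_le {y : ℝ} (hy : 0 < y) (m : ℤ) :
    |cs y m| ≤ 2 / (1 - exp (-(4 * y))) * exp (-(2 * y * |(m : ℝ)|)) := by
  have hd : 0 < 1 - exp (-(4 * y)) := by
    rw [sub_pos, exp_lt_one_iff]; linarith
  rcases eq_or_ne m 0 with rfl | hm
  · rw [cs_zero, abs_zero]
    positivity
  have h1 : |cs y m| = (sinh (2 * |(m : ℝ)| * y))⁻¹ := by
    rw [cs, abs_inv, abs_sinh, abs_mul, abs_mul, abs_two, abs_of_pos hy]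
  have hm1 : (1 : ℝ) ≤ |(m : ℝ)| := by exact_mod_cast Int.one_le_abs hm
  have h2 : exp (2 * y * |(m : ℝ)|) * (1 - exp (-(4 * y))) / 2 ≤ sinh (2 * |(m : ℝ)| * y) := by
    rw [sinh_eq, mul_sub, mul_one, ← exp_add, show 2 * |(m : ℝ)| * y = 2 * y * |(m : ℝ)| by ring]
    have : exp (-(2 * y * |(m : ℝ)|)) ≤ exp (2 * y * |(m : ℝ)| + -(4 * y)) := by
      rw [exp_le_exp]; nlinarith
    linarith
  rw [h1]
  calc (sinh (2 * |(m : ℝ)| * y))⁻¹ ≤ (exp (2 * y * |(m : ℝ)|) * (1 - exp (-(4 * y))) / 2)⁻¹ := by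
        gcongr
    _ = _ := by
        rw [exp_neg (2 * y * |(m : ℝ)|)]
        field_simp

lemma rapidDecay_cs {y : ℝ} (hy : 0 < y) : RapidDecay fun m => (cs y m : ℂ) := by
  refine RapidDecay.of_le_exp (K := 2 / (1 - exp (-(4 * y)))) (δ := 2 * y) (by positivity)
    fun m => ?_
  rw [Complex.norm_real]
  exact abs_cs_le hy m

lemma summable_sc {y : ℝ} (hy : 0 < y) : Summable (sc y) := by
  simpa [abs_of_pos (sc_pos y _)] using (rapidDecay_sc hy).summable_norm

lemma summable_cs_mul {y : ℝ} (hy : 0 < y) (n : ℤ) :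
    Summable fun m => cs y m * sc y (n - m) := by
  refine Summable.of_norm_bounded (g := fun m => |cs y m|)
    (by simpa using (rapidDecay_cs hy).summable_norm) fun m => ?_
  rw [norm_mul, norm_of_nonneg (sc_pos _ _).le, norm_eq_abs]
  exact mul_le_of_le_one_right (abs_nonneg _) (sc_le_one _ _)

lemma summable_mul_cs_mul {y : ℝ} (hy : 0 < y) (n : ℤ) :
    Summable fun m : ℤ => 2 * m * cs y m * sc y (n - m) := by
  refine Summable.of_norm_bounded (g := fun m : ℤ => 2 * (|(m : ℝ)| ^ 1 * |cs y m|))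
    (by simpa using ((rapidDecay_cs hy) 1).mul_left 2) fun m => ?_
  rw [norm_mul, norm_of_nonneg (sc_pos _ _).le, norm_eq_abs, abs_mul, abs_mul, abs_two, pow_one,
    mul_assoc 2]
  exact mul_le_of_le_one_right (by positivity) (sc_le_one _ _)

lemma tanh_sub_tanh (a b : ℝ) : tanh a - tanh b = sinh (a - b) * ((cosh a)⁻¹ * (cosh b)⁻¹) := by
  have := (cosh_pos a).ne'
  have := (cosh_pos b).ne'
  rw [tanh_eq_sinh_div_cosh, tanh_eq_sinh_div_cosh, sinh_sub]
  field_simp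

lemma th_sub_th (y : ℝ) (n k : ℤ) :
    th y n - th y (n - k) = sinh (2 * k * y) * (sc y n * sc y (k - 1 - n)) := by
  rw [th, th, tanh_sub_tanh, sc, sc, ← cosh_neg ((2 * ((k - 1 - n : ℤ) : ℝ) + 1) * y)]
  congr 2
  · push_cast; ring
  · congr 3; push_cast; ring

lemma tendsto_tanh_atTop : Filter.Tendsto tanh Filter.atTop (nhds 1) := by
  have h : ∀ x, tanh x = 1 - exp (-x) * (cosh x)⁻¹ := fun x => by
    have := (cosh_pos x).ne'
    rw [tanh_eq_sinh_div_cosh, ← cosh_sub_sinh]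
    field_simp
    ring
  have h1 : Filter.Tendsto (fun x => exp (-x) * (cosh x)⁻¹) Filter.atTop (nhds 0) := by
    refine squeeze_zero (fun x => by positivity [inv_cosh_pos x]) (fun x => ?_)
      (tendsto_exp_neg_atTop_nhds_zero)
    exact mul_le_of_le_one_right (exp_pos _).le (inv_cosh_le_one x)
  simpa [funext h] using h1.const_sub 1

lemma tendsto_th {y : ℝ} (hy : 0 < y) :
    Filter.Tendsto (fun n : ℕ => th y n) Filter.atTop (nhds 1) := by
  refine tendsto_tanh_atTop.comp (Filter.Tendsto.atTop_mul_const hy ?_)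
  refine Filter.tendsto_atTop_add_const_right _ _ (Filter.Tendsto.const_mul_atTop two_pos ?_)
  simpa using tendsto_natCast_atTop_atTop

lemma summable_sc_mul {y : ℝ} (hy : 0 < y) (k : ℤ) :
    Summable fun n => sc y n * sc y (k - n) := by
  refine Summable.of_nonneg_of_le (fun n => (mul_pos (sc_pos _ _) (sc_pos _ _)).le)
    (fun n => ?_) (summable_sc hy)
  exact mul_le_of_le_one_right (sc_pos _ _).le (sc_le_one _ _)

lemma summable_th_sub {y : ℝ} (hy : 0 < y) (k : ℤ) :
    Summable fun n => th y n - th y (n - k) := by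
  simp_rw [th_sub_th]
  exact (summable_sc_mul hy _).mul_left _

lemma hasSum_th_sub_one {y : ℝ} (hy : 0 < y) : HasSum (fun n => th y n - th y (n - 1)) 2 := by
  have hs := summable_th_sub hy 1
  have h1 := hs.hasSum.nat_add_neg_add_one.tendsto_sum_nat
  have h2 : ∀ N : ℕ, ∑ n ∈ Finset.range N, ((th y n - th y (n - 1)) +
      (th y (-(n + 1)) - th y (-(n + 1) - 1))) = th y N + th y (N - 1 : ℤ) := by
    intro N
    induction N with
    | zero =>
      have := th_neg y 0
      simp_all
    | succ N ih =>
      rw [Finset.sum_range_succ, ih, show (-((N : ℤ) + 1)) = -1 - N by ring, th_neg,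
        show (-1 - (N : ℤ) - 1) = -1 - (N + 1 : ℤ) by ring, th_neg]
      push_cast
      rw [add_sub_cancel_right]
      ring
  have h3 : Filter.Tendsto (fun N : ℕ => th y N + th y (N - 1 : ℤ)) Filter.atTop (nhds (1 + 1)) := by
    refine (tendsto_th hy).add ?_
    rw [← Filter.tendsto_add_atTop_iff_nat 1]
    simpa using tendsto_th hy
  rw [one_add_one_eq_two] at h3
  rw [Filter.tendsto_congr h2] at h1
  rw [← tendsto_nhds_unique h1 h3]
  exact hs.hasSum

lemma int_ext_of_step {f g : ℤ → ℝ} (h0 : f 0 = g 0) (h : ∀ n, f (n + 1) - f n = g (n + 1) - g n)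
    (n : ℤ) : f n = g n := by
  induction n using Int.induction_on with
  | zero => exact h0
  | succ n ih => linarith [h n]
  | pred n ih =>
    have := h (-n - 1)
    rw [sub_add_cancel] at this
    linarith

lemma tsum_th_sub {y : ℝ} (hy : 0 < y) (k : ℤ) : ∑' n, (th y n - th y (n - k)) = 2 * k := by
  refine int_ext_of_step (f := fun k => ∑' n, (th y n - th y (n - k))) (g := fun k => 2 * (k : ℝ))
    (by simp) (fun k => ?_) k
  have h := (Equiv.subRight k).hasSum_iff.2 (hasSum_th_sub_one hy)
  rw [← (summable_th_sub hy _).tsum_sub (summable_th_sub hy _)]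
  have : (fun n => th y n - th y (n - (k + 1)) - (th y n - th y (n - k))) =
      (fun n => th y n - th y (n - 1)) ∘ Equiv.subRight k := by
    ext n
    simp only [Function.comp_apply, Equiv.subRight_apply, sub_sub]
    ring
  rw [this, h.tsum_eq]
  push_cast
  ring

/-- The convolution of `sech` with itself over odd multiples of `y`. -/
lemma tsum_sc_mul_sc {y : ℝ} (hy : 0 < y) {k : ℤ} (hk : k ≠ 0) :
    ∑' n, sc y n * sc y (k - 1 - n) = 2 * k * cs y k := by
  have h := tsum_th_sub hy k
  simp_rw [th_sub_th, tsum_mul_left] at h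
  rw [← h, cs]
  field_simp [sinh_two_mul_ne_zero hy hk]

/-- `coth (2my) + tanh ((2(n-m)+1)y)`, where `coth 0` is read as `0`. -/
noncomputable def cothAddTh (y : ℝ) (n m : ℤ) : ℝ := cosh (2 * m * y) * cs y m + th y (n - m)

lemma cothAddTh_of_ne_zero {y : ℝ} (hy : 0 < y) (n : ℤ) {m : ℤ} (hm : m ≠ 0) :
    cothAddTh y n m = cosh ((2 * n + 1) * y) * (cs y m * sc y (n - m)) := by
  have h1 := sinh_two_mul_ne_zero hy hm
  have h2 := (cosh_pos ((2 * ((n - m : ℤ) : ℝ) + 1) * y)).ne'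
  rw [cothAddTh, cs, sc, th, tanh_eq_sinh_div_cosh]
  have : (2 * (n : ℝ) + 1) * y = 2 * m * y + (2 * ((n - m : ℤ) : ℝ) + 1) * y := by
    push_cast; ring
  rw [this, cosh_add]
  field_simp

lemma cothAddTh_zero (y : ℝ) (n : ℤ) : cothAddTh y n 0 = th y n := by
  simp [cothAddTh, cs_zero]

lemma cothAddTh_eq {y : ℝ} (hy : 0 < y) (n m : ℤ) :
    cothAddTh y n m =
      cosh ((2 * n + 1) * y) * (cs y m * sc y (n - m)) + if m = 0 then th y n else 0 := by
  rcases eq_or_ne m 0 with rfl | hm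
  · simp [cothAddTh_zero, cs_zero]
  · simp [cothAddTh_of_ne_zero hy n hm, hm]

lemma summable_cothAddTh {y : ℝ} (hy : 0 < y) (n : ℤ) : Summable (cothAddTh y n) := by
  rw [funext (cothAddTh_eq hy n)]
  exact ((summable_cs_mul hy n).mul_left _).add (hasSum_ite_eq 0 (th y n)).summable

lemma cothAddTh_succ_sub (y : ℝ) (n m : ℤ) :
    cothAddTh y (n + 1) m - cothAddTh y n m = th y (n + 1 - m) - th y (n + 1 - m - 1) := by
  rw [cothAddTh, cothAddTh, add_sub_add_left_eq_sub]
  congr 2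
  ring

lemma tsum_cothAddTh {y : ℝ} (hy : 0 < y) (n : ℤ) : ∑' m, cothAddTh y n m = 2 * n + 1 := by
  have hstep : ∀ n, ∑' m, cothAddTh y (n + 1) m - ∑' m, cothAddTh y n m = 2 := fun n => by
    rw [← (summable_cothAddTh hy _).tsum_sub (summable_cothAddTh hy _)]
    simp_rw [cothAddTh_succ_sub]
    exact ((Equiv.subLeft (n + 1)).hasSum_iff.2 (hasSum_th_sub_one hy)).tsum_eq
  have h0 : ∑' m, cothAddTh y (-1) m = -∑' m, cothAddTh y 0 m := by
    rw [← (Equiv.neg ℤ).tsum_eq, ← tsum_neg]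
    refine tsum_congr fun m => ?_
    rw [cothAddTh, cothAddTh, Equiv.neg_apply, cs_neg, show (-1 : ℤ) - -m = -1 - (0 - m) by ring,
      th_neg, ← cosh_neg]
    push_cast
    ring_nf
  refine int_ext_of_step (f := fun n => ∑' m, cothAddTh y n m) (g := fun n => 2 * (n : ℝ) + 1) ?_
    (fun n => ?_) n
  · have := hstep (-1)
    rw [neg_add_cancel] at this
    simp only [Int.cast_zero]
    linarith
  · rw [hstep]
    push_cast
    ring

/-- The convolution of `csch` over even multiples with `sech` over odd multiples of `y`. -/
lemma tsum_cs_mul_sc {y : ℝ} (hy : 0 < y) (n : ℤ) :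
    ∑' m, cs y m * sc y (n - m) = sc y n * (2 * n + 1 - th y n) := by
  have h := tsum_cothAddTh hy n
  rw [funext (cothAddTh_eq hy n), ((summable_cs_mul hy n).mul_left _).tsum_add
    (hasSum_ite_eq 0 (th y n)).summable, tsum_mul_left, tsum_ite_eq] at h
  have hc := (cosh_pos ((2 * (n : ℝ) + 1) * y)).ne'
  rw [← h, sc]
  field_simp
  ring

/-- The quasimodular constant in the convolution of `2m csch (2my)` with `sech`. -/
noncomputable def quasiConst (y : ℝ) : ℝ :=
  cosh y * ∑' m : ℤ, 2 * m * cs y m * sc y (0 - m) - 1 / 2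

lemma summable_mul_th_sub {y : ℝ} (hy : 0 < y) :
    Summable fun n : ℤ => (n : ℝ) * (th y n - th y (n - 1)) := by
  simp_rw [th_sub_th]
  have h : Summable fun n : ℤ => |(n : ℝ)| ^ 1 * sc y n := by
    simpa [abs_of_pos (sc_pos y _)] using rapidDecay_sc hy 1
  refine Summable.of_norm_bounded (h.mul_left (|sinh (2 * (1 : ℤ) * y)|)) fun n => ?_
  rw [norm_mul, norm_mul, norm_mul, norm_of_nonneg (sc_pos _ _).le, norm_of_nonneg (sc_pos _ _).le,
    norm_eq_abs, norm_eq_abs, pow_one, mul_left_comm]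
  gcongr
  exact mul_le_of_le_one_right (sc_pos _ _).le (sc_le_one _ _)

lemma tsum_mul_th_sub (y : ℝ) : ∑' n : ℤ, (n : ℝ) * (th y n - th y (n - 1)) = 0 := by
  have h : ∑' n : ℤ, (n : ℝ) * (th y n - th y (n - 1)) =
      -∑' n : ℤ, (n : ℝ) * (th y n - th y (n - 1)) := by
    nth_rw 1 [← (Equiv.neg ℤ).tsum_eq]
    rw [← tsum_neg]
    refine tsum_congr fun n => ?_
    rw [Equiv.neg_apply, show -n = -1 - (n - 1) by ring, th_neg,
      show -1 - (n - 1) - 1 = -1 - n by ring, th_neg]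
    push_cast
    ring
  linarith

lemma tsum_mul_cs_mul_sc {y : ℝ} (hy : 0 < y) (n : ℤ) :
    ∑' m : ℤ, 2 * m * cs y m * sc y (n - m) =
      sc y n * ((2 * n + 1) ^ 2 / 2 + quasiConst y) := by
  have hf : ∀ n m : ℤ, cosh ((2 * n + 1) * y) * (2 * m * cs y m * sc y (n - m)) =
      2 * m * cothAddTh y n m := fun n m => by
    rcases eq_or_ne m 0 with rfl | hm
    · simp
    · rw [cothAddTh_of_ne_zero hy n hm]
      ring
  have hs : ∀ n, Summable fun m : ℤ => 2 * (m : ℝ) * cothAddTh y n m := fun n => by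
    simp_rw [← hf]
    exact (summable_mul_cs_mul hy n).mul_left _
  have hstep : ∀ n : ℤ, ∑' m : ℤ, 2 * (m : ℝ) * cothAddTh y (n + 1) m -
      ∑' m : ℤ, 2 * (m : ℝ) * cothAddTh y n m = 4 * (n + 1) := fun n => by
    rw [← (hs _).tsum_sub (hs _)]
    simp_rw [← mul_sub, cothAddTh_succ_sub]
    have h1 := ((hasSum_th_sub_one hy).mul_left (2 * (n + 1 : ℝ))).sub
      ((summable_mul_th_sub hy).hasSum.mul_left 2)
    rw [tsum_mul_th_sub] at h1
    have h2 := (Equiv.subLeft (n + 1)).hasSum_iff.2 h1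
    convert h2.tsum_eq using 1
    · refine tsum_congr fun m => ?_
      simp only [Function.comp_apply, Equiv.subLeft_apply]
      push_cast
      ring
    · ring
  have key : ∑' m : ℤ, 2 * (m : ℝ) * cothAddTh y n m = (2 * n + 1) ^ 2 / 2 + quasiConst y := by
    refine int_ext_of_step (f := fun n => ∑' m : ℤ, 2 * (m : ℝ) * cothAddTh y n m)
      (g := fun n => (2 * (n : ℝ) + 1) ^ 2 / 2 + quasiConst y) ?_ (fun n => ?_) n
    · simp only [quasiConst, ← hf, tsum_mul_left]
      simp
    · rw [hstep]
      push_cast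
      ring
  have hc := (cosh_pos ((2 * (n : ℝ) + 1) * y)).ne'
  simp_rw [← hf, tsum_mul_left] at key
  rw [← key, sc]
  field_simp

/-- `∑ sech² ((2n+1)y)`. -/
noncomputable def sechSq (y : ℝ) : ℝ := ∑' n, sc y n ^ 2

/-- `∑ sech ((2n+1)y)`. -/
noncomputable def sechSum (y : ℝ) : ℝ := ∑' n, sc y n

/-- `∑ (-1)ⁿ (2n+1) sech ((2n+1)y)`. -/
noncomputable def altSum (y : ℝ) : ℝ := ∑' n : ℤ, (-1 : ℝ) ^ n * ((2 * n + 1) * sc y n)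

/-- The coefficient of the linear term in the differential equation of `cnSeries`. -/
noncomputable def lam (y : ℝ) : ℝ := 2 * (sechSq y + quasiConst y)

/-- The Fourier series of a multiple of the Jacobi elliptic function `cn`. -/
noncomputable def cnSeries (y : ℝ) : ℝ → ℂ := trigSeries 1 fun n => sc y n

/-- The derivative of `cnSeries`. -/
noncomputable def cnDeriv (y : ℝ) : ℝ → ℂ :=
  trigSeries 1 fun n => Complex.I * (2 * n + (1 : ℤ)) * sc y n

/-- The Fourier series of a multiple of the Jacobi zeta function. -/
noncomputable def zetaSeries (y : ℝ) : ℝ → ℂ := trigSeries 0 fun m => -Complex.I * cs y m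

/-- The Fourier coefficients of the square of `cnSeries`. -/
noncomputable def sqCoeff (y : ℝ) (m : ℤ) : ℂ :=
  (2 * m) * cs y m + if m = 0 then (sechSq y : ℂ) else 0

lemma rapidDecay_sqCoeff {y : ℝ} (hy : 0 < y) : RapidDecay (sqCoeff y) := by
  have h1 : RapidDecay fun m : ℤ => (2 * (m : ℂ) + 0) * cs y m := (rapidDecay_cs hy).affine_mul 2 0
  have h2 : RapidDecay fun m : ℤ => if m = 0 then (sechSq y : ℂ) else 0 := fun k => by
    refine summable_of_ne_finset_zero (s := {0}) fun m hm => ?_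
    rw [Finset.mem_singleton] at hm
    simp [hm]
  convert h1.add h2 using 2
  rw [sqCoeff, add_zero]

lemma rapidDecay_deriv {α : ℤ → ℂ} (h : RapidDecay α) (θ : ℤ) :
    RapidDecay fun n => Complex.I * (2 * n + θ) * α n := by
  have := h.affine_mul (Complex.I * 2) (Complex.I * θ)
  convert this using 2
  ring

lemma conv_sc_sc {y : ℝ} (hy : 0 < y) (k : ℤ) :
    conv (fun n => (sc y n : ℂ)) (fun n => (sc y (n + -1) : ℂ)) k = sqCoeff y k := by
  rw [conv, sqCoeff]
  rcases eq_or_ne k 0 with rfl | hk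
  · rw [if_pos rfl, sechSq, Complex.ofReal_tsum]
    simp only [Int.cast_zero, mul_zero, zero_mul, zero_add]
    refine tsum_congr fun n => ?_
    rw [show 0 - n + -1 = -1 - n by ring, sc_neg, sq, Complex.ofReal_mul]
  · rw [if_neg hk, add_zero]
    have h := (Complex.ofReal_tsum (L := .unconditional ℤ)
      fun n => sc y n * sc y (k - 1 - n)).symm
    rw [tsum_sc_mul_sc hy hk] at h
    push_cast at h
    rw [← h]
    refine tsum_congr fun n => ?_
    rw [show k - n + -1 = k - 1 - n by ring]

lemma cnSeries_sq {y : ℝ} (hy : 0 < y) (v : ℝ) : cnSeries y v ^ 2 = trigSeries 0 (sqCoeff y) v := by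
  have h := rapidDecay_sc hy
  have hshift : trigSeries (-1) (fun n => (sc y (n + -1) : ℂ)) v = cnSeries y v := by
    rw [trigSeries_shift (fun n => (sc y n : ℂ)) (-1) (-1) v]
    norm_num [cnSeries]
  calc cnSeries y v ^ 2
      = trigSeries 1 (fun n => (sc y n : ℂ)) v * trigSeries (-1) (fun n => (sc y (n + -1) : ℂ)) v := by
        rw [hshift, sq, cnSeries]
    _ = _ := by
        rw [trigSeries_mul h.summable_norm (h.shift (-1)).summable_norm, add_neg_cancel]
        exact congrArg (fun γ => trigSeries 0 γ v) (funext (conv_sc_sc hy))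

lemma cnSeries_sq_eq {y : ℝ} (hy : 0 < y) (v : ℝ) :
    cnSeries y v ^ 2 = trigSeries 0 (fun m => Complex.I * (2 * m + (0 : ℤ)) *
      (-Complex.I * cs y m)) v + sechSq y := by
  rw [cnSeries_sq hy]
  have h1 : RapidDecay fun m : ℤ => (2 * (m : ℂ) + 0) * cs y m := (rapidDecay_cs hy).affine_mul 2 0
  have h2 : RapidDecay fun m : ℤ => if m = 0 then (sechSq y : ℂ) else 0 := fun k => by
    refine summable_of_ne_finset_zero (s := {0}) fun m hm => ?_
    rw [Finset.mem_singleton] at hm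
    simp [hm]
  have h3 := trigSeries_add h1 h2 0 v
  have h4 : trigSeries 0 (fun m : ℤ => if m = 0 then (sechSq y : ℂ) else 0) v = sechSq y := by
    rw [trigSeries, tsum_eq_single 0 fun m hm => by simp [hm]]
    simp
  rw [h4] at h3
  convert h3 using 2
  · ext m; simp [sqCoeff]
  · congr 1
    ext m
    push_cast
    linear_combination (-(2 * m + 0) * cs y m : ℂ) * Complex.I_sq

lemma hasDerivAt_cnSeries {y : ℝ} (hy : 0 < y) (v : ℝ) :
    HasDerivAt (cnSeries y) (cnDeriv y v) v :=
  (rapidDecay_sc hy).hasDerivAt_trigSeries 1 v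

lemma hasDerivAt_zetaSeries {y : ℝ} (hy : 0 < y) (v : ℝ) :
    HasDerivAt (zetaSeries y) (cnSeries y v ^ 2 - sechSq y) v := by
  rw [cnSeries_sq_eq hy, add_sub_cancel_right]
  exact ((rapidDecay_cs hy).const_mul _).hasDerivAt_trigSeries 0 v

/-- The differential equation `c'' = λ c - 2 c³`, with `c''` given by its Fourier series. -/
lemma cnSeries_ode {y : ℝ} (hy : 0 < y) (v : ℝ) :
    trigSeries 1 (fun n => Complex.I * (2 * n + (1 : ℤ)) * (Complex.I * (2 * n + (1 : ℤ)) *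
      sc y n)) v = lam y * cnSeries y v - 2 * cnSeries y v ^ 3 := by
  have h := rapidDecay_sc hy
  have h3 : cnSeries y v ^ 3 = trigSeries 1 (conv (sqCoeff y) fun n => (sc y n : ℂ)) v := by
    rw [pow_succ, cnSeries_sq hy, cnSeries,
      trigSeries_mul (rapidDecay_sqCoeff hy).summable_norm h.summable_norm, zero_add]
  have hc : ∀ n, conv (sqCoeff y) (fun n => (sc y n : ℂ)) n =
      sc y n * ((2 * n + 1) ^ 2 / 2 + quasiConst y + sechSq y) := by
    intro n
    have h1 := ((summable_mul_cs_mul hy n).hasSum)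
    rw [tsum_mul_cs_mul_sc hy n] at h1
    have h2 := (Complex.hasSum_ofReal.2 h1).add (hasSum_ite_eq (0 : ℤ) ((sechSq y * sc y n : ℂ)))
    rw [conv]
    convert h2.tsum_eq using 1
    · refine tsum_congr fun m => ?_
      rw [sqCoeff]
      split_ifs with hm
      · subst hm; simp
      · push_cast; ring
    · push_cast; ring
  have h2 := (((rapidDecay_deriv (rapidDecay_deriv h 1) 1).hasSum_trigSeries 1 v).sub
    ((h.hasSum_trigSeries 1 v).mul_left (lam y : ℂ)))
  have hsum : Summable fun n : ℤ => conv (sqCoeff y) (fun n => (sc y n : ℂ)) n *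
      Complex.exp (Complex.I * (2 * n + (1 : ℤ)) * v) := by
    have := summable_conv (rapidDecay_sqCoeff hy).summable_norm h.summable_norm
    refine Summable.of_norm ?_
    simpa only [norm_mul, norm_exp_phase, mul_one] using this
  have h4 := h2.add (hsum.hasSum.mul_left 2)
  have h5 : trigSeries 1 (fun n => Complex.I * (2 * n + (1 : ℤ)) * (Complex.I * (2 * n + (1 : ℤ)) *
      sc y n)) v - lam y * cnSeries y v + 2 * cnSeries y v ^ 3 = 0 := by
    rw [h3, trigSeries, cnSeries, trigSeries]
    refine h4.unique ?_
    convert hasSum_zero with n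
    rw [hc, lam]
    push_cast
    linear_combination ((2 * n + 1) ^ 2 * sc y n *
      Complex.exp (Complex.I * (2 * n + 1) * v) : ℂ) * Complex.I_sq
  linear_combination h5

lemma hasDerivAt_cnDeriv {y : ℝ} (hy : 0 < y) (v : ℝ) :
    HasDerivAt (cnDeriv y) (lam y * cnSeries y v - 2 * cnSeries y v ^ 3) v := by
  rw [← cnSeries_ode hy]
  exact (rapidDecay_deriv (rapidDecay_sc hy) 1).hasDerivAt_trigSeries 1 v

lemma abs_th_le_one (y : ℝ) (n : ℤ) : |th y n| ≤ 1 := (abs_tanh_lt_one _).le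

/-- The termwise derivative of `cnSeries` in the parameter `y`. -/
noncomputable def cnParamDeriv (y : ℝ) : ℝ → ℂ :=
  trigSeries 1 fun n => -((2 * n + 1) * sc y n * th y n)

lemma rapidDecay_cnParamDeriv {y : ℝ} (hy : 0 < y) :
    RapidDecay fun n : ℤ => (-((2 * n + 1) * sc y n * th y n) : ℂ) := by
  refine ((rapidDecay_sc hy).affine_mul 2 1).of_le 1 fun n => ?_
  rw [norm_neg, norm_mul, one_mul, Complex.norm_real]
  exact mul_le_of_le_one_right (norm_nonneg _) (abs_th_le_one y n)

/-- The heat-type equation `∂c/∂y = c' Z + c''/2 + C c`. -/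
lemma cnParamDeriv_eq {y : ℝ} (hy : 0 < y) (v : ℝ) :
    cnParamDeriv y v = cnDeriv y v * zetaSeries y v +
      (lam y * cnSeries y v - 2 * cnSeries y v ^ 3) / 2 + quasiConst y * cnSeries y v := by
  have h := rapidDecay_sc hy
  have hz : RapidDecay fun m : ℤ => -Complex.I * cs y m := (rapidDecay_cs hy).const_mul _
  have hd := rapidDecay_deriv h 1
  have h1 : cnDeriv y v * zetaSeries y v = trigSeries 1
      (conv (fun m : ℤ => -Complex.I * cs y m)
        (fun n : ℤ => Complex.I * (2 * n + (1 : ℤ)) * sc y n)) v := by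
    rw [mul_comm, zetaSeries, cnDeriv, trigSeries_mul hz.summable_norm hd.summable_norm, zero_add]
  have hc : ∀ n : ℤ, conv (fun m : ℤ => -Complex.I * cs y m)
        (fun n : ℤ => Complex.I * (2 * n + (1 : ℤ)) * sc y n) n =
      sc y n * ((2 * n + 1) * (2 * n + 1 - th y n) - ((2 * n + 1) ^ 2 / 2 + quasiConst y)) := by
    intro n
    have h2 := ((summable_cs_mul hy n).hasSum.mul_left (2 * (n : ℝ) + 1)).sub
      (summable_mul_cs_mul hy n).hasSum
    rw [tsum_cs_mul_sc hy, tsum_mul_cs_mul_sc hy] at h2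
    rw [conv]
    convert (Complex.hasSum_ofReal.2 h2).tsum_eq using 1
    · refine tsum_congr fun m => ?_
      push_cast
      linear_combination (-(2 * (n - m) + 1) * cs y m * sc y (n - m) : ℂ) * Complex.I_sq
    · push_cast; ring
  rw [h1, ← cnSeries_ode hy]
  have hs2 := (rapidDecay_deriv hd 1).hasSum_trigSeries 1 v
  have hsum : Summable fun n : ℤ => conv (fun m : ℤ => -Complex.I * cs y m)
        (fun n : ℤ => Complex.I * (2 * n + (1 : ℤ)) * sc y n) n *
      Complex.exp (Complex.I * (2 * n + (1 : ℤ)) * v) := by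
    have := summable_conv hz.summable_norm hd.summable_norm
    refine Summable.of_norm ?_
    simpa only [norm_mul, norm_exp_phase, mul_one] using this
  have h4 := (hsum.hasSum.add (hs2.mul_left (1 / 2))).add
    ((h.hasSum_trigSeries 1 v).mul_left (quasiConst y : ℂ))
  have h5 := (rapidDecay_cnParamDeriv hy).hasSum_trigSeries 1 v
  have h6 := h5.unique (h4.congr_fun fun n => ?_)
  · rw [cnParamDeriv, h6, cnSeries, ← trigSeries]
    ring
  · rw [hc]
    push_cast
    linear_combination (-(2 * n + 1) ^ 2 / 2 * sc y n *
      Complex.exp (Complex.I * (2 * n + 1) * v) : ℂ) * Complex.I_sq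

lemma tsum_eq_zero_of_reflect {f : ℤ → ℂ} (a : ℤ) (h : ∀ n, f (a - n) = -f n) : ∑' n, f n = 0 := by
  have h1 := (Equiv.subLeft a).tsum_eq f
  simp only [Equiv.subLeft_apply, h, tsum_neg] at h1
  linear_combination (-1 / 2 : ℂ) * h1

lemma exp_odd_pi_div_two (n : ℤ) :
    Complex.exp (Complex.I * (2 * n + (1 : ℤ)) * (π / 2 : ℝ)) = Complex.I * (-1) ^ n := by
  have : Complex.I * (2 * n + (1 : ℤ)) * (π / 2 : ℝ) =
      n * (π * Complex.I) + π / 2 * Complex.I := by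
    push_cast; ring
  rw [this, Complex.exp_add, Complex.exp_int_mul, Complex.exp_pi_mul_I, Complex.exp_pi_div_two_mul_I]
  ring

lemma exp_even_pi_div_two (n : ℤ) :
    Complex.exp (Complex.I * (2 * n + (0 : ℤ)) * (π / 2 : ℝ)) = (-1) ^ n := by
  have : Complex.I * (2 * n + (0 : ℤ)) * (π / 2 : ℝ) = n * (π * Complex.I) := by
    push_cast; ring
  rw [this, Complex.exp_int_mul, Complex.exp_pi_mul_I]

lemma exp_even_pi (n : ℤ) : Complex.exp (Complex.I * (2 * n + (0 : ℤ)) * π) = 1 := by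
  rw [Complex.exp_eq_one_iff]
  exact ⟨n, by push_cast; ring⟩

lemma exp_odd_pi (n : ℤ) : Complex.exp (Complex.I * (2 * n + (1 : ℤ)) * π) = -1 := by
  have : Complex.I * (2 * n + (1 : ℤ)) * π = Complex.I * (2 * n + (0 : ℤ)) * π + π * Complex.I := by
    push_cast; ring
  rw [this, Complex.exp_add, exp_even_pi, Complex.exp_pi_mul_I, one_mul]

lemma neg_one_zpow_reflect {K : Type*} [Field K] (n : ℤ) : (-1 : K) ^ (-1 - n) = -(-1) ^ n := by
  have h : (-1 : K) ≠ 0 := neg_ne_zero.2 one_ne_zero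
  rw [zpow_sub₀ h, zpow_neg_one, inv_neg_one, neg_div, one_div, ← inv_zpow, inv_neg_one]

lemma cnSeries_zero (y : ℝ) : cnSeries y 0 = sechSum y := by
  rw [cnSeries, trigSeries, sechSum, Complex.ofReal_tsum]
  simp

lemma cnDeriv_zero (y : ℝ) : cnDeriv y 0 = 0 := by
  rw [cnDeriv, trigSeries]
  refine tsum_eq_zero_of_reflect (-1) fun n => ?_
  rw [sc_neg]
  simp
  ring

lemma cnDeriv_pi (y : ℝ) : cnDeriv y π = 0 := by
  rw [cnDeriv, trigSeries]
  refine tsum_eq_zero_of_reflect (-1) fun n => ?_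
  rw [sc_neg, exp_odd_pi, exp_odd_pi]
  push_cast
  ring

lemma zetaSeries_zero (y : ℝ) : zetaSeries y 0 = 0 := by
  rw [zetaSeries, trigSeries]
  refine tsum_eq_zero_of_reflect 0 fun n => ?_
  rw [zero_sub, cs_neg]
  simp

lemma zetaSeries_pi (y : ℝ) : zetaSeries y π = 0 := by
  rw [zetaSeries, trigSeries]
  refine tsum_eq_zero_of_reflect 0 fun n => ?_
  rw [zero_sub, cs_neg, exp_even_pi, exp_even_pi]
  simp

lemma zetaSeries_pi_div_two (y : ℝ) : zetaSeries y (π / 2 : ℝ) = 0 := by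
  rw [zetaSeries, trigSeries]
  refine tsum_eq_zero_of_reflect 0 fun n => ?_
  rw [zero_sub, cs_neg, exp_even_pi_div_two, exp_even_pi_div_two, zpow_neg, ← inv_zpow, inv_neg_one]
  simp

lemma cnSeries_pi_div_two (y : ℝ) : cnSeries y (π / 2 : ℝ) = 0 := by
  rw [cnSeries, trigSeries]
  refine tsum_eq_zero_of_reflect (-1) fun n => ?_
  rw [sc_neg, exp_odd_pi_div_two, exp_odd_pi_div_two, neg_one_zpow_reflect]
  ring

lemma cnDeriv_pi_div_two (y : ℝ) : cnDeriv y (π / 2 : ℝ) = -altSum y := by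
  rw [cnDeriv, trigSeries, altSum, Complex.ofReal_tsum, ← tsum_neg]
  refine tsum_congr fun n => ?_
  rw [exp_odd_pi_div_two]
  push_cast
  linear_combination ((-1) ^ n * (2 * n + 1) * sc y n : ℂ) * Complex.I_sq

/-- The first integral of the differential equation of `cnSeries`. -/
lemma cnDeriv_sq {y : ℝ} (hy : 0 < y) (v : ℝ) :
    cnDeriv y v ^ 2 = lam y * cnSeries y v ^ 2 - cnSeries y v ^ 4 + altSum y ^ 2 := by
  have hd : ∀ v, HasDerivAt (fun v => cnDeriv y v ^ 2 - lam y * cnSeries y v ^ 2 + cnSeries y v ^ 4)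
      0 v := fun v => by
    have h1 := hasDerivAt_cnSeries hy v
    have h2 := hasDerivAt_cnDeriv hy v
    refine (((h2.pow 2).sub ((h1.pow 2).const_mul (lam y : ℂ))).add (h1.pow 4)).congr_deriv ?_
    push_cast
    ring
  have h := is_const_of_deriv_eq_zero (fun v => (hd v).differentiableAt) (fun v => (hd v).deriv)
    v (π / 2 : ℝ)
  rw [cnSeries_pi_div_two, cnDeriv_pi_div_two] at h
  linear_combination h

lemma sechSum_pow_four {y : ℝ} (hy : 0 < y) :
    sechSum y ^ 4 = lam y * sechSum y ^ 2 + altSum y ^ 2 := by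
  have h := cnDeriv_sq hy 0
  rw [cnDeriv_zero, cnSeries_zero] at h
  have : (sechSum y : ℂ) ^ 4 = lam y * sechSum y ^ 2 + altSum y ^ 2 := by linear_combination h
  exact_mod_cast this

lemma tsum_sc_mul_th {y : ℝ} (hy : 0 < y) :
    ∑' n : ℤ, -((2 * n + 1) * sc y n * th y n) =
      sechSum y * (lam y / 2 - sechSum y ^ 2 + quasiConst y) := by
  have h := cnParamDeriv_eq hy 0
  rw [cnDeriv_zero, cnSeries_zero, cnParamDeriv, trigSeries] at h
  have h1 : ((∑' n : ℤ, -((2 * n + 1) * sc y n * th y n) : ℝ) : ℂ) =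
      sechSum y * (lam y / 2 - sechSum y ^ 2 + quasiConst y) := by
    rw [Complex.ofReal_tsum]
    simp only [Complex.ofReal_zero, mul_zero, Complex.exp_zero, mul_one, zero_mul, zero_add] at h
    push_cast
    linear_combination h
  exact_mod_cast h1

lemma tsum_alt_sq_mul_sc_mul_th {y : ℝ} (hy : 0 < y) :
    ∑' n : ℤ, (-1 : ℝ) ^ n * (-((2 * n + 1) ^ 2 * (sc y n * th y n))) =
      (lam y - 2 * sechSq y) * altSum y := by
  have h1 := (rapidDecay_cnParamDeriv hy).hasDerivAt_trigSeries 1 (π / 2 : ℝ)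
  have hc := hasDerivAt_cnSeries hy (π / 2 : ℝ)
  have h2 := (((hasDerivAt_cnDeriv hy (π / 2 : ℝ)).mul (hasDerivAt_zetaSeries hy (π / 2 : ℝ))).add
    ((((hc.const_mul (lam y : ℂ)).sub ((hc.pow 3).const_mul 2))).div_const 2)).add
    (hc.const_mul (quasiConst y : ℂ))
  have h3 := h1.unique (h2.congr_of_eventuallyEq
    (Filter.Eventually.of_forall fun v => cnParamDeriv_eq hy v))
  rw [cnSeries_pi_div_two, cnDeriv_pi_div_two, zetaSeries_pi_div_two, trigSeries] at h3
  have h4 : ((∑' n : ℤ, (-1 : ℝ) ^ n * (-((2 * n + 1) ^ 2 * (sc y n * th y n))) : ℝ) : ℂ) =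
      (lam y - 2 * sechSq y) * altSum y := by
    have h5 : (lam y : ℂ) = 2 * (sechSq y + quasiConst y) := by rw [lam]; push_cast; ring
    rw [Complex.ofReal_tsum]
    trans -(-(altSum y) * (0 ^ 2 - sechSq y) + lam y * -(altSum y) / 2 + quasiConst y * -(altSum y))
    · refine Eq.trans ?_ (congrArg Neg.neg (h3.trans ?_))
      · rw [← tsum_neg]
        refine tsum_congr fun n => ?_
        rw [exp_odd_pi_div_two]
        push_cast
        linear_combination (-(-1) ^ n * (2 * n + 1) ^ 2 * (sc y n * th y n) : ℂ) * Complex.I_sq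
      · push_cast
        ring
    · linear_combination (-(altSum y) / 2 : ℂ) * h5
  exact_mod_cast h4

lemma tsum_alt_pow_three_mul_sc {y : ℝ} (hy : 0 < y) :
    ∑' n : ℤ, (-1 : ℝ) ^ n * ((2 * n + 1) ^ 3 * sc y n) = -(lam y * altSum y) := by
  have h1 := (rapidDecay_deriv (rapidDecay_deriv (rapidDecay_sc hy) 1) 1).hasDerivAt_trigSeries
    1 (π / 2 : ℝ)
  have hc := hasDerivAt_cnSeries hy (π / 2 : ℝ)
  have h3 := h1.unique (((hc.const_mul (lam y : ℂ)).sub ((hc.pow 3).const_mul 2)).congr_of_eventuallyEq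
    (Filter.Eventually.of_forall fun v => cnSeries_ode hy v))
  rw [cnSeries_pi_div_two, cnDeriv_pi_div_two, trigSeries] at h3
  have h4 : ((∑' n : ℤ, (-1 : ℝ) ^ n * ((2 * n + 1) ^ 3 * sc y n) : ℝ) : ℂ) =
      -(lam y * altSum y) := by
    rw [Complex.ofReal_tsum]
    refine Eq.trans ?_ (h3.trans ?_)
    · refine tsum_congr fun n => ?_
      rw [exp_odd_pi_div_two]
      push_cast
      linear_combination (-(-1) ^ n * (2 * n + 1) ^ 3 * sc y n * (Complex.I ^ 2 - 1) : ℂ) *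
        Complex.I_sq
    · push_cast
      ring
  exact_mod_cast h4

lemma tsum_sc_sq_mul_th {y : ℝ} (hy : 0 < y) :
    ∑' n : ℤ, (2 * n + 1) * (-2 * (sc y n ^ 2 * th y n)) = -sechSq y ^ 2 - altSum y ^ 2 := by
  have hs := rapidDecay_sc hy
  have hk := rapidDecay_cnParamDeriv hy
  have hcont : Continuous (cnSeries y) :=
    continuous_iff_continuousAt.2 fun v => (hasDerivAt_cnSeries hy v).continuousAt
  have hcontk : Continuous (cnParamDeriv y) :=
    continuous_iff_continuousAt.2 fun v => (hk.hasDerivAt_trigSeries 1 v).continuousAt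
  have hd : ∀ v, HasDerivAt (fun v => cnSeries y v ^ 2 * zetaSeries y v + cnSeries y v * cnDeriv y v)
      (2 * (cnSeries y v * cnParamDeriv y v) + sechSq y * cnSeries y v ^ 2 + altSum y ^ 2) v :=
    fun v => by
    have h1 := hasDerivAt_cnSeries hy v
    refine (((h1.pow 2).mul (hasDerivAt_zetaSeries hy v)).add
      (h1.mul (hasDerivAt_cnDeriv hy v))).congr_deriv ?_
    have h5 : (lam y : ℂ) = 2 * (sechSq y + quasiConst y) := by rw [lam]; push_cast; ring
    rw [cnParamDeriv_eq hy]
    simp only [Pi.pow_apply]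
    push_cast
    linear_combination cnDeriv_sq hy v + cnSeries y v ^ 2 * h5
  have hi := intervalIntegral.integral_eq_sub_of_hasDerivAt (a := 0) (b := π) (fun v _ => hd v)
    (Continuous.intervalIntegrable (by fun_prop) _ _)
  rw [zetaSeries_zero, zetaSeries_pi, cnDeriv_zero, cnDeriv_pi] at hi
  have hsq : ∫ v in (0 : ℝ)..π, cnSeries y v ^ 2 = π * sechSq y := by
    simp_rw [cnSeries_sq hy]
    rw [integral_trigSeries (rapidDecay_sqCoeff hy).summable_norm]
    simp [sqCoeff]
  have hck : ∫ v in (0 : ℝ)..π, cnSeries y v * cnParamDeriv y v =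
      π * ∑' n : ℤ, (((2 * n + 1) * (-(sc y n ^ 2 * th y n)) : ℝ) : ℂ) := by
    have hshift : ∀ v, cnParamDeriv y v = trigSeries (-1) (fun n : ℤ =>
        (-((2 * (n + -1 : ℤ) + 1) * sc y (n + -1) * th y (n + -1)) : ℂ)) v := fun v => by
      rw [trigSeries_shift (fun n : ℤ => (-((2 * n + 1) * sc y n * th y n) : ℂ)) (-1) (-1) v]
      norm_num [cnParamDeriv]
    simp_rw [hshift, cnSeries]
    simp_rw [trigSeries_mul hs.summable_norm (hk.shift (-1)).summable_norm, add_neg_cancel]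
    rw [integral_trigSeries (summable_conv hs.summable_norm (hk.shift (-1)).summable_norm), conv]
    congr 1
    refine tsum_congr fun n => ?_
    rw [show 0 - n + -1 = -1 - n by ring, sc_neg, th_neg]
    push_cast
    ring
  rw [intervalIntegral.integral_add (Continuous.intervalIntegrable (by fun_prop) _ _)
    (Continuous.intervalIntegrable (by fun_prop) _ _),
    intervalIntegral.integral_add (Continuous.intervalIntegrable (by fun_prop) _ _)
    (Continuous.intervalIntegrable (by fun_prop) _ _),
    intervalIntegral.integral_const_mul, intervalIntegral.integral_const_mul, hsq, hck,
    intervalIntegral.integral_const, ← Complex.ofReal_tsum] at hi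
  have h6 : ∑' n : ℤ, (2 * n + 1) * (-2 * (sc y n ^ 2 * th y n)) =
      2 * ∑' n : ℤ, (2 * n + 1) * (-(sc y n ^ 2 * th y n)) := by
    rw [← tsum_mul_left]
    exact tsum_congr fun n => by ring
  rw [h6]
  have h7 : (2 * (π * ∑' n : ℤ, (2 * n + 1) * (-(sc y n ^ 2 * th y n))) + sechSq y * (π * sechSq y)
      + π * altSum y ^ 2 : ℝ) = 0 := by
    have : ((2 * (π * ∑' n : ℤ, (2 * n + 1) * (-(sc y n ^ 2 * th y n))) + sechSq y * (π * sechSq y)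
      + π * altSum y ^ 2 : ℝ) : ℂ) = 0 := by
      rw [sub_zero, Complex.real_smul] at hi
      push_cast at hi ⊢
      linear_combination hi
    exact_mod_cast this
  have h8 : π * (2 * ∑' n : ℤ, (2 * n + 1) * (-(sc y n ^ 2 * th y n)) + sechSq y ^ 2
      + altSum y ^ 2) = 0 := by linear_combination h7
  rcases mul_eq_zero.1 h8 with h | h
  · exact absurd h pi_ne_zero
  · linear_combination h

lemma RapidDecay.affine_pow_mul {α : ℤ → ℂ} (h : RapidDecay α) (a b : ℂ) (k : ℕ) :
    RapidDecay fun n => (a * n + b) ^ k * α n := by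
  induction k with
  | zero => simpa using h
  | succ k ih =>
    convert ih.affine_mul a b using 2
    ring

lemma summable_odd_pow_mul_exp {δ : ℝ} (hδ : 0 < δ) (k : ℕ) :
    Summable fun n : ℤ => |2 * (n : ℝ) + 1| ^ k * exp (-|(2 * (n : ℝ) + 1) * δ|) := by
  have h : RapidDecay fun n : ℤ => ((exp (-|(2 * (n : ℝ) + 1) * δ|) : ℝ) : ℂ) := by
    refine RapidDecay.of_le_exp (K := exp δ) (δ := 2 * δ) (by positivity) fun n => ?_
    rw [Complex.norm_real, norm_of_nonneg (exp_pos _).le]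
    exact exp_odd_le hδ n
  refine (h.affine_pow_mul 2 1 k).summable_norm.congr fun n => ?_
  rw [norm_mul, norm_pow, Complex.norm_real, norm_of_nonneg (exp_pos _).le]
  congr 2
  rw [← norm_eq_abs, ← Complex.norm_real]
  push_cast
  rfl

lemma summable_odd_mul {w : ℤ → ℝ} {g : ℝ → ℝ} {B : ℝ} (k : ℕ)
    (hw : ∀ n, |w n| ≤ |2 * (n : ℝ) + 1| ^ k) (hB : ∀ x, |g x| ≤ B * exp (-|x|))
    {y : ℝ} (hy : 0 < y) : Summable fun n : ℤ => w n * g ((2 * n + 1) * y) := by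
  refine Summable.of_norm_bounded ((summable_odd_pow_mul_exp hy k).mul_left B) fun n => ?_
  rw [norm_eq_abs, abs_mul]
  calc |w n| * |g ((2 * n + 1) * y)|
      ≤ |2 * (n : ℝ) + 1| ^ k * (B * exp (-|(2 * (n : ℝ) + 1) * y|)) := by
        gcongr
        · exact hw n
        · exact hB _
    _ = _ := by ring

lemma hasDerivAt_tsum_odd {w : ℤ → ℝ} {g g' : ℝ → ℝ} {B : ℝ} (k : ℕ)
    (hw : ∀ n, |w n| ≤ |2 * (n : ℝ) + 1| ^ k) (hg : ∀ x, HasDerivAt g (g' x) x)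
    (hB : ∀ x, |g x| ≤ B * exp (-|x|)) (hB' : ∀ x, |g' x| ≤ B * exp (-|x|))
    {y : ℝ} (hy : 0 < y) :
    HasDerivAt (fun y => ∑' n : ℤ, w n * g ((2 * n + 1) * y))
      (∑' n : ℤ, w n * (2 * n + 1) * g' ((2 * n + 1) * y)) y := by
  have hB0 : 0 ≤ B := by
    have := (abs_nonneg _).trans (hB 0)
    simpa using this
  refine hasDerivAt_tsum_of_isPreconnected (t := Set.Ioi (y / 2)) (y₀ := y)
    (g := fun n y => w n * g ((2 * n + 1) * y))
    (g' := fun n y => w n * (2 * n + 1) * g' ((2 * n + 1) * y))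
    ((summable_odd_pow_mul_exp (half_pos hy) (k + 1)).mul_left B) isOpen_Ioi isPreconnected_Ioi
    (fun n z _ => ?_) (fun n z hz => ?_) (half_lt_self hy) (summable_odd_mul k hw hB hy)
    (half_lt_self hy)
  · have h1 : HasDerivAt (fun z : ℝ => (2 * (n : ℝ) + 1) * z) (2 * n + 1) z := by
      simpa using (hasDerivAt_id z).const_mul (2 * (n : ℝ) + 1)
    exact (((hg _).comp z h1).const_mul (w n)).congr_deriv (by ring)
  · rw [norm_eq_abs, abs_mul, abs_mul]
    have hz' : y / 2 < z := hz
    have h2 : exp (-|(2 * (n : ℝ) + 1) * z|) ≤ exp (-|(2 * (n : ℝ) + 1) * (y / 2)|) := by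
      rw [exp_le_exp, neg_le_neg_iff, abs_mul, abs_mul, abs_of_pos (half_pos hy),
        abs_of_pos ((half_pos hy).trans hz')]
      gcongr
    calc |w n| * |2 * (n : ℝ) + 1| * |g' ((2 * n + 1) * z)|
        ≤ |2 * (n : ℝ) + 1| ^ k * |2 * (n : ℝ) + 1| *
          (B * exp (-|(2 * (n : ℝ) + 1) * (y / 2)|)) := by
          gcongr
          · exact hw n
          · exact (hB' _).trans (by gcongr)
      _ = _ := by ring

lemma hasDerivAt_inv_cosh (x : ℝ) :
    HasDerivAt (fun x => (cosh x)⁻¹) (-((cosh x)⁻¹ * tanh x)) x := by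
  refine ((hasDerivAt_cosh x).inv (cosh_pos x).ne').congr_deriv ?_
  rw [tanh_eq_sinh_div_cosh]
  field_simp

lemma hasDerivAt_tanh (x : ℝ) : HasDerivAt tanh ((cosh x)⁻¹ ^ 2) x := by
  have h := (hasDerivAt_sinh x).div (hasDerivAt_cosh x) (cosh_pos x).ne'
  have h2 : tanh = sinh / cosh := funext fun x => tanh_eq_sinh_div_cosh x
  rw [h2]
  refine h.congr_deriv ?_
  have := cosh_sq x
  have := (cosh_pos x).ne'
  field_simp
  linarith

lemma tanh_sq_eq (x : ℝ) : tanh x ^ 2 = 1 - (cosh x)⁻¹ ^ 2 := by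
  rw [tanh_eq_sinh_div_cosh]
  have := cosh_sq x
  have := (cosh_pos x).ne'
  field_simp
  linarith

lemma hasDerivAt_inv_cosh_mul_tanh (x : ℝ) :
    HasDerivAt (fun x => -((cosh x)⁻¹ * tanh x)) ((cosh x)⁻¹ - 2 * (cosh x)⁻¹ ^ 3) x := by
  refine ((hasDerivAt_inv_cosh x).mul (hasDerivAt_tanh x)).neg.congr_deriv ?_
  linear_combination (cosh x)⁻¹ * tanh_sq_eq x

lemma abs_inv_cosh_mul_tanh_le (x : ℝ) : |(cosh x)⁻¹ * tanh x| ≤ (cosh x)⁻¹ := by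
  rw [abs_mul, abs_of_pos (inv_cosh_pos x)]
  exact mul_le_of_le_one_right (inv_cosh_pos x).le (abs_tanh_lt_one x).le

lemma inv_cosh_pow_le {k : ℕ} (hk : 0 < k) (x : ℝ) : (cosh x)⁻¹ ^ k ≤ 2 * exp (-|x|) :=
  (pow_le_of_le_one (inv_cosh_pos x).le (inv_cosh_le_one x) hk.ne').trans (inv_cosh_le x)

lemma hasDerivAt_sechSum {y : ℝ} (hy : 0 < y) :
    HasDerivAt sechSum (sechSum y * (lam y - sechSum y ^ 2 - sechSq y)) y := by
  have h := hasDerivAt_tsum_odd (w := fun _ => 1) (B := 2) 0 (fun n => by simp)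
    hasDerivAt_inv_cosh (fun x => (abs_of_pos (inv_cosh_pos x)).trans_le (inv_cosh_le x))
    (fun x => by rw [abs_neg]; exact (abs_inv_cosh_mul_tanh_le x).trans (inv_cosh_le x)) hy
  have h1 := tsum_sc_mul_th hy
  refine (h.congr_of_eventuallyEq (Filter.Eventually.of_forall fun z => ?_)).congr_deriv ?_
  · exact tsum_congr fun n => (one_mul _).symm
  · trans ∑' n : ℤ, -((2 * n + 1) * sc y n * th y n)
    · exact tsum_congr fun n => by rw [sc, th]; ring
    · rw [h1, lam]
      ring

lemma abs_neg_one_zpow_mul (n : ℤ) (a : ℝ) : |(-1 : ℝ) ^ n * a| = |a| := by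
  rw [abs_mul, abs_zpow, abs_neg, abs_one, one_zpow, one_mul]

lemma hasDerivAt_altSum {y : ℝ} (hy : 0 < y) :
    HasDerivAt altSum ((lam y - 2 * sechSq y) * altSum y) y := by
  have h := hasDerivAt_tsum_odd (w := fun n => (-1) ^ n * (2 * n + 1)) (B := 2) 1
    (fun n => by rw [abs_neg_one_zpow_mul, pow_one])
    hasDerivAt_inv_cosh (fun x => (abs_of_pos (inv_cosh_pos x)).trans_le (inv_cosh_le x))
    (fun x => by rw [abs_neg]; exact (abs_inv_cosh_mul_tanh_le x).trans (inv_cosh_le x)) hy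
  rw [← tsum_alt_sq_mul_sc_mul_th hy]
  refine (h.congr_of_eventuallyEq (Filter.Eventually.of_forall fun z => ?_)).congr_deriv ?_
  · exact tsum_congr fun n => by rw [sc]; ring
  · exact tsum_congr fun n => by rw [sc, th]; ring

lemma hasDerivAt_sechSq {y : ℝ} (hy : 0 < y) :
    HasDerivAt sechSq (-sechSq y ^ 2 - altSum y ^ 2) y := by
  have h := hasDerivAt_tsum_odd (w := fun _ => 1) (B := 4) (g := fun x => (cosh x)⁻¹ ^ 2)
    (g' := fun x => 2 * ((cosh x)⁻¹ * -((cosh x)⁻¹ * tanh x))) 0 (fun n => by simp)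
    (fun x => ((hasDerivAt_inv_cosh x).pow 2).congr_deriv (by push_cast; ring))
    (fun x => by
      rw [abs_of_pos (pow_pos (inv_cosh_pos x) 2)]
      linarith [inv_cosh_pow_le two_pos x, exp_pos (-|x|)])
    (fun x => by
      rw [abs_mul, abs_mul, abs_neg, abs_two, abs_of_pos (inv_cosh_pos x)]
      have h1 := (abs_inv_cosh_mul_tanh_le x).trans (inv_cosh_le x)
      nlinarith [inv_cosh_pos x, inv_cosh_le_one x, abs_nonneg ((cosh x)⁻¹ * tanh x)]) hy
  rw [← tsum_sc_sq_mul_th hy]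
  refine (h.congr_of_eventuallyEq (Filter.Eventually.of_forall fun z => ?_)).congr_deriv ?_
  · exact tsum_congr fun n => (one_mul _).symm
  · exact tsum_congr fun n => by rw [sc, th]; ring

lemma sechSum_pos {y : ℝ} (hy : 0 < y) : 0 < sechSum y :=
  (summable_sc hy).tsum_pos (fun n => (sc_pos y n).le) 0 (sc_pos y 0)

lemma lam_eq {y : ℝ} (hy : 0 < y) : lam y = sechSum y ^ 2 - altSum y ^ 2 / sechSum y ^ 2 := by
  have h := sechSum_pow_four hy
  have h1 := (sechSum_pos hy).ne'
  field_simp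
  linarith

lemma hasDerivAt_lam {y : ℝ} (hy : 0 < y) :
    HasDerivAt lam (-2 * sechSq y * lam y - 4 * altSum y ^ 2) y := by
  have hA := (hasDerivAt_sechSum hy).pow 2
  have h1 := (sechSum_pos hy).ne'
  have h := hA.sub (((hasDerivAt_altSum hy).pow 2).div hA (pow_ne_zero 2 h1))
  have heq : lam =ᶠ[nhds y] (sechSum ^ 2 - altSum ^ 2 / sechSum ^ 2) := by
    filter_upwards [Ioi_mem_nhds hy] with z hz using lam_eq hz
  refine (h.congr_of_eventuallyEq heq).congr_deriv ?_
  simp only [Pi.pow_apply]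
  rw [lam_eq hy]
  push_cast
  field_simp
  ring

/-- `∑ (-1)ⁿ (2n+1)³ sech³ ((2n+1)y)`. -/
noncomputable def altCubeSum (y : ℝ) : ℝ := ∑' n : ℤ, (-1 : ℝ) ^ n * ((2 * n + 1) ^ 3 * sc y n ^ 3)

lemma abs_alt_pow_le (k : ℕ) (n : ℤ) :
    |(-1 : ℝ) ^ n * (2 * (n : ℝ) + 1) ^ k| ≤ |2 * (n : ℝ) + 1| ^ k := by
  rw [abs_neg_one_zpow_mul, abs_pow]

lemma abs_inv_cosh_pow_le {k : ℕ} (hk : 0 < k) (x : ℝ) : |(cosh x)⁻¹ ^ k| ≤ 2 * exp (-|x|) := by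
  rw [abs_of_pos (pow_pos (inv_cosh_pos x) k)]
  exact inv_cosh_pow_le hk x

lemma hasDerivAt_mul_altSum {y : ℝ} (hy : 0 < y) :
    HasDerivAt (fun y => (lam y - 2 * sechSq y) * altSum y)
      (-(lam y * altSum y) - 2 * altCubeSum y) y := by
  have h := hasDerivAt_tsum_odd (w := fun n => (-1) ^ n * (2 * n + 1) ^ 2) (B := 6) 2
    (fun n => abs_alt_pow_le 2 n) hasDerivAt_inv_cosh_mul_tanh
    (fun x => by
      rw [abs_neg]
      linarith [(abs_inv_cosh_mul_tanh_le x).trans (inv_cosh_le x), exp_pos (-|x|)])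
    (fun x => by
      refine (abs_sub _ _).trans ?_
      rw [abs_mul, abs_two, abs_of_pos (inv_cosh_pos x)]
      linarith [inv_cosh_le x, abs_inv_cosh_pow_le three_pos x]) hy
  have heq : (fun y => (lam y - 2 * sechSq y) * altSum y) =ᶠ[nhds y] fun y =>
      ∑' n : ℤ, (-1) ^ n * (2 * n + 1) ^ 2 * -((cosh ((2 * n + 1) * y))⁻¹ * tanh ((2 * n + 1) * y)) := by
    filter_upwards [Ioi_mem_nhds hy] with z hz
    rw [← tsum_alt_sq_mul_sc_mul_th hz]
    exact tsum_congr fun n => by rw [sc, th]; ring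
  refine (h.congr_of_eventuallyEq heq).congr_deriv ?_
  rw [← tsum_alt_pow_three_mul_sc hy, altCubeSum, ← tsum_mul_left, ← Summable.tsum_sub]
  · exact tsum_congr fun n => by rw [sc]; ring
  · refine (summable_odd_mul 3 (fun n => abs_alt_pow_le 3 n)
      (fun x => (abs_of_pos (inv_cosh_pos x)).trans_le (inv_cosh_le x)) hy).congr fun n => ?_
    rw [sc]; ring
  · refine ((summable_odd_mul 3 (fun n => abs_alt_pow_le 3 n)
      (abs_inv_cosh_pow_le three_pos) hy).mul_left 2).congr fun n => ?_
    rw [sc]; ring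

lemma hasDerivAt_altCubeSum {y : ℝ} (hy : 0 < y) :
    HasDerivAt altCubeSum
      (-3 * ∑' n : ℤ, (-1 : ℝ) ^ n * ((2 * n + 1) ^ 4 * (sc y n ^ 3 * th y n))) y := by
  have h := hasDerivAt_tsum_odd (w := fun n => (-1) ^ n * (2 * n + 1) ^ 3) (B := 6) 3
    (g := fun x => (cosh x)⁻¹ ^ 3)
    (g' := fun x => 3 * ((cosh x)⁻¹ ^ 2 * -((cosh x)⁻¹ * tanh x)))
    (fun n => abs_alt_pow_le 3 n)
    (fun x => ((hasDerivAt_inv_cosh x).pow 3).congr_deriv (by push_cast; ring))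
    (fun x => by linarith [abs_inv_cosh_pow_le three_pos x, exp_pos (-|x|)])
    (fun x => by
      rw [abs_mul, abs_mul, abs_neg, abs_of_pos (pow_pos (inv_cosh_pos x) 2),
        abs_of_pos (three_pos : (0 : ℝ) < 3)]
      have h1 := (abs_inv_cosh_mul_tanh_le x).trans (inv_cosh_le x)
      have h2 := pow_le_one₀ (n := 2) (inv_cosh_pos x).le (inv_cosh_le_one x)
      nlinarith [pow_pos (inv_cosh_pos x) 2, abs_nonneg ((cosh x)⁻¹ * tanh x)]) hy
  refine (h.congr_of_eventuallyEq (Filter.Eventually.of_forall fun z => ?_)).congr_deriv ?_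
  · exact tsum_congr fun n => by rw [sc]; ring
  · rw [← tsum_mul_left]
    exact tsum_congr fun n => by rw [sc, th]; ring

open scoped FourierTransform

lemma sigmoid_mul_one_sub (s : ℝ) : sigmoid s * (1 - sigmoid s) = ((2 * cosh (s / 2)) ^ 2)⁻¹ := by
  have h : sigmoid s * (1 - sigmoid s) = ((1 + exp (-s)) * (1 + exp s))⁻¹ := by
    rw [← sigmoid_neg, sigmoid_def, sigmoid_def, neg_neg, mul_inv]
  rw [h]
  congr 1
  have h1 : exp s = exp (s / 2) ^ 2 := by rw [← exp_nat_mul]; congr 1; push_cast; ring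
  have h2 : exp (-s) = exp (-(s / 2)) ^ 2 := by rw [← exp_nat_mul]; congr 1; push_cast; ring
  have h3 : exp (s / 2) * exp (-(s / 2)) = 1 := by rw [← exp_add]; simp
  rw [cosh_eq, h1, h2]
  linear_combination (exp (s / 2) * exp (-(s / 2)) - 1) * h3

lemma cpow_sigmoid (t s : ℝ) :
    (sigmoid s * (1 - sigmoid s) : ℝ) • (((sigmoid s : ℝ) : ℂ) ^ ((1 / 2 + t * Complex.I) - 1) *
      (1 - ((sigmoid s : ℝ) : ℂ)) ^ ((1 / 2 - t * Complex.I) - 1)) =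
      Complex.exp (s * t * Complex.I) * ((2 * cosh (s / 2))⁻¹ : ℝ) := by
  have ha := sigmoid_pos s
  have hb : 0 < 1 - sigmoid s := sub_pos.2 (sigmoid_lt_one s)
  have hc : 0 < 2 * cosh (s / 2) := mul_pos two_pos (cosh_pos _)
  have hlog : log (sigmoid s) - log (1 - sigmoid s) = s := by
    rw [← sigmoid_neg, ← sigmoid_mul_rexp_neg, log_mul ha.ne' (exp_pos _).ne', log_exp]
    ring
  have hlog2 : log (sigmoid s) + log (1 - sigmoid s) = -2 * log (2 * cosh (s / 2)) := by
    rw [← log_mul ha.ne' hb.ne', sigmoid_mul_one_sub, log_inv, log_pow]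
    push_cast
    ring
  have e1 : ((sigmoid s : ℝ) : ℂ) = Complex.exp (log (sigmoid s)) := by
    rw [← Complex.ofReal_exp, exp_log ha]
  have e2 : (1 - ((sigmoid s : ℝ) : ℂ)) = Complex.exp (log (1 - sigmoid s)) := by
    rw [← Complex.ofReal_exp, exp_log hb]; push_cast; rfl
  have e3 : (((2 * cosh (s / 2))⁻¹ : ℝ) : ℂ) = Complex.exp (-log (2 * cosh (s / 2))) := by
    rw [← Complex.ofReal_neg, ← Complex.ofReal_exp, exp_neg, exp_log hc]
  have n1 : ((sigmoid s : ℝ) : ℂ) ≠ 0 := by exact_mod_cast ha.ne'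
  have n2 : (1 - ((sigmoid s : ℝ) : ℂ)) ≠ 0 := by rw [e2]; exact Complex.exp_ne_zero _
  rw [Complex.real_smul, Complex.ofReal_mul, Complex.ofReal_sub, Complex.ofReal_one,
    Complex.cpow_def_of_ne_zero n1, Complex.cpow_def_of_ne_zero n2, ← Complex.ofReal_one,
    ← Complex.ofReal_sub, ← Complex.ofReal_log ha.le, ← Complex.ofReal_log hb.le, Complex.ofReal_sub,
    Complex.ofReal_one, e2]
  nth_rw 1 [e1]
  rw [e3, ← Complex.exp_add, ← Complex.exp_add, ← Complex.exp_add, ← Complex.exp_add]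
  congr 1
  have f1 : (log (sigmoid s) : ℂ) - log (1 - sigmoid s) = s := by exact_mod_cast hlog
  have f2 : (log (sigmoid s) : ℂ) + log (1 - sigmoid s) = -2 * log (2 * cosh (s / 2)) := by
    exact_mod_cast hlog2
  linear_combination (t * Complex.I) * f1 + (1 / 2) * f2

lemma integral_exp_mul_inv_cosh (t : ℝ) :
    ∫ s : ℝ, Complex.exp (s * t * Complex.I) * ((2 * cosh (s / 2))⁻¹ : ℝ) = π / cosh (π * t) := by
  have hre1 : 0 < (1 / 2 + t * Complex.I : ℂ).re := by simp
  have hre2 : 0 < (1 / 2 - t * Complex.I : ℂ).re := by simp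
  have hb := Complex.Gamma_mul_Gamma_eq_betaIntegral hre1 hre2
  have h1 : (1 / 2 - t * Complex.I : ℂ) = 1 - (1 / 2 + t * Complex.I) := by ring
  have h2 : Complex.sin (π * (1 / 2 + t * Complex.I)) = cosh (π * t) := by
    rw [show (π : ℂ) * (1 / 2 + t * Complex.I) = (π * t) * Complex.I + π / 2 by ring,
      Complex.sin_add_pi_div_two, Complex.cos_mul_I]
    push_cast
    rfl
  have h3 : Complex.betaIntegral (1 / 2 + t * Complex.I) (1 / 2 - t * Complex.I) =
      π / cosh (π * t) := by
    have h4 := Complex.Gamma_mul_Gamma_one_sub (1 / 2 + t * Complex.I)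
    rw [← h1, hb, h2] at h4
    rw [← h4, show (1 / 2 + t * Complex.I : ℂ) + (1 / 2 - t * Complex.I) = 1 by ring,
      Complex.Gamma_one, one_mul]
  rw [← h3, Complex.betaIntegral, intervalIntegral.integral_of_le zero_le_one,
    MeasureTheory.integral_Ioc_eq_integral_Ioo, ← range_sigmoid, ← Set.image_univ,
    MeasureTheory.integral_image_eq_integral_abs_deriv_smul MeasurableSet.univ
      (fun x _ => (hasDerivAt_sigmoid x).hasDerivWithinAt) sigmoid_injective.injOn,
    MeasureTheory.setIntegral_univ]
  refine MeasureTheory.integral_congr_ae (Filter.Eventually.of_forall fun s => ?_)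
  simp only
  rw [← cpow_sigmoid, abs_of_pos (mul_pos (sigmoid_pos s) (sub_pos.2 (sigmoid_lt_one s)))]

/-- The summand of the Poisson summation. -/
noncomputable def twistedSech (y u : ℝ) : ℂ :=
  Complex.exp (π * u * Complex.I) * ((cosh (2 * y * u))⁻¹ : ℝ)

lemma norm_twistedSech (y u : ℝ) : ‖twistedSech y u‖ = (cosh (2 * y * u))⁻¹ := by
  rw [twistedSech, norm_mul, ← Complex.ofReal_mul, Complex.norm_exp_ofReal_mul_I, one_mul,
    Complex.norm_real, norm_of_nonneg (inv_cosh_pos _).le]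

lemma fourier_twistedSech {y : ℝ} (hy : 0 < y) (k : ℤ) :
    𝓕 (twistedSech y) (k : ℝ) = π / (2 * y) * sc (π ^ 2 / (4 * y)) (k - 1) := by
  rw [Real.fourier_eq']
  have h := MeasureTheory.Measure.integral_comp_mul_left (fun s : ℝ => Complex.exp
    (s * (π * (1 - 2 * k) / (4 * y) : ℝ) * Complex.I) * ((2 * cosh (s / 2))⁻¹ : ℝ)) (4 * y)
  rw [integral_exp_mul_inv_cosh, abs_of_pos (by positivity)] at h
  have h2 : ∀ v : ℝ, Complex.exp (↑(-2 * π * inner ℝ v (k : ℝ)) * Complex.I) • twistedSech y v =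
      2 * (Complex.exp ((4 * y * v : ℝ) * (π * (1 - 2 * k) / (4 * y) : ℝ) * Complex.I) *
        ((2 * cosh ((4 * y * v) / 2))⁻¹ : ℝ)) := by
    intro v
    have hy' : (y : ℂ) ≠ 0 := by exact_mod_cast hy.ne'
    rw [twistedSech, smul_eq_mul, ← mul_assoc, ← Complex.exp_add, mul_inv, Complex.ofReal_mul 2⁻¹,
      show 4 * y * v / 2 = 2 * y * v by ring]
    rw [show (↑(-2 * π * inner ℝ v (k : ℝ)) * Complex.I + π * v * Complex.I : ℂ) =
      (4 * y * v : ℝ) * (π * (1 - 2 * k) / (4 * y) : ℝ) * Complex.I by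
        simp only [RCLike.inner_apply, conj_trivial]
        push_cast
        field_simp
        ring]
    push_cast
    ring
  simp_rw [h2]
  rw [MeasureTheory.integral_const_mul, h, sc, ← cosh_neg, Complex.real_smul]
  rw [show -(π * (π * (1 - 2 * k) / (4 * y))) = (2 * ((k - 1 : ℤ) : ℝ) + 1) * (π ^ 2 / (4 * y)) by
    push_cast; field_simp; ring]
  push_cast
  field_simp
  ring

lemma isBigO_twistedSech {y : ℝ} (hy : 0 < y) :
    twistedSech y =O[Filter.cocompact ℝ] fun x : ℝ => |x| ^ (-2 : ℝ) := by
  refine Asymptotics.IsBigO.of_bound (1 / y ^ 2) ?_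
  have h0 : ∀ᶠ x : ℝ in Filter.cocompact ℝ, x ≠ 0 := by
    have := (isCompact_singleton (x := (0 : ℝ))).compl_mem_cocompact
    filter_upwards [this] with x hx using hx
  filter_upwards [h0] with x hx
  have hx' : 0 < |x| := abs_pos.2 hx
  rw [norm_twistedSech, norm_of_nonneg (by positivity), rpow_neg hx'.le, ← one_div, ← one_div,
    div_mul_div_comm, one_mul]
  refine one_div_le_one_div_of_le (by positivity) ?_
  have h1 := Real.quadratic_le_exp_of_nonneg (abs_nonneg (2 * y * x))
  rw [← cosh_abs, cosh_eq]
  have h2 : |2 * y * x| ^ 2 = 4 * (y ^ 2 * |x| ^ (2 : ℝ)) := by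
    rw [abs_mul, abs_of_pos (by positivity : 0 < 2 * y), rpow_two]
    ring
  nlinarith [exp_pos (-|2 * y * x|), abs_nonneg (2 * y * x)]

lemma cnSeries_poisson {y : ℝ} (hy : 0 < y) (x : ℝ) :
    Complex.exp (π * x * Complex.I) *
      ∑' n : ℤ, (((-1 : ℝ) ^ n * (cosh (2 * y * (x + n)))⁻¹ : ℝ) : ℂ) =
      π / (2 * y) * (Complex.exp (π * x * Complex.I) * cnSeries (π ^ 2 / (4 * y)) (π * x)) := by
  have hy' : 0 < π ^ 2 / (4 * y) := by positivity
  have hcont : Continuous (twistedSech y) := by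
    unfold twistedSech
    have : ∀ u : ℝ, cosh (2 * y * u) ≠ 0 := fun u => (cosh_pos _).ne'
    fun_prop (disch := assumption)
  have hF : Summable fun n : ℤ => 𝓕 (twistedSech y) (n : ℝ) := by
    simp_rw [fourier_twistedSech hy]
    exact (((rapidDecay_sc hy').shift (-1)).summable).mul_left _
  have h := Real.tsum_eq_tsum_fourier_of_rpow_decay_of_summable hcont one_lt_two
    (isBigO_twistedSech hy) hF x
  have h1 : ∑' n : ℤ, twistedSech y (x + n) = Complex.exp (π * x * Complex.I) *
      ∑' n : ℤ, (((-1 : ℝ) ^ n * (cosh (2 * y * (x + n)))⁻¹ : ℝ) : ℂ) := by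
    rw [← tsum_mul_left]
    refine tsum_congr fun n => ?_
    rw [twistedSech, show (π * (x + n : ℝ) * Complex.I : ℂ) = π * x * Complex.I +
      n * (π * Complex.I) by push_cast; ring, Complex.exp_add, Complex.exp_int_mul,
      Complex.exp_pi_mul_I]
    push_cast
    ring
  have h2 : ∑' n : ℤ, 𝓕 (twistedSech y) (n : ℝ) * fourier n (x : UnitAddCircle) =
      π / (2 * y) * (Complex.exp (π * x * Complex.I) * cnSeries (π ^ 2 / (4 * y)) (π * x)) := by
    rw [cnSeries, trigSeries, ← tsum_mul_left, ← tsum_mul_left,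
      ← (Equiv.subRight (1 : ℤ)).tsum_eq fun n : ℤ => (π / (2 * y) * (Complex.exp (π * x * Complex.I) *
        (sc (π ^ 2 / (4 * y)) n * Complex.exp (Complex.I * (2 * n + (1 : ℤ)) * (π * x : ℝ)))) : ℂ)]
    refine tsum_congr fun n => ?_
    rw [fourier_twistedSech hy, fourier_coe_apply, Equiv.subRight_apply]
    rw [mul_left_comm (Complex.exp _), ← Complex.exp_add, mul_assoc]
    congr 3
    push_cast
    ring
  rw [← h1, h, h2]

lemma tsum_int_eq_two_mul_tsum_nat {f : ℤ → ℝ} (hs : Summable f) (hf : ∀ n, f (-1 - n) = f n) :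
    ∑' n, f n = 2 * ∑' n : ℕ, f n := by
  have h : ∀ n : ℕ, f (-(n + 1)) = f n := fun n => by
    rw [← hf n]
    congr 1
    ring
  have hn : Summable fun n : ℕ => f n := hs.comp_injective Nat.cast_injective
  rw [tsum_of_nat_of_neg_add_one hn (by simpa only [h] using hn)]
  simp only [h]
  ring

lemma hasDerivAt_tsum_shift {y : ℝ} (hy : 0 < y) :
    HasDerivAt (fun x : ℝ => ∑' n : ℤ, (-1 : ℝ) ^ n * (cosh (2 * y * (x + n)))⁻¹)
      (-(2 * y) * ∑' n : ℤ, (-1 : ℝ) ^ n * (sc y n * th y n)) (1 / 2) := by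
  have hexp : ∀ n : ℤ, ∀ x ∈ Set.Ioo (0 : ℝ) 1, (cosh (2 * y * (x + n)))⁻¹ ≤
      2 * (exp (2 * y) * exp (-(2 * y * |(n : ℝ)|))) := fun n x hx => by
    refine (inv_cosh_le _).trans ?_
    rw [← exp_add, abs_mul, abs_of_pos (by positivity : 0 < 2 * y)]
    gcongr
    have h1 : |(n : ℝ)| ≤ |x + n| + |x| := by
      calc |(n : ℝ)| = |(x + n) - x| := by ring_nf
        _ ≤ _ := abs_sub _ _
    rw [abs_of_pos hx.1] at h1
    nlinarith [hx.2]
  have hu : Summable fun n : ℤ => 2 * (exp (2 * y) * exp (-(2 * y * |(n : ℝ)|))) := by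
    have := summable_abs_pow_mul_exp (by positivity : 0 < 2 * y) 0
    simp only [pow_zero, one_mul] at this
    exact (this.mul_left _).mul_left _
  have h := hasDerivAt_tsum_of_isPreconnected (t := Set.Ioo (0 : ℝ) 1) (y₀ := 1 / 2) (y := 1 / 2)
    (g := fun (n : ℤ) x => (-1 : ℝ) ^ n * (cosh (2 * y * (x + n)))⁻¹)
    (g' := fun (n : ℤ) x => (-1 : ℝ) ^ n *
      (-(2 * y) * ((cosh (2 * y * (x + n)))⁻¹ * tanh (2 * y * (x + n)))))
    (hu.mul_left (2 * y)) isOpen_Ioo isPreconnected_Ioo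
    (fun n x _ => ?_) (fun n x hx => ?_) (by norm_num) ?_ (by norm_num)
  · refine h.congr_deriv ?_
    rw [← tsum_mul_left]
    refine tsum_congr fun n => ?_
    rw [sc, th, show 2 * y * (1 / 2 + n) = (2 * n + 1) * y by ring]
    ring
  · have h1 : HasDerivAt (fun x : ℝ => 2 * y * (x + n)) (2 * y * 1) x :=
      ((hasDerivAt_id x).add_const (n : ℝ)).const_mul (2 * y)
    exact (((hasDerivAt_inv_cosh _).comp x h1).const_mul _).congr_deriv (by ring)
  · rw [norm_eq_abs, abs_neg_one_zpow_mul, abs_mul, abs_neg, abs_of_pos (by positivity : 0 < 2 * y)]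
    gcongr
    exact (abs_inv_cosh_mul_tanh_le _).trans (hexp n x hx)
  · refine Summable.of_norm_bounded hu fun n => ?_
    rw [norm_eq_abs, abs_neg_one_zpow_mul, abs_of_pos (inv_cosh_pos _)]
    exact hexp n _ (by norm_num)

lemma altSum_modular_aux {y : ℝ} (hy : 0 < y) :
    altSum (π ^ 2 / (4 * y)) = 4 * y ^ 2 / π ^ 2 * ∑' n : ℤ, (-1 : ℝ) ^ n * (sc y n * th y n) := by
  have hy' : 0 < π ^ 2 / (4 * y) := by positivity
  have h1 : HasDerivAt (fun x : ℝ => cnSeries (π ^ 2 / (4 * y)) (π * x))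
      (π * -altSum (π ^ 2 / (4 * y)) : ℝ) (1 / 2) := by
    have h2 : HasDerivAt (fun x : ℝ => π * x) π (1 / 2) := by
      simpa using (hasDerivAt_id (1 / 2 : ℝ)).const_mul π
    have h3 := HasDerivAt.scomp (1 / 2) (hasDerivAt_cnSeries hy' (π * (1 / 2))) h2
    rw [show π * (1 / 2) = π / 2 by ring, cnDeriv_pi_div_two] at h3
    refine h3.congr_deriv ?_
    rw [Complex.real_smul]
    push_cast
    rfl
  have h4 := ((hasDerivAt_tsum_shift hy).const_mul (2 * y / π)).ofReal_comp
  have h5 := h1.unique (h4.congr_of_eventuallyEq (Filter.Eventually.of_forall fun x => ?_))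
  · have h6 : π * -altSum (π ^ 2 / (4 * y)) =
        2 * y / π * (-(2 * y) * ∑' n : ℤ, (-1 : ℝ) ^ n * (sc y n * th y n)) := by exact_mod_cast h5
    have := pi_ne_zero
    field_simp at h6 ⊢
    linarith
  · have h7 := cnSeries_poisson hy x
    have h8 : (π : ℂ) ≠ 0 := by exact_mod_cast pi_ne_zero
    have h9 : (y : ℂ) ≠ 0 := by exact_mod_cast hy.ne'
    rw [mul_left_comm] at h7
    have h10 := mul_left_cancel₀ (Complex.exp_ne_zero _) h7
    beta_reduce
    rw [Complex.ofReal_mul, Complex.ofReal_tsum, h10]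
    push_cast
    field_simp

lemma exp_neg_odd_mul (k : ℕ) (t : ℝ) :
    exp (-((2 * k + 1) * t)) = exp (-t) * exp (-t) ^ (2 * k) := by
  rw [← exp_nat_mul, ← exp_add]
  congr 1
  push_cast
  ring

lemma hasSum_inv_cosh {t : ℝ} (ht : 0 < t) :
    HasSum (fun k : ℕ => (-1 : ℝ) ^ k * (2 * exp (-((2 * k + 1) * t)))) (cosh t)⁻¹ := by
  have hq : exp (-t) < 1 := Real.exp_lt_one_iff.2 (neg_neg_of_pos ht)
  have h0 := exp_pos (-t)
  have hr : |-exp (-t) ^ 2| < 1 := by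
    rw [abs_neg, abs_of_pos (by positivity)]
    nlinarith
  have h := (hasSum_geometric_of_abs_lt_one hr).mul_left (2 * exp (-t))
  have hv : (cosh t)⁻¹ = 2 * exp (-t) * (1 - -exp (-t) ^ 2)⁻¹ := by
    rw [cosh_eq, show exp t = (exp (-t))⁻¹ by rw [exp_neg, inv_inv], sub_neg_eq_add]
    field_simp
  rw [hv]
  refine h.congr_fun fun k => ?_
  rw [exp_neg_odd_mul, neg_pow (exp (-t) ^ 2), ← pow_mul]
  ring

lemma hasSum_inv_cosh_mul_tanh {t : ℝ} (ht : 0 < t) :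
    HasSum (fun k : ℕ => (-1 : ℝ) ^ k * ((2 * k + 1) * (2 * exp (-((2 * k + 1) * t)))))
      ((cosh t)⁻¹ * tanh t) := by
  have hq : exp (-t) < 1 := Real.exp_lt_one_iff.2 (neg_neg_of_pos ht)
  have h0 := exp_pos (-t)
  have hr : ‖-exp (-t) ^ 2‖ < 1 := by
    rw [norm_neg, norm_of_nonneg (by positivity)]
    nlinarith
  have h := (((hasSum_coe_mul_geometric_of_norm_lt_one hr).mul_left 2).add
    (hasSum_geometric_of_norm_lt_one hr)).mul_left (2 * exp (-t))
  have hv : (cosh t)⁻¹ * tanh t = 2 * exp (-t) *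
      (2 * (-exp (-t) ^ 2 / (1 - -exp (-t) ^ 2) ^ 2) + (1 - -exp (-t) ^ 2)⁻¹) := by
    rw [tanh_eq_sinh_div_cosh, sinh_eq, cosh_eq, show exp t = (exp (-t))⁻¹ by rw [exp_neg, inv_inv], sub_neg_eq_add]
    field_simp
    ring
  rw [hv]
  refine h.congr_fun fun k => ?_
  rw [exp_neg_odd_mul, neg_pow (exp (-t) ^ 2), ← pow_mul]
  ring

lemma tsum_lambert {y : ℝ} (hy : 0 < y) :
    ∑' n : ℕ, (-1 : ℝ) ^ n * (sc y n * th y n) = ∑' n : ℕ, (-1 : ℝ) ^ n * ((2 * n + 1) * sc y n) := by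
  have hpos : ∀ n : ℕ, 0 < (2 * (n : ℝ) + 1) * y := fun n => by positivity
  have h1 : ∀ n : ℕ, (-1 : ℝ) ^ n * (sc y n * th y n) = ∑' k : ℕ, (-1 : ℝ) ^ n * ((-1 : ℝ) ^ k *
      ((2 * k + 1) * (2 * exp (-((2 * k + 1) * ((2 * n + 1) * y)))))) := fun n => by
    rw [tsum_mul_left, (hasSum_inv_cosh_mul_tanh (hpos n)).tsum_eq, sc, th]
    push_cast
    rfl
  have h2 : ∀ n : ℕ, (-1 : ℝ) ^ n * ((2 * n + 1) * sc y n) = ∑' k : ℕ, (-1 : ℝ) ^ n *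
      ((2 * n + 1) * ((-1 : ℝ) ^ k * (2 * exp (-((2 * k + 1) * ((2 * n + 1) * y)))))) := fun n => by
    rw [tsum_mul_left, tsum_mul_left, (hasSum_inv_cosh (hpos n)).tsum_eq, sc]
    push_cast
    rfl
  simp_rw [h1, h2]
  rw [Summable.tsum_comm]
  · exact tsum_congr fun n => tsum_congr fun k => by ring_nf
  · have ha : Summable fun n : ℕ => exp (-(2 * y * n)) := by
      simpa [neg_mul] using Real.summable_pow_mul_exp_neg_nat_mul 0 (by positivity : 0 < 2 * y)
    have hb : Summable fun n : ℕ => (2 * (n : ℝ) + 1) * (2 * exp (-(2 * y * n))) := by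
      have h3 := Real.summable_pow_mul_exp_neg_nat_mul 1 (by positivity : 0 < 2 * y)
      refine ((h3.mul_left 4).add (ha.mul_left 2)).congr fun n => ?_
      rw [neg_mul, pow_one]
      ring
    refine Summable.of_norm_bounded
      (hb.mul_of_nonneg ha (fun _ => by positivity) fun _ => by positivity) fun p => ?_
    simp only [Function.uncurry]
    rw [norm_mul, norm_mul, norm_pow, norm_pow, norm_neg, norm_one, one_pow, one_pow, one_mul, one_mul,
      norm_of_nonneg (by positivity)]
    rw [mul_assoc, mul_assoc, ← exp_add]
    gcongr
    have : (0 : ℝ) ≤ p.1 * p.2 * y := by positivity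
    nlinarith

lemma neg_one_zpow_natCast (n : ℕ) : (-1 : ℝ) ^ (n : ℤ) = (-1) ^ n := zpow_natCast _ _

lemma summable_alt_odd_mul_sc {y : ℝ} (hy : 0 < y) :
    Summable fun n : ℤ => (-1 : ℝ) ^ n * ((2 * n + 1) * sc y n) := by
  refine (summable_odd_mul (w := fun n => (-1) ^ n * (2 * n + 1)) 1
    (fun n => by simpa only [pow_one] using abs_alt_pow_le 1 n)
    (fun x => (abs_of_pos (inv_cosh_pos x)).trans_le (inv_cosh_le x)) hy).congr fun n => ?_
  rw [sc]
  ring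

/-- The modular transformation of `altSum`. -/
lemma altSum_modular {y : ℝ} (hy : 0 < y) :
    altSum (π ^ 2 / (4 * y)) = 4 * y ^ 2 / π ^ 2 * altSum y := by
  rw [altSum_modular_aux hy]
  congr 1
  have hs1 : Summable fun n : ℤ => (-1 : ℝ) ^ n * (sc y n * th y n) := by
    exact summable_odd_mul (w := fun n => (-1) ^ n) (g := fun x => (cosh x)⁻¹ * tanh x) 0
      (fun n => by simp)
      (fun x => (abs_inv_cosh_mul_tanh_le x).trans (inv_cosh_le x)) hy
  rw [altSum, tsum_int_eq_two_mul_tsum_nat hs1, tsum_int_eq_two_mul_tsum_nat (summable_alt_odd_mul_sc hy)]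
  · congr 1
    simpa only [neg_one_zpow_natCast, Int.cast_natCast] using tsum_lambert hy
  · intro n
    rw [neg_one_zpow_reflect, sc_neg]
    push_cast
    ring
  · intro n
    rw [neg_one_zpow_reflect, sc_neg, th_neg]
    ring

lemma eq_deriv_of_eq_of_pos {f g : ℝ → ℝ} {f' g' y : ℝ} (hy : 0 < y) (h : ∀ x, 0 < x → f x = g x)
    (hf : HasDerivAt f f' y) (hg : HasDerivAt g g' y) : f' = g' :=
  hf.unique (hg.congr_of_eventuallyEq (by filter_upwards [Ioi_mem_nhds hy] with x hx using h x hx))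

lemma exp_neg_lt_sc_zero {y : ℝ} (hy : 0 < y) : exp (-y) < sc y 0 := by
  rw [sc, Int.cast_zero, mul_zero, zero_add, one_mul, exp_neg, inv_lt_inv₀ (exp_pos y) (cosh_pos y),
    cosh_eq]
  linarith [exp_lt_exp.2 (by linarith : -y < y)]

lemma odd_mul_sc_le {y : ℝ} (hy : 0 < y) (n : ℕ) :
    (2 * n + 1) * sc y n ≤ 2 * exp (-y) * (3 * exp (-y) ^ 2) ^ n := by
  have h1 : (2 * (n : ℝ) + 1) ≤ 3 ^ n := by
    have := one_add_mul_le_pow (by norm_num : (-2 : ℝ) ≤ 2) n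
    norm_num at this
    linarith
  have h2 : sc y n ≤ 2 * (exp (-y) * exp (-y) ^ (2 * n)) := by
    rw [← exp_neg_odd_mul, sc, Int.cast_natCast]
    refine (inv_cosh_le _).trans_eq ?_
    rw [abs_of_pos (by positivity)]
  calc (2 * n + 1) * sc y n ≤ 3 ^ n * (2 * (exp (-y) * exp (-y) ^ (2 * n))) := by
        gcongr
        exact (sc_pos y n).le
    _ = _ := by rw [mul_pow, ← pow_mul]; ring

lemma tsum_mul_sc_pos {y : ℝ} (hy : π / 2 ≤ y) {w : ℕ → ℝ} (h0 : 0 < w 0)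
    (hw : ∀ n, |w n| ≤ (2 * n + 1) * w 0) : 0 < ∑' n : ℕ, w n * sc y n := by
  have hy0 : 0 < y := by linarith [pi_pos]
  have he : 9 * exp (-y) ^ 2 < 1 := by
    have h1 : exp (-y) ^ 2 ≤ exp (-1) ^ 3 := by
      rw [← exp_nat_mul, ← exp_nat_mul, exp_le_exp]
      push_cast
      linarith [pi_gt_three]
    have h2 : exp (-1) < 2 / 5 := by
      rw [exp_neg, inv_lt_comm₀ (exp_pos 1) (by norm_num)]
      linarith [exp_one_gt_d9]
    have h3 : exp (-1) ^ 3 < (2 / 5) ^ 3 := pow_lt_pow_left₀ h2 (exp_pos _).le (by norm_num)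
    norm_num at h3
    linarith
  have hq : 0 < exp (-y) := exp_pos _
  have hg := hasSum_geometric_of_lt_one (r := 3 * exp (-y) ^ 2) (by positivity) (by linarith)
  have hb : ∀ n : ℕ, |w n * sc y n| ≤ w 0 * (2 * exp (-y) * (3 * exp (-y) ^ 2) ^ n) := fun n => by
    rw [abs_mul, abs_of_pos (sc_pos y n)]
    calc |w n| * sc y n ≤ (2 * n + 1) * w 0 * sc y n := by
          gcongr
          exacts [(sc_pos y n).le, hw n]
      _ = w 0 * ((2 * n + 1) * sc y n) := by ring
      _ ≤ _ := mul_le_mul_of_nonneg_left (odd_mul_sc_le hy0 n) h0.le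
  have hs : Summable fun n : ℕ => w n * sc y n :=
    Summable.of_norm_bounded ((hg.summable.mul_left _).mul_left _) hb
  have htail : ‖∑' n : ℕ, w (n + 1) * sc y ((n + 1 : ℕ) : ℤ)‖ ≤
      w 0 * (2 * exp (-y) * (3 * exp (-y) ^ 2 * (1 - 3 * exp (-y) ^ 2)⁻¹)) := by
    refine tsum_of_norm_bounded (((hg.mul_left _).mul_left _).mul_left _) fun n => ?_
    exact (hb (n + 1)).trans_eq (by ring)
  have hsmall : 3 * exp (-y) ^ 2 * (1 - 3 * exp (-y) ^ 2)⁻¹ ≤ 1 / 2 := by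
    rw [← div_eq_mul_inv, div_le_div_iff₀ (by linarith) two_pos]
    linarith
  rw [hs.tsum_eq_zero_add]
  have h1 : w 0 * exp (-y) < w 0 * sc y ((0 : ℕ) : ℤ) := by
    gcongr
    exact exp_neg_lt_sc_zero hy0
  have h2 : w 0 * (2 * exp (-y) * (3 * exp (-y) ^ 2 * (1 - 3 * exp (-y) ^ 2)⁻¹)) ≤
      w 0 * (2 * exp (-y) * (1 / 2)) := by gcongr
  linarith [neg_le_of_abs_le htail]

lemma altSum_eq_tsum_nat {y : ℝ} (hy : 0 < y) :
    altSum y = 2 * ∑' n : ℕ, (-1 : ℝ) ^ n * (2 * n + 1) * sc y n := by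
  rw [altSum, tsum_int_eq_two_mul_tsum_nat (summable_alt_odd_mul_sc hy)]
  · simp only [neg_one_zpow_natCast, Int.cast_natCast, mul_assoc]
  · intro n
    rw [neg_one_zpow_reflect, sc_neg]
    push_cast
    ring

lemma altSum_pos {y : ℝ} (hy : 0 < y) : 0 < altSum y := by
  have main : ∀ z, π / 2 ≤ z → 0 < altSum z := fun z hz => by
    rw [altSum_eq_tsum_nat (by linarith [pi_pos])]
    refine mul_pos two_pos (tsum_mul_sc_pos hz (by norm_num) fun n => ?_)
    rw [abs_mul, abs_pow, abs_neg, abs_one, one_pow, one_mul, abs_of_pos (by positivity)]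
    simp
  rcases le_total (π / 2) y with h | h
  · exact main y h
  · have h1 := main (π ^ 2 / (4 * y)) (by
      rw [div_le_div_iff₀ two_pos (by positivity)]
      nlinarith [pi_pos])
    rw [altSum_modular hy] at h1
    exact pos_of_mul_pos_right h1 (by positivity)

/-- The logarithmic derivative of `altSum`. -/
noncomputable def altLogDeriv (y : ℝ) : ℝ := lam y - 2 * sechSq y

lemma hasDerivAt_altLogDeriv {y : ℝ} (hy : 0 < y) :
    HasDerivAt altLogDeriv (2 * sechSq y ^ 2 - 2 * sechSq y * lam y - 2 * altSum y ^ 2) y :=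
  ((hasDerivAt_lam hy).sub ((hasDerivAt_sechSq hy).const_mul 2)).congr_deriv (by ring)

lemma hasDerivAt_altLogDeriv_deriv {y : ℝ} (hy : 0 < y) :
    HasDerivAt (fun y => 2 * sechSq y ^ 2 - 2 * sechSq y * lam y - 2 * altSum y ^ 2)
      (-4 * sechSq y ^ 3 + 6 * lam y * sechSq y ^ 2 + 12 * sechSq y * altSum y ^ 2
        - 2 * lam y * altSum y ^ 2) y := by
  refine ((((hasDerivAt_sechSq hy).pow 2).const_mul 2).sub
    (((hasDerivAt_sechSq hy).const_mul 2).mul (hasDerivAt_lam hy))).sub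
      (((hasDerivAt_altSum hy).pow 2).const_mul 2) |>.congr_deriv ?_
  push_cast
  ring

lemma hasDerivAt_comp_inversion {f : ℝ → ℝ} {f' y : ℝ} (hy : 0 < y)
    (hf : HasDerivAt f f' (π ^ 2 / (4 * y))) :
    HasDerivAt (fun x => f (π ^ 2 / (4 * x))) (f' * -(π ^ 2 / (4 * y ^ 2))) y := by
  refine HasDerivAt.comp y hf (((hasDerivAt_inv hy.ne').const_mul (π ^ 2 / 4)).congr_of_eventuallyEq
    (Filter.Eventually.of_forall fun x => ?_) |>.congr_deriv ?_)
  · ring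
  · field_simp

lemma altLogDeriv_modular {y : ℝ} (hy : 0 < y) :
    -altLogDeriv (π ^ 2 / (4 * y)) = 8 * y / π ^ 2 + 4 * y ^ 2 / π ^ 2 * altLogDeriv y := by
  have hy' : 0 < π ^ 2 / (4 * y) := by positivity
  have h := eq_deriv_of_eq_of_pos hy (fun x hx => altSum_modular hx)
    (hasDerivAt_comp_inversion hy (hasDerivAt_altSum hy'))
    ((((hasDerivAt_pow 2 y).const_mul 4).div_const (π ^ 2)).mul (hasDerivAt_altSum hy))
  rw [altSum_modular hy, ← altLogDeriv, ← altLogDeriv] at h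
  refine mul_right_cancel₀ (altSum_pos hy).ne' ?_
  have := pi_ne_zero
  push_cast at h
  field_simp at h ⊢
  linear_combination h

lemma altLogDeriv_deriv_modular {y : ℝ} (hy : 0 < y) (D : ℝ → ℝ)
    (hD : ∀ x, 0 < x → HasDerivAt altLogDeriv (D x) x) :
    D (π ^ 2 / (4 * y)) * (π ^ 2 / (4 * y ^ 2)) =
      8 / π ^ 2 + 8 * y / π ^ 2 * altLogDeriv y + 4 * y ^ 2 / π ^ 2 * D y := by
  have hy' : 0 < π ^ 2 / (4 * y) := by positivity
  have h := eq_deriv_of_eq_of_pos hy (fun x hx => altLogDeriv_modular hx)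
    (hasDerivAt_comp_inversion hy (hD _ hy')).neg
    ((((hasDerivAt_id y).const_mul 8).div_const (π ^ 2)).add
      ((((hasDerivAt_pow 2 y).const_mul 4).div_const (π ^ 2)).mul (hD y hy)))
  push_cast at h
  linear_combination h

lemma altLogDeriv_pi_div_two : altLogDeriv (π / 2) = -(2 / π) := by
  have h := altLogDeriv_modular (by positivity : 0 < π / 2)
  have := pi_ne_zero
  rw [show π ^ 2 / (4 * (π / 2)) = π / 2 by field_simp; norm_num] at h
  field_simp at h ⊢
  linarith

lemma altLogDeriv_deriv_deriv_pi_div_two {D : ℝ → ℝ} {E : ℝ}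
    (hD : ∀ x, 0 < x → HasDerivAt altLogDeriv (D x) x) (hE : HasDerivAt D E (π / 2)) :
    π ^ 3 * E + 6 * π ^ 2 * D (π / 2) - 8 = 0 := by
  have hy : 0 < π / 2 := by positivity
  have hfix : π ^ 2 / (4 * (π / 2)) = π / 2 := by field_simp; norm_num
  have hE' : HasDerivAt D E (π ^ 2 / (4 * (π / 2))) := by rwa [hfix]
  have h := eq_deriv_of_eq_of_pos hy (fun x hx => altLogDeriv_deriv_modular hx D hD)
    ((hasDerivAt_comp_inversion hy hE').mul
      (((hasDerivAt_pow 2 (π / 2)).inv (by positivity)).const_mul (π ^ 2 / 4) |>.congr_of_eventuallyEq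
        (Filter.Eventually.of_forall fun x => by simp only [Pi.inv_apply]; ring)))
    (((((((hasDerivAt_id (π / 2)).const_mul 8).div_const (π ^ 2)).mul (hD _ hy)).const_add _)).add
      ((((hasDerivAt_pow 2 (π / 2)).const_mul 4).div_const (π ^ 2)).mul hE))
  simp only [hfix, id_eq, altLogDeriv_pi_div_two] at h
  have := pi_ne_zero
  push_cast at h
  field_simp at h
  linear_combination -h / 128

lemma lam_pi_div_two : lam (π / 2) = 0 := by
  have hy : 0 < π / 2 := by positivity
  have h := altLogDeriv_deriv_deriv_pi_div_two (fun x hx => hasDerivAt_altLogDeriv hx)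
    (hasDerivAt_altLogDeriv_deriv hy)
  have h1 := altLogDeriv_pi_div_two
  rw [altLogDeriv] at h1
  have hS : sechSq (π / 2) = lam (π / 2) / 2 + π⁻¹ := by
    rw [div_eq_mul_inv 2 π] at h1
    linear_combination -h1 / 2
  have h2 : lam (π / 2) * (lam (π / 2) ^ 2 + 4 * altSum (π / 2) ^ 2) = 0 := by
    rw [hS] at h
    have h3 : π ≠ 0 := pi_ne_zero
    field_simp at h
    refine mul_left_cancel₀ (pow_ne_zero 3 h3) ?_
    linear_combination h / 8
  have h4 := altSum_pos hy
  exact (mul_eq_zero.1 h2).resolve_right (by positivity)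

lemma sechSq_pi_div_two : sechSq (π / 2) = 1 / π := by
  have h := altLogDeriv_pi_div_two
  rw [altLogDeriv, lam_pi_div_two] at h
  linear_combination -h / 2

lemma beta_eq_setIntegral {a b : ℝ} (ha : 0 < a) (hb : 0 < b) :
    ProbabilityTheory.beta a b = ∫ t in Set.Ioo 0 1, t ^ (a - 1) * (1 - t) ^ (b - 1) := by
  rw [ProbabilityTheory.beta_eq_betaIntegralReal a b ha hb, Complex.betaIntegral,
    ← MeasureTheory.integral_Ioc_eq_integral_Ioo, ← intervalIntegral.integral_of_le zero_le_one]
  have h : ∫ x : ℝ in 0..1, (x : ℂ) ^ ((a : ℂ) - 1) * (1 - (x : ℂ)) ^ ((b : ℂ) - 1) =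
      ((∫ x : ℝ in 0..1, x ^ (a - 1) * (1 - x) ^ (b - 1) : ℝ) : ℂ) := by
    rw [← intervalIntegral.integral_ofReal]
    refine intervalIntegral.integral_congr fun x hx => ?_
    rw [Set.uIcc_of_le zero_le_one] at hx
    push_cast [Complex.ofReal_cpow hx.1, Complex.ofReal_cpow (sub_nonneg.2 hx.2)]
    rfl
  rw [h, Complex.ofReal_re]

lemma beta_one_fourth_one_half :
    ProbabilityTheory.beta (1 / 4) (1 / 2) ^ 2 = Gamma (1 / 4) ^ 4 / (2 * π) := by
  have h1 := Gamma_mul_Gamma_one_sub (1 / 4)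
  rw [show π * (1 / 4) = π / 4 by ring, sin_pi_div_four, show (1 : ℝ) - 1 / 4 = 3 / 4 by norm_num] at h1
  have h2 : Gamma (1 / 4) ≠ 0 := (Gamma_pos_of_pos (by norm_num)).ne'
  have h3 : Gamma (3 / 4) ≠ 0 := (Gamma_pos_of_pos (by norm_num)).ne'
  rw [ProbabilityTheory.beta, show (1 / 4 : ℝ) + 1 / 2 = 3 / 4 by norm_num, Gamma_one_half_eq, div_pow,
    mul_pow, sq_sqrt pi_pos.le]
  have h4 : (Gamma (1 / 4) * Gamma (3 / 4)) ^ 2 = 2 * π ^ 2 := by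
    rw [h1, div_pow, div_pow, sq_sqrt zero_le_two]
    ring
  have h5 := pi_ne_zero
  field_simp
  linear_combination -h4

lemma beta_eq_of_lemniscate {c d : ℝ → ℝ} {p T : ℝ} (hT : 0 < T) (hp : 0 < p)
    (hc : ∀ v, HasDerivAt c (d v) v) (hd : ∀ v, HasDerivAt d (-2 * c v ^ 3) v)
    (hcd : ∀ v, d v ^ 2 = p ^ 2 - c v ^ 4) (hc0 : c 0 ^ 2 = p) (hd0 : d 0 = 0) (hcT : c T = 0)
    (hpos : ∀ v ∈ Set.Ico 0 T, 0 < c v) :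
    ProbabilityTheory.beta (1 / 4) (1 / 2) = 4 * √p * T := by
  have hcont : Continuous c := continuous_iff_continuousAt.2 fun v => (hc v).continuousAt
  have hdcont : Continuous d := continuous_iff_continuousAt.2 fun v => (hd v).continuousAt
  have hdanti : StrictAntiOn d (Set.Icc 0 T) := by
    refine strictAntiOn_of_deriv_neg (convex_Icc _ _) hdcont.continuousOn fun v hv => ?_
    rw [interior_Icc] at hv
    have := hpos v ⟨hv.1.le, hv.2⟩
    rw [(hd v).deriv, neg_mul, neg_lt_zero]
    positivity
  have hdneg : ∀ v ∈ Set.Ioo 0 T, d v < 0 := fun v hv => by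
    simpa only [hd0] using hdanti ⟨le_rfl, hT.le⟩ ⟨hv.1.le, hv.2.le⟩ hv.1
  set f : ℝ → ℝ := fun v => c v ^ 4 / p ^ 2 with hf
  have hf' : ∀ v, HasDerivAt f (4 * c v ^ 3 * d v / p ^ 2) v := fun v => by
    simpa using ((hc v).pow 4).div_const (p ^ 2)
  have hfcont : Continuous f := continuous_iff_continuousAt.2 fun v => (hf' v).continuousAt
  have hfanti : StrictAntiOn f (Set.Icc 0 T) := by
    refine strictAntiOn_of_deriv_neg (convex_Icc _ _) hfcont.continuousOn fun v hv => ?_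
    rw [interior_Icc] at hv
    have h1 := hpos v ⟨hv.1.le, hv.2⟩
    rw [(hf' v).deriv]
    exact div_neg_of_neg_of_pos (mul_neg_of_pos_of_neg (by positivity) (hdneg v hv)) (by positivity)
  have hf0 : f 0 = 1 := by
    simp only [hf]
    rw [show c 0 ^ 4 = (c 0 ^ 2) ^ 2 by ring, hc0, div_self (by positivity)]
  have hfT : f T = 0 := by simp [hf, hcT]
  have himage : f '' Set.Ioo 0 T = Set.Ioo (f T) (f 0) := by
    refine Set.Subset.antisymm ?_ ?_
    · rintro _ ⟨v, hv, rfl⟩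
      have hv' : v ∈ Set.Icc 0 T := ⟨hv.1.le, hv.2.le⟩
      exact ⟨hfanti hv' ⟨hT.le, le_rfl⟩ hv.2, hfanti ⟨le_rfl, hT.le⟩ hv' hv.1⟩
    · exact intermediate_value_Ioo' hT.le hfcont.continuousOn
  rw [hf0, hfT] at himage
  rw [beta_eq_setIntegral (by norm_num) (by norm_num), ← himage,
    MeasureTheory.integral_image_eq_integral_abs_deriv_smul measurableSet_Ioo
      (fun v _ => (hf' v).hasDerivWithinAt) (hfanti.mono Set.Ioo_subset_Icc_self).injOn]
  have hsubst : ∀ v ∈ Set.Ioo 0 T, |4 * c v ^ 3 * d v / p ^ 2| •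
      (f v ^ (1 / 4 - 1 : ℝ) * (1 - f v) ^ (1 / 2 - 1 : ℝ)) = 4 * √p := fun v hv => by
    have h1 := hpos v ⟨hv.1.le, hv.2⟩
    have h2 := hdneg v hv
    have h3 : f v = (c v / √p) ^ 4 := by
      rw [div_pow, show √p ^ 4 = (√p ^ 2) ^ 2 by ring, sq_sqrt hp.le]
    have h4 : 1 - f v = (-d v / p) ^ 2 := by
      rw [div_pow, neg_sq, hcd]
      simp only [hf]
      field_simp
    have h5 : 0 < c v / √p := by positivity
    have h6 : 0 < -d v / p := div_pos (neg_pos.2 h2) hp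
    have h7 : √p ^ 2 = p := sq_sqrt hp.le
    have h8 : 0 < √p := sqrt_pos.2 hp
    rw [h4, h3, ← rpow_natCast (c v / √p) 4, ← rpow_natCast (-d v / p) 2, ← rpow_mul h5.le, ← rpow_mul h6.le,
      show ((4 : ℕ) : ℝ) * (1 / 4 - 1) = ((-3 : ℤ) : ℝ) by norm_num,
      show ((2 : ℕ) : ℝ) * (1 / 2 - 1) = ((-1 : ℤ) : ℝ) by norm_num, rpow_intCast, rpow_intCast,
      abs_of_neg (div_neg_of_neg_of_pos (mul_neg_of_pos_of_neg (by positivity) h2) (by positivity)),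
      smul_eq_mul, zpow_neg_one, zpow_neg]
    have h9 := h2.ne
    norm_cast
    rw [← h7]
    field_simp
    rw [h7, h7]
  rw [MeasureTheory.setIntegral_congr_fun measurableSet_Ioo hsubst]
  simp [hT.le, mul_comm]

lemma abs_cos_odd_mul_le (n : ℕ) (v : ℝ) : |cos ((2 * n + 1) * v)| ≤ (2 * n + 1) * |cos v| := by
  induction n with
  | zero => simp
  | succ n ih =>
    rw [show (2 * ((n + 1 : ℕ) : ℝ) + 1) * v = (2 * n + 1) * v + 2 * v by push_cast; ring, cos_add,
      sin_two_mul]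
    refine (abs_sub _ _).trans ?_
    rw [abs_mul, abs_mul, abs_mul, abs_mul, abs_two]
    have h1 := mul_le_of_le_one_right (abs_nonneg (cos ((2 * n + 1) * v))) (abs_cos_le_one (2 * v))
    have h2 := mul_le_mul_of_nonneg_right (mul_le_one₀ (abs_sin_le_one ((2 * n + 1) * v))
      (abs_nonneg _) (abs_sin_le_one v)) (mul_nonneg zero_le_two (abs_nonneg (cos v)))
    push_cast
    linarith

/-- The Fourier cosine series of `cnSeries`. -/
noncomputable def cnReal (y v : ℝ) : ℝ := ∑' n : ℤ, cos ((2 * n + 1) * v) * sc y n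

lemma summable_cos_mul_sc {y : ℝ} (hy : 0 < y) (v : ℝ) :
    Summable fun n : ℤ => cos ((2 * n + 1) * v) * sc y n := by
  refine Summable.of_norm_bounded (summable_sc hy) fun n => ?_
  rw [norm_mul, norm_of_nonneg (sc_pos y n).le]
  exact mul_le_of_le_one_left (sc_pos y n).le (abs_cos_le_one _)

lemma cnSeries_eq_cnReal {y : ℝ} (hy : 0 < y) (v : ℝ) : cnSeries y v = cnReal y v := by
  rw [← sub_eq_zero, cnReal, Complex.ofReal_tsum, cnSeries, trigSeries, ← Summable.tsum_sub]
  · refine tsum_eq_zero_of_reflect (-1) fun n => ?_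
    have h : ∀ n : ℤ, (sc y n : ℂ) * Complex.exp (Complex.I * (2 * n + (1 : ℤ)) * v) -
        ((cos ((2 * n + 1) * v) * sc y n : ℝ) : ℂ) = Complex.I * (sin ((2 * n + 1) * v) * sc y n : ℝ) :=
      fun n => by
        rw [show Complex.I * (2 * n + (1 : ℤ)) * v = ((2 * n + 1) * v : ℝ) * Complex.I by push_cast; ring,
          Complex.exp_mul_I]
        push_cast
        ring
    rw [h, h, sc_neg, show (2 * ((-1 - n : ℤ) : ℝ) + 1) * v = -((2 * n + 1) * v) by push_cast; ring,
      sin_neg]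
    push_cast
    ring
  · exact ((rapidDecay_sc hy).summable_trig 1 v).of_norm
  · exact Complex.ofRealCLM.summable (summable_cos_mul_sc hy v)

lemma cnReal_pos {y v : ℝ} (hy : π / 2 ≤ y) (hv : 0 < cos v) : 0 < cnReal y v := by
  have hy0 : 0 < y := by linarith [pi_pos]
  rw [cnReal, tsum_int_eq_two_mul_tsum_nat (summable_cos_mul_sc hy0 v)]
  · refine mul_pos two_pos ?_
    simp only [Int.cast_natCast]
    refine tsum_mul_sc_pos (w := fun n => cos ((2 * n + 1) * v)) hy (by simpa using hv) fun n => ?_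
    simpa [abs_of_pos hv] using abs_cos_odd_mul_le n v
  · intro n
    rw [sc_neg, show (2 * ((-1 - n : ℤ) : ℝ) + 1) * v = -((2 * n + 1) * v) by push_cast; ring, cos_neg]

lemma hasDerivAt_cnReal {y : ℝ} (hy : 0 < y) (v : ℝ) : HasDerivAt (cnReal y) (cnDeriv y v).re v := by
  have h := Complex.reCLM.hasFDerivAt.comp_hasDerivAt v (hasDerivAt_cnSeries hy v)
  refine h.congr_of_eventuallyEq (Filter.Eventually.of_forall fun x => ?_)
  simp [cnSeries_eq_cnReal hy]

lemma cnDeriv_eq_re {y : ℝ} (hy : 0 < y) (v : ℝ) : cnDeriv y v = (cnDeriv y v).re :=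
  (hasDerivAt_cnSeries hy v).unique ((hasDerivAt_cnReal hy v).ofReal_comp.congr_of_eventuallyEq
    (Filter.Eventually.of_forall fun x => cnSeries_eq_cnReal hy x))

lemma altSum_pi_div_two : altSum (π / 2) = Gamma (1 / 4) ^ 4 / (8 * π ^ 3) := by
  have hy : 0 < π / 2 := by positivity
  have hp := altSum_pos hy
  have h : ProbabilityTheory.beta (1 / 4) (1 / 2) = 4 * √(altSum (π / 2)) * (π / 2) := by
    refine beta_eq_of_lemniscate (c := cnReal (π / 2)) (d := fun v => (cnDeriv (π / 2) v).re) hy hp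
      (hasDerivAt_cnReal hy) (fun v => ?_) (fun v => ?_) ?_ ?_ ?_ fun v hv => ?_
    · have h := Complex.reCLM.hasFDerivAt.comp_hasDerivAt v (hasDerivAt_cnDeriv hy v)
      refine h.congr_deriv ?_
      rw [lam_pi_div_two, cnSeries_eq_cnReal hy]
      simp [← Complex.ofReal_pow]
    · have h := cnDeriv_sq hy v
      rw [cnDeriv_eq_re hy, cnSeries_eq_cnReal hy, lam_pi_div_two] at h
      have h1 : (cnDeriv (π / 2) v).re ^ 2 = 0 * cnReal (π / 2) v ^ 2 - cnReal (π / 2) v ^ 4 +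
        altSum (π / 2) ^ 2 := by exact_mod_cast h
      linarith
    · have h := sechSum_pow_four hy
      rw [lam_pi_div_two] at h
      have h1 : cnReal (π / 2) 0 = sechSum (π / 2) := by
        have := cnSeries_zero (π / 2)
        rw [cnSeries_eq_cnReal hy] at this
        exact_mod_cast this
      rw [h1]
      refine (pow_left_inj₀ (by positivity) hp.le two_ne_zero).1 ?_
      linarith
    · simp [cnDeriv_zero]
    · have := cnSeries_pi_div_two (π / 2)
      rw [cnSeries_eq_cnReal hy] at this
      exact_mod_cast this
    · exact cnReal_pos le_rfl (cos_pos_of_mem_Ioo ⟨by linarith [hv.1], hv.2⟩)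
  have h1 := beta_one_fourth_one_half
  rw [h, mul_pow, mul_pow, sq_sqrt hp.le] at h1
  have := pi_ne_zero
  field_simp at h1 ⊢
  linarith

lemma altCubeSum_eq {y : ℝ} (hy : 0 < y) :
    altCubeSum y = -(1 / 2) * ((lam y + (2 * sechSq y ^ 2 - 2 * sechSq y * lam y - 2 * altSum y ^ 2)
      + altLogDeriv y ^ 2) * altSum y) := by
  have h := (hasDerivAt_mul_altSum hy).unique ((hasDerivAt_altLogDeriv hy).mul (hasDerivAt_altSum hy))
  rw [← altLogDeriv] at h
  linear_combination -(1 / 2) * h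

lemma tsum_alt_pow_four_mul_sc_cube_mul_th_pi_div_two :
    ∑' n : ℤ, (-1 : ℝ) ^ n * ((2 * n + 1) ^ 4 * (sc (π / 2) n ^ 3 * th (π / 2) n)) =
      -4 * altSum (π / 2) / π ^ 3 + 4 * altSum (π / 2) ^ 3 / π - 2 * altSum (π / 2) ^ 3 / 3 := by
  have hy : 0 < π / 2 := by positivity
  have h := eq_deriv_of_eq_of_pos hy (fun x hx => altCubeSum_eq hx) (hasDerivAt_altCubeSum hy)
    (((((hasDerivAt_lam hy).add (hasDerivAt_altLogDeriv_deriv hy)).add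
      ((hasDerivAt_altLogDeriv hy).pow 2)).mul (hasDerivAt_altSum hy)).const_mul (-(1 / 2)))
  simp only [Pi.add_apply, Pi.pow_apply, lam_pi_div_two, sechSq_pi_div_two, altLogDeriv_pi_div_two] at h
  have := pi_ne_zero
  push_cast at h
  field_simp at h ⊢
  linear_combination -h / 2

end SechSums

open SechSums

theorem sum_odd_fourth_sinh_cosh_fourth :
    (∑' n : ℕ, (-1 : ℝ) ^ n * (2*(n:ℝ)+1) ^ 4 * Real.sinh ((2*(n:ℝ)+1) * π / 2)
        / Real.cosh ((2*(n:ℝ)+1) * π / 2) ^ 4) =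
      -(Real.Gamma (1/4) ^ 4 / (2 ^ 2 * π ^ 6))
    - Real.Gamma (1/4) ^ 12 / (3 * 2 ^ 9 * π ^ 9)
    + Real.Gamma (1/4) ^ 12 / (2 ^ 8 * π ^ 10) := by
  have hs : Summable fun n : ℤ => (-1 : ℝ) ^ n * ((2 * n + 1) ^ 4 * (sc (π / 2) n ^ 3 * th (π / 2) n)) := by
    refine (summable_odd_mul (w := fun n => (-1) ^ n * (2 * n + 1) ^ 4)
      (g := fun x => (cosh x)⁻¹ ^ 3 * tanh x) (B := 2) 4 (fun n => abs_alt_pow_le 4 n) (fun x => ?_)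
      (by positivity : 0 < π / 2)).congr fun n => ?_
    · rw [pow_succ, mul_assoc, abs_mul, abs_of_pos (pow_pos (inv_cosh_pos x) 2)]
      exact (mul_le_of_le_one_left (abs_nonneg _) (pow_le_one₀ (inv_cosh_pos x).le
        (inv_cosh_le_one x))).trans ((abs_inv_cosh_mul_tanh_le x).trans (inv_cosh_le x))
    · rw [sc, th]
      ring
  have h := tsum_alt_pow_four_mul_sc_cube_mul_th_pi_div_two
  rw [tsum_int_eq_two_mul_tsum_nat hs, altSum_pi_div_two] at h
  · have h1 : ∀ n : ℕ, (-1 : ℝ) ^ n * (2 * (n : ℝ) + 1) ^ 4 * sinh ((2 * (n : ℝ) + 1) * π / 2)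
        / cosh ((2 * (n : ℝ) + 1) * π / 2) ^ 4 = (-1 : ℝ) ^ (n : ℤ) *
        ((2 * ((n : ℤ) : ℝ) + 1) ^ 4 * (sc (π / 2) n ^ 3 * th (π / 2) n)) := fun n => by
      have := (cosh_pos ((2 * (n : ℝ) + 1) * (π / 2))).ne'
      rw [sc, th, tanh_eq_sinh_div_cosh, zpow_natCast, Int.cast_natCast, mul_div_assoc (_ + _)]
      field_simp
    rw [tsum_congr h1]
    have := pi_ne_zero
    field_simp at h ⊢
    linear_combination h / 2
  · intro n
    rw [neg_one_zpow_reflect, sc_neg, th_neg]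
    push_cast
    ring
end

section
/- Σ_{n=0}^∞ (−1)^n (2n+1)^5 / cosh((2n+1)π/2)^5 = 5Γ^4/(2^4 π^7) − 5Γ^12/(2^9 π^11) + 25Γ^12/(3·2^9 π^10) − 9Γ^12/(2^11 π^9) + Γ^20/(3·2^16 π^15), where Γ = Γ(1/4). -/
open Real

section

open Complex
open UpperHalfPlane hiding I σ
open Filter Topology
open scoped ArithmeticFunction.sigma MatrixGroups ModularForm Manifold
open Derivative
open Set MeasureTheory

/-- The `q`-series `∑ n ^ j * σ k n * q ^ n` with `q = exp (2 π i τ)`. -/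
noncomputable def sigmaSeries (k j : ℕ) (τ : ℂ) : ℂ :=
  ∑' n : ℕ, (n : ℂ) ^ j * (σ k n : ℂ) * cexp (2 * π * I * τ) ^ n

lemma norm_cexp_two_pi_I_mul (τ : ℂ) : ‖cexp (2 * π * I * τ)‖ = rexp (-(2 * π * τ.im)) := by
  rw [Complex.norm_exp]
  simp

lemma norm_cexp_two_pi_I_mul_lt_one {τ : ℂ} (hτ : 0 < τ.im) : ‖cexp (2 * π * I * τ)‖ < 1 := by
  rw [norm_cexp_two_pi_I_mul, Real.exp_lt_one_iff]
  have := Real.pi_pos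
  nlinarith [mul_pos this hτ]

lemma norm_sigmaSeries_term_le (k j n : ℕ) (q : ℂ) :
    ‖(n : ℂ) ^ j * (σ k n : ℂ) * q ^ n‖ ≤ (n : ℝ) ^ (j + k + 1) * ‖q‖ ^ n := by
  rw [norm_mul, norm_mul, norm_pow, norm_pow, Complex.norm_natCast, Complex.norm_natCast,
    add_assoc, pow_add]
  gcongr
  exact_mod_cast ArithmeticFunction.sigma_le_pow_succ k n

lemma summable_pow_mul_norm_pow (m : ℕ) {r : ℝ} (hr : 0 ≤ r) (hr1 : r < 1) :
    Summable fun n : ℕ ↦ (n : ℝ) ^ m * r ^ n := by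
  simpa using summable_pow_mul_geometric_of_norm_lt_one m (r := r)
    (by rwa [Real.norm_of_nonneg hr])

lemma summable_sigmaSeries_term (k j : ℕ) {q : ℂ} (hq : ‖q‖ < 1) :
    Summable fun n : ℕ ↦ (n : ℂ) ^ j * (σ k n : ℂ) * q ^ n :=
  .of_norm_bounded (summable_pow_mul_norm_pow (j + k + 1) (norm_nonneg q) hq)
    fun n ↦ norm_sigmaSeries_term_le k j n q

lemma hasDerivAt_sigmaSeries (k j : ℕ) {τ : ℂ} (hτ : 0 < τ.im) :
    HasDerivAt (sigmaSeries k j) (2 * π * I * sigmaSeries k (j + 1) τ) τ := by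
  set U : Set ℂ := {w | τ.im / 2 < w.im}
  have hU : IsOpen U := isOpen_lt continuous_const Complex.continuous_im
  have hτU : τ ∈ U := by simp only [U, Set.mem_ofPred_eq]; linarith
  set r : ℝ := rexp (-(2 * π * (τ.im / 2)))
  have hr1 : r < 1 := by
    rw [Real.exp_lt_one_iff]
    have := mul_pos Real.pi_pos hτ
    linarith
  have hterm (n : ℕ) (w : ℂ) : HasDerivAt
      (fun w ↦ (n : ℂ) ^ j * (σ k n : ℂ) * cexp (2 * π * I * w) ^ n)
      (2 * π * I * ((n : ℂ) ^ (j + 1) * (σ k n : ℂ) * cexp (2 * π * I * w) ^ n)) w := by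
    have h : HasDerivAt (fun w ↦ (n : ℂ) ^ j * (σ k n : ℂ) * cexp (n * (2 * π * I * w)))
        ((n : ℂ) ^ j * (σ k n : ℂ) * (cexp (n * (2 * π * I * w)) * (n * (2 * π * I * 1)))) w :=
      ((((hasDerivAt_id w).const_mul (2 * π * I)).const_mul (n : ℂ)).cexp).const_mul _
    simp only [Complex.exp_nat_mul] at h
    convert h using 1
    ring
  have hbound (n : ℕ) (w : ℂ) (hw : w ∈ U) :
      ‖(n : ℂ) ^ j * (σ k n : ℂ) * cexp (2 * π * I * w) ^ n‖ ≤ (n : ℝ) ^ (j + k + 1) * r ^ n := by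
    refine (norm_sigmaSeries_term_le k j n _).trans ?_
    gcongr
    rw [norm_cexp_two_pi_I_mul, Real.exp_le_exp]
    have : τ.im / 2 < w.im := hw
    have := mul_lt_mul_of_pos_left this Real.pi_pos
    linarith
  have hsum := summable_pow_mul_norm_pow (j + k + 1) (Real.exp_nonneg _) hr1
  have hdiff (n : ℕ) : DifferentiableOn ℂ
      (fun w ↦ (n : ℂ) ^ j * (σ k n : ℂ) * cexp (2 * π * I * w) ^ n) U :=
    fun w _ ↦ (hterm n w).differentiableAt.differentiableWithinAt
  have key := hasSum_deriv_of_summable_norm hsum hdiff hU hbound hτU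
  have hd : DifferentiableAt ℂ (sigmaSeries k j) τ :=
    ((differentiableOn_tsum_of_summable_norm hsum hdiff hU hbound) τ hτU).differentiableAt
      (hU.mem_nhds hτU)
  have : deriv (sigmaSeries k j) τ = 2 * π * I * sigmaSeries k (j + 1) τ := by
    rw [show deriv (sigmaSeries k j) τ = _ from key.tsum_eq.symm, sigmaSeries, ← tsum_mul_left]
    exact tsum_congr fun n ↦ (hterm n τ).deriv
  exact this ▸ hd.hasDerivAt

lemma sigmaSeries_add_one (k j : ℕ) (τ : ℂ) :
    sigmaSeries k j (τ + 1) = sigmaSeries k j τ := by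
  simp only [sigmaSeries, mul_add, mul_one, Complex.exp_periodic _]

lemma tendsto_sigmaSeries_atImInfty (k j : ℕ) :
    Tendsto (fun τ : ℍ ↦ sigmaSeries k j τ) atImInfty (𝓝 0) := by
  have hr1 : rexp (-(2 * π)) < 1 := by
    rw [Real.exp_lt_one_iff]; linarith [Real.pi_pos]
  have hsum := summable_pow_mul_norm_pow (j + k + 1) (Real.exp_nonneg _) hr1
  have := tendsto_tsum_of_dominated_convergence (𝓕 := atImInfty)
    (f := fun (τ : ℍ) (n : ℕ) ↦ (n : ℂ) ^ j * (σ k n : ℂ) * cexp (2 * π * I * τ) ^ n)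
    (g := fun _ ↦ 0) hsum ?_ ?_
  · simpa [sigmaSeries] using this
  · intro n
    rcases Nat.eq_zero_or_pos n with rfl | hn
    · simp
    · have hq : Tendsto (fun τ : ℍ ↦ cexp (2 * π * I * τ)) atImInfty (𝓝 0) := by
        rw [tendsto_zero_iff_norm_tendsto_zero]
        simp only [norm_cexp_two_pi_I_mul, UpperHalfPlane.coe_im]
        exact Real.tendsto_exp_neg_atTop_nhds_zero.comp
          (tendsto_comap.const_mul_atTop (by positivity))
      simpa [hn.ne'] using (hq.pow n).const_mul ((n : ℂ) ^ j * (σ k n : ℂ))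
  · filter_upwards [preimage_mem_comap (Ici_mem_atTop 1)] with τ hτ n
    refine (norm_sigmaSeries_term_le k j n _).trans ?_
    gcongr
    rw [norm_cexp_two_pi_I_mul, Real.exp_le_exp, UpperHalfPlane.coe_im]
    have : 1 ≤ τ.im := hτ
    nlinarith [Real.pi_pos]

lemma tsum_pnat_sigma_eq_sigmaSeries (k : ℕ) (τ : ℍ) :
    ∑' n : ℕ+, (σ k n : ℂ) * cexp (2 * π * I * τ) ^ (n : ℕ) = sigmaSeries k 0 τ := by
  have h := summable_sigmaSeries_term k 0 (norm_cexp_two_pi_I_mul_lt_one τ.im_pos)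
  simp only [pow_zero, one_mul] at h
  have := tsum_zero_pnat_eq_tsum_nat h
  simpa [sigmaSeries] using this

lemma E2_eq_sigmaSeries (τ : ℍ) : EisensteinSeries.E2 τ = 1 - 24 * sigmaSeries 1 0 τ := by
  rw [EisensteinSeries.E2_eq_tsum_cexp, ← tsum_pnat_sigma_eq_sigmaSeries]

open ModularForm in
lemma E4_eq_sigmaSeries (τ : ℍ) : E₄ τ = 1 + 240 * sigmaSeries 3 0 τ := by
  have := EisensteinSeries.q_expansion_bernoulli (k := 4) (by norm_num) ⟨2, rfl⟩ τ
  rw [show bernoulli 4 = -1 / 30 by decide +kernel] at this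
  rw [← tsum_pnat_sigma_eq_sigmaSeries, this]
  norm_num

open ModularForm in
lemma E6_eq_sigmaSeries (τ : ℍ) : E₆ τ = 1 - 504 * sigmaSeries 5 0 τ := by
  have := EisensteinSeries.q_expansion_bernoulli (k := 6) (by norm_num) ⟨3, rfl⟩ τ
  rw [show bernoulli 6 = 1 / 42 by decide +kernel] at this
  rw [← tsum_pnat_sigma_eq_sigmaSeries, this]
  norm_num

/-- A holomorphic function of weight less than `12` that is invariant under `SL(2, ℤ)` and vanishes
at infinity is zero. -/
lemma eq_zero_of_slash_invariant {k : ℤ} (hk : k < 12) {f : ℍ → ℂ} (hf : MDiff f)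
    (hinv : ∀ γ : SL(2, ℤ), f ∣[k] γ = f) (hlim : Tendsto f atImInfty (𝓝 0)) : f = 0 := by
  let F : CuspForm 𝒮ℒ k :=
    { toFun := f
      slash_action_eq' := by
        intro A hA
        obtain ⟨A, rfl⟩ := hA
        exact hinv A
      holo' := hf
      zero_at_cusps' := by
        intro c hc
        rw [Subgroup.IsArithmetic.isCusp_iff_isCusp_SL2Z] at hc
        rw [OnePoint.isZeroAt_iff_forall_SL2Z hc]
        intro γ _
        rw [hinv]
        exact hlim }
  have hF : F = 0 := rank_zero_iff_forall_zero.mp (CuspForm.rank_eq_zero_of_weight_lt_twelve hk) F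
  exact congrArg (fun G : CuspForm 𝒮ℒ k ↦ (G : ℍ → ℂ)) hF

lemma normalizedDerivOfComplex_eq_of_hasDerivAt {F : ℍ → ℂ} {f : ℂ → ℂ} {f' : ℂ}
    (hF : ∀ τ : ℍ, F τ = f τ) {τ : ℍ} (hf : HasDerivAt f (2 * π * I * f') τ) : D F τ = f' := by
  have h : F ∘ ofComplex =ᶠ[𝓝 (τ : ℂ)] f := by
    filter_upwards [isOpen_upperHalfPlaneSet.mem_nhds τ.im_pos] with w hw
    simp [hF, ofComplex_apply_of_im_pos hw]
  rw [normalizedDerivOfComplex, h.deriv_eq, hf.deriv,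
    inv_mul_cancel_left₀ Complex.two_pi_I_ne_zero]

lemma normalizedDeriv_E2 (τ : ℍ) : D EisensteinSeries.E2 τ = -24 * sigmaSeries 1 1 τ := by
  refine normalizedDerivOfComplex_eq_of_hasDerivAt (f := fun w ↦ 1 - 24 * sigmaSeries 1 0 w)
    E2_eq_sigmaSeries ?_
  convert! ((hasDerivAt_sigmaSeries 1 0 τ.im_pos).const_mul 24).const_sub 1 using 1
  ring

open ModularForm in
lemma normalizedDeriv_E4 (τ : ℍ) : D E₄ τ = 240 * sigmaSeries 3 1 τ := by
  refine normalizedDerivOfComplex_eq_of_hasDerivAt (f := fun w ↦ 1 + 240 * sigmaSeries 3 0 w)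
    E4_eq_sigmaSeries ?_
  convert! ((hasDerivAt_sigmaSeries 3 0 τ.im_pos).const_mul 240).const_add 1 using 1
  ring

open ModularForm in
lemma normalizedDeriv_E6 (τ : ℍ) : D E₆ τ = -504 * sigmaSeries 5 1 τ := by
  refine normalizedDerivOfComplex_eq_of_hasDerivAt (f := fun w ↦ 1 - 504 * sigmaSeries 5 0 w)
    E6_eq_sigmaSeries ?_
  convert! ((hasDerivAt_sigmaSeries 5 0 τ.im_pos).const_mul 504).const_sub 1 using 1
  ring

lemma E2_slash_eq (γ : SL(2, ℤ)) (τ : ℍ) : (EisensteinSeries.E2 ∣[(2 : ℤ)] γ) τ =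
    EisensteinSeries.E2 τ - 6 * I / π * (γ 1 0 / denom γ τ) := by
  have hπ : (π : ℂ) ≠ 0 := by exact_mod_cast Real.pi_ne_zero
  rw [EisensteinSeries.E2_slash_action, riemannZeta_two]
  simp only [Pi.sub_apply, Pi.smul_apply, EisensteinSeries.D2, smul_eq_mul]
  field_simp

lemma normalizedDeriv_E2_slash (γ : SL(2, ℤ)) (τ : ℍ) :
    D (EisensteinSeries.E2 ∣[(2 : ℤ)] γ) τ = D EisensteinSeries.E2 τ +
      3 / π ^ 2 * (γ 1 0 / denom γ τ) ^ 2 := by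
  have hπ : (π : ℂ) ≠ 0 := by exact_mod_cast Real.pi_ne_zero
  have hden : HasDerivAt (fun w : ℂ ↦ denom (γ : GL (Fin 2) ℝ) w) (γ 1 0) τ := by
    simpa using hasDerivAt_denom_zpow (γ : GL (Fin 2) ℝ) 1 τ
  have hu : HasDerivAt (fun w : ℂ ↦ (γ 1 0 : ℂ) / denom (γ : GL (Fin 2) ℝ) w)
      (-(γ 1 0 / denom (γ : GL (Fin 2) ℝ) τ) ^ 2) τ := by
    convert! (hden.fun_inv (denom_ne_zero _ τ)).const_mul (γ 1 0 : ℂ) using 1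
    have := denom_ne_zero (γ : GL (Fin 2) ℝ) τ
    field_simp
  have h := (((hasDerivAt_sigmaSeries 1 0 τ.im_pos).const_mul 24).const_sub 1).sub
    (hu.const_mul (6 * I / π))
  rw [normalizedDeriv_E2]
  refine normalizedDerivOfComplex_eq_of_hasDerivAt (fun τ ↦ ?_) (h.congr_deriv ?_)
  · rw [E2_slash_eq, E2_eq_sigmaSeries]
    rfl
  · field_simp
    ring_nf

lemma normalizedDeriv_E2_eq (τ : ℍ) :
    D EisensteinSeries.E2 τ = (EisensteinSeries.E2 τ ^ 2 - ModularForm.E₄ τ) / 12 := by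
  have hE4 (γ : SL(2, ℤ)) : (ModularForm.E₄ : ℍ → ℂ) ∣[(4 : ℤ)] γ = ModularForm.E₄ :=
    ModularForm.E₄.slash_action_eq' _ ⟨γ, rfl⟩
  have hmd : MDiff (ModularForm.E₄ : ℍ → ℂ) := ModularForm.E₄.holo'
  have hE2 := E2_mdifferentiable
  set f : ℍ → ℂ := D EisensteinSeries.E2 -
    (1 / 12 : ℂ) • (EisensteinSeries.E2 * EisensteinSeries.E2 - ModularForm.E₄) with hf
  have hf0 : f = 0 := by
    refine eq_zero_of_slash_invariant (k := 4) (by norm_num) ?_ ?_ ?_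
    · exact (normalizedDerivOfComplex_mdifferentiable hE2).sub
        (((hE2.mul hE2).sub hmd).const_smul _)
    · intro γ
      have hD : D EisensteinSeries.E2 ∣[(4 : ℤ)] γ = _ :=
        (sub_eq_iff_eq_add.mp (normalizedDerivOfComplex_SL_slash (k := 2) hE2 (γ := γ)).symm)
      have hmul : (EisensteinSeries.E2 * EisensteinSeries.E2) ∣[(4 : ℤ)] γ = _ :=
        ModularForm.mul_slash_SL2 2 2 γ EisensteinSeries.E2 EisensteinSeries.E2
      ext τ
      have hπ : (π : ℂ) ≠ 0 := by exact_mod_cast Real.pi_ne_zero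
      simp only [hf, sub_eq_add_neg, SlashAction.add_slash, SlashAction.neg_slash,
        ModularForm.SL_smul_slash, hD, hmul, hE4]
      simp only [Pi.add_apply, Pi.neg_apply, Pi.smul_apply, Pi.mul_apply,
        normalizedDeriv_E2_slash, E2_slash_eq, smul_eq_mul]
      generalize (γ 1 0 / denom γ τ : ℂ) = u
      field_simp
      ring_nf
      simp
    · have h1 := tendsto_sigmaSeries_atImInfty 1 0
      have h2 := tendsto_sigmaSeries_atImInfty 1 1
      have h3 := tendsto_sigmaSeries_atImInfty 3 0
      have h4 : f = fun τ : ℍ ↦ -24 * sigmaSeries 1 1 τ - (1 / 12 : ℂ) *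
          ((1 - 24 * sigmaSeries 1 0 τ) * (1 - 24 * sigmaSeries 1 0 τ) -
            (1 + 240 * sigmaSeries 3 0 τ)) := by
        ext τ
        simp [hf, normalizedDeriv_E2, E2_eq_sigmaSeries, E4_eq_sigmaSeries]
      have h5 : Tendsto (fun τ : ℍ ↦ 1 - 24 * sigmaSeries 1 0 τ) atImInfty (𝓝 1) := by
        simpa using (h1.const_mul 24).const_sub 1
      have h6 : Tendsto (fun τ : ℍ ↦ 1 + 240 * sigmaSeries 3 0 τ) atImInfty (𝓝 1) := by
        simpa using (h3.const_mul 240).const_add 1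
      rw [h4]
      simpa using (h2.const_mul (-24)).sub (((h5.mul h5).sub h6).const_mul (1 / 12 : ℂ))
  have := congrFun hf0 τ
  simp only [hf, Pi.sub_apply, Pi.smul_apply, Pi.mul_apply, smul_eq_mul, Pi.zero_apply] at this
  linear_combination this

open ModularForm in
lemma normalizedDeriv_E4_eq (τ : ℍ) :
    D E₄ τ = (EisensteinSeries.E2 τ * E₄ τ - E₆ τ) / 3 := by
  have hE4 (γ : SL(2, ℤ)) : (E₄ : ℍ → ℂ) ∣[(4 : ℤ)] γ = E₄ := E₄.slash_action_eq' _ ⟨γ, rfl⟩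
  have hE6 (γ : SL(2, ℤ)) : (E₆ : ℍ → ℂ) ∣[(6 : ℤ)] γ = E₆ := E₆.slash_action_eq' _ ⟨γ, rfl⟩
  have hmd4 : MDiff (E₄ : ℍ → ℂ) := E₄.holo'
  have hmd6 : MDiff (E₆ : ℍ → ℂ) := E₆.holo'
  set f : ℍ → ℂ := serreDerivative (4 : ℤ) E₄ + (1 / 3 : ℂ) • (E₆ : ℍ → ℂ) with hf
  have hf0 : f = 0 := by
    refine eq_zero_of_slash_invariant (k := 6) (by norm_num) ?_ ?_ ?_
    · exact (serreDerivative_mdifferentiable _ hmd4).add (hmd6.const_smul _)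
    · intro γ
      have hS : serreDerivative (4 : ℤ) E₄ ∣[(6 : ℤ)] γ = _ :=
        serreDerivative_slash_invariant hmd4 (hE4 γ)
      rw [hf, SlashAction.add_slash, ModularForm.SL_smul_slash, hS, hE6]
    · have h1 := tendsto_sigmaSeries_atImInfty 1 0
      have h2 := tendsto_sigmaSeries_atImInfty 3 1
      have h3 := tendsto_sigmaSeries_atImInfty 3 0
      have h4 := tendsto_sigmaSeries_atImInfty 5 0
      have h5 : f = fun τ : ℍ ↦ 240 * sigmaSeries 3 1 τ - 4 * 12⁻¹ *
          (1 - 24 * sigmaSeries 1 0 τ) * (1 + 240 * sigmaSeries 3 0 τ) +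
            (1 / 3 : ℂ) * (1 - 504 * sigmaSeries 5 0 τ) := by
        ext τ
        simp [hf, normalizedDeriv_E4, E2_eq_sigmaSeries, E4_eq_sigmaSeries, E6_eq_sigmaSeries]
      rw [h5]
      have := ((h2.const_mul 240).sub ((((h1.const_mul 24).const_sub 1).const_mul
        (4 * 12⁻¹ : ℂ)).mul ((h3.const_mul 240).const_add 1))).add
        (((h4.const_mul 504).const_sub 1).const_mul (1 / 3 : ℂ))
      convert this using 2
      norm_num
  have := congrFun hf0 τ
  simp only [hf, Pi.add_apply, Pi.smul_apply, serreDerivative_apply, smul_eq_mul,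
    Pi.zero_apply] at this
  push_cast at this
  linear_combination this

open ModularForm in
lemma normalizedDeriv_E6_eq (τ : ℍ) :
    D E₆ τ = (EisensteinSeries.E2 τ * E₆ τ - E₄ τ ^ 2) / 2 := by
  have hE4 (γ : SL(2, ℤ)) : (E₄ : ℍ → ℂ) ∣[(4 : ℤ)] γ = E₄ := E₄.slash_action_eq' _ ⟨γ, rfl⟩
  have hE6 (γ : SL(2, ℤ)) : (E₆ : ℍ → ℂ) ∣[(6 : ℤ)] γ = E₆ := E₆.slash_action_eq' _ ⟨γ, rfl⟩
  have hmd4 : MDiff (E₄ : ℍ → ℂ) := E₄.holo'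
  have hmd6 : MDiff (E₆ : ℍ → ℂ) := E₆.holo'
  set f : ℍ → ℂ := serreDerivative (6 : ℤ) E₆ + (1 / 2 : ℂ) • (E₄ * E₄ : ℍ → ℂ) with hf
  have hf0 : f = 0 := by
    refine eq_zero_of_slash_invariant (k := 8) (by norm_num) ?_ ?_ ?_
    · exact (serreDerivative_mdifferentiable _ hmd6).add ((hmd4.mul hmd4).const_smul _)
    · intro γ
      have hS : serreDerivative (6 : ℤ) E₆ ∣[(8 : ℤ)] γ = _ :=
        serreDerivative_slash_invariant hmd6 (hE6 γ)
      have hmul : (E₄ * E₄ : ℍ → ℂ) ∣[(8 : ℤ)] γ = _ := ModularForm.mul_slash_SL2 4 4 γ E₄ E₄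
      rw [hf, SlashAction.add_slash, ModularForm.SL_smul_slash, hS, hmul, hE4]
    · have h1 := tendsto_sigmaSeries_atImInfty 1 0
      have h2 := tendsto_sigmaSeries_atImInfty 5 1
      have h3 := tendsto_sigmaSeries_atImInfty 3 0
      have h4 := tendsto_sigmaSeries_atImInfty 5 0
      have h5 : f = fun τ : ℍ ↦ -504 * sigmaSeries 5 1 τ - 6 * 12⁻¹ *
          (1 - 24 * sigmaSeries 1 0 τ) * (1 - 504 * sigmaSeries 5 0 τ) +
            (1 / 2 : ℂ) * ((1 + 240 * sigmaSeries 3 0 τ) * (1 + 240 * sigmaSeries 3 0 τ)) := by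
        ext τ
        simp [hf, normalizedDeriv_E6, E2_eq_sigmaSeries, E4_eq_sigmaSeries, E6_eq_sigmaSeries]
      rw [h5]
      have h6 : Tendsto (fun τ : ℍ ↦ 1 + 240 * sigmaSeries 3 0 τ) atImInfty (𝓝 1) := by
        simpa using (h3.const_mul 240).const_add 1
      have := ((h2.const_mul (-504)).sub ((((h1.const_mul 24).const_sub 1).const_mul
        (6 * 12⁻¹ : ℂ)).mul ((h4.const_mul 504).const_sub 1))).add
        ((h6.mul h6).const_mul (1 / 2 : ℂ))
      convert this using 2
      norm_num
  have := congrFun hf0 τ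
  simp only [hf, Pi.add_apply, Pi.smul_apply, Pi.mul_apply, serreDerivative_apply, smul_eq_mul,
    Pi.zero_apply] at this
  push_cast at this
  linear_combination this

/-- The Eisenstein series `E₂` as a function on `ℂ`. -/
noncomputable def eisTwo (τ : ℂ) : ℂ := 1 - 24 * sigmaSeries 1 0 τ

/-- The Eisenstein series `E₄` as a function on `ℂ`. -/
noncomputable def eisFour (τ : ℂ) : ℂ := 1 + 240 * sigmaSeries 3 0 τ

/-- The Eisenstein series `E₆` as a function on `ℂ`. -/
noncomputable def eisSix (τ : ℂ) : ℂ := 1 - 504 * sigmaSeries 5 0 τ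

lemma sigmaSeries_one_one {τ : ℂ} (hτ : 0 < τ.im) :
    sigmaSeries 1 1 τ = -(eisTwo τ ^ 2 - eisFour τ) / 288 := by
  have h := normalizedDeriv_E2_eq ⟨τ, hτ⟩
  rw [normalizedDeriv_E2, E2_eq_sigmaSeries, E4_eq_sigmaSeries] at h
  simp only at h
  rw [eisTwo, eisFour]
  linear_combination -h / 24

lemma sigmaSeries_three_one {τ : ℂ} (hτ : 0 < τ.im) :
    sigmaSeries 3 1 τ = (eisTwo τ * eisFour τ - eisSix τ) / 720 := by
  have h := normalizedDeriv_E4_eq ⟨τ, hτ⟩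
  rw [normalizedDeriv_E4, E2_eq_sigmaSeries, E4_eq_sigmaSeries, E6_eq_sigmaSeries] at h
  simp only at h
  rw [eisTwo, eisFour, eisSix]
  linear_combination h / 240

lemma sigmaSeries_five_one {τ : ℂ} (hτ : 0 < τ.im) :
    sigmaSeries 5 1 τ = -(eisTwo τ * eisSix τ - eisFour τ ^ 2) / 1008 := by
  have h := normalizedDeriv_E6_eq ⟨τ, hτ⟩
  rw [normalizedDeriv_E6, E2_eq_sigmaSeries, E4_eq_sigmaSeries, E6_eq_sigmaSeries] at h
  simp only at h
  rw [eisTwo, eisFour, eisSix]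
  linear_combination -h / 504

lemma hasDerivAt_eisTwo {τ : ℂ} (hτ : 0 < τ.im) :
    HasDerivAt eisTwo (2 * π * I * ((eisTwo τ ^ 2 - eisFour τ) / 12)) τ := by
  refine (((hasDerivAt_sigmaSeries 1 0 hτ).const_mul 24).const_sub 1).congr_deriv ?_
  rw [sigmaSeries_one_one hτ]
  ring

lemma hasDerivAt_eisFour {τ : ℂ} (hτ : 0 < τ.im) :
    HasDerivAt eisFour (2 * π * I * ((eisTwo τ * eisFour τ - eisSix τ) / 3)) τ := by
  refine (((hasDerivAt_sigmaSeries 3 0 hτ).const_mul 240).const_add 1).congr_deriv ?_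
  rw [sigmaSeries_three_one hτ]
  ring

lemma hasDerivAt_eisSix {τ : ℂ} (hτ : 0 < τ.im) :
    HasDerivAt eisSix (2 * π * I * ((eisTwo τ * eisSix τ - eisFour τ ^ 2) / 2)) τ := by
  refine (((hasDerivAt_sigmaSeries 5 0 hτ).const_mul 504).const_sub 1).congr_deriv ?_
  rw [sigmaSeries_five_one hτ]
  ring

/-- Differentiating an identity for a `sigmaSeries` on the upper half plane. -/
lemma sigmaSeries_succ_eq_of_hasDerivAt {k j : ℕ} {f : ℂ → ℂ} {f' τ : ℂ} (hτ : 0 < τ.im)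
    (h : ∀ w : ℂ, 0 < w.im → sigmaSeries k j w = f w) (hf : HasDerivAt f (2 * π * I * f') τ) :
    sigmaSeries k (j + 1) τ = f' := by
  have he : sigmaSeries k j =ᶠ[𝓝 τ] f := by
    filter_upwards [isOpen_upperHalfPlaneSet.mem_nhds hτ] with w hw using h w hw
  exact mul_left_cancel₀ Complex.two_pi_I_ne_zero
    ((hasDerivAt_sigmaSeries k j hτ).unique (hf.congr_of_eventuallyEq he))

lemma sigmaSeries_one_two {τ : ℂ} (hτ : 0 < τ.im) : sigmaSeries 1 2 τ =
    -(eisTwo τ ^ 3 - 3 * eisTwo τ * eisFour τ + 2 * eisSix τ) / 1728 := by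
  refine sigmaSeries_succ_eq_of_hasDerivAt hτ (fun w hw ↦ sigmaSeries_one_one hw) ?_
  have h2 := hasDerivAt_eisTwo hτ
  have h4 := hasDerivAt_eisFour hτ
  refine (((h2.fun_pow 2).fun_sub h4).fun_neg.div_const 288).congr_deriv ?_
  norm_num
  ring

lemma sigmaSeries_one_three {τ : ℂ} (hτ : 0 < τ.im) : sigmaSeries 1 3 τ =
    -(eisTwo τ ^ 4 - 6 * eisTwo τ ^ 2 * eisFour τ + 8 * eisTwo τ * eisSix τ - 3 * eisFour τ ^ 2)
      / 6912 := by
  refine sigmaSeries_succ_eq_of_hasDerivAt hτ (fun w hw ↦ sigmaSeries_one_two hw) ?_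
  have h2 := hasDerivAt_eisTwo hτ
  have h4 := hasDerivAt_eisFour hτ
  have h6 := hasDerivAt_eisSix hτ
  refine ((((h2.fun_pow 3).fun_sub ((h2.const_mul 3).fun_mul h4)).fun_add
    (h6.const_mul 2)).fun_neg.div_const 1728).congr_deriv ?_
  norm_num
  ring

lemma sigmaSeries_one_four {τ : ℂ} (hτ : 0 < τ.im) : sigmaSeries 1 4 τ =
    -(eisTwo τ ^ 5 - 10 * eisTwo τ ^ 3 * eisFour τ + 20 * eisTwo τ ^ 2 * eisSix τ
      - 15 * eisTwo τ * eisFour τ ^ 2 + 4 * eisFour τ * eisSix τ) / 20736 := by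
  refine sigmaSeries_succ_eq_of_hasDerivAt hτ (fun w hw ↦ sigmaSeries_one_three hw) ?_
  have h2 := hasDerivAt_eisTwo hτ
  have h4 := hasDerivAt_eisFour hτ
  have h6 := hasDerivAt_eisSix hτ
  refine (((((h2.fun_pow 4).fun_sub (((h2.fun_pow 2).const_mul 6).fun_mul h4)).fun_add
    ((h2.const_mul 8).fun_mul h6)).fun_sub
    ((h4.fun_pow 2).const_mul 3)).fun_neg.div_const 6912).congr_deriv ?_
  norm_num
  ring

lemma sigmaSeries_three_two {τ : ℂ} (hτ : 0 < τ.im) : sigmaSeries 3 2 τ =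
    (eisTwo τ ^ 2 * eisFour τ - 2 * eisTwo τ * eisSix τ + eisFour τ ^ 2) / 1728 := by
  refine sigmaSeries_succ_eq_of_hasDerivAt hτ (fun w hw ↦ sigmaSeries_three_one hw) ?_
  have h2 := hasDerivAt_eisTwo hτ
  have h4 := hasDerivAt_eisFour hτ
  have h6 := hasDerivAt_eisSix hτ
  refine (((h2.fun_mul h4).fun_sub h6).div_const 720).congr_deriv ?_
  ring

lemma eisTwo_add_one (τ : ℂ) : eisTwo (τ + 1) = eisTwo τ := by
  rw [eisTwo, eisTwo, sigmaSeries_add_one]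

lemma eisFour_add_one (τ : ℂ) : eisFour (τ + 1) = eisFour τ := by
  rw [eisFour, eisFour, sigmaSeries_add_one]

lemma eisSix_add_one (τ : ℂ) : eisSix (τ + 1) = eisSix τ := by
  rw [eisSix, eisSix, sigmaSeries_add_one]

lemma eisFour_neg_one_div {τ : ℂ} (hτ : 0 < τ.im) : eisFour (-1 / τ) = τ ^ 4 * eisFour τ := by
  have h : (ModularForm.E₄ : ℍ → ℂ) ∣[(4 : ℤ)] ModularGroup.S = ModularForm.E₄ :=
    ModularForm.E₄.slash_action_eq' _ ⟨_, rfl⟩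
  have h1 := congrFun h ⟨τ, hτ⟩
  have hτ0 : τ ≠ 0 := by rintro rfl; simp at hτ
  rw [ModularForm.SL_slash_apply, ModularGroup.denom_S, modular_S_smul, E4_eq_sigmaSeries,
    E4_eq_sigmaSeries] at h1
  simp only at h1
  rw [eisFour, eisFour, ← h1, neg_div, one_div, ← inv_neg]
  field_simp

lemma eisSix_neg_one_div {τ : ℂ} (hτ : 0 < τ.im) : eisSix (-1 / τ) = τ ^ 6 * eisSix τ := by
  have h : (ModularForm.E₆ : ℍ → ℂ) ∣[(6 : ℤ)] ModularGroup.S = ModularForm.E₆ :=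
    ModularForm.E₆.slash_action_eq' _ ⟨_, rfl⟩
  have h1 := congrFun h ⟨τ, hτ⟩
  have hτ0 : τ ≠ 0 := by rintro rfl; simp at hτ
  rw [ModularForm.SL_slash_apply, ModularGroup.denom_S, modular_S_smul, E6_eq_sigmaSeries,
    E6_eq_sigmaSeries] at h1
  simp only at h1
  rw [eisSix, eisSix, ← h1, neg_div, one_div, ← inv_neg]
  field_simp

lemma eisTwo_neg_one_div {τ : ℂ} (hτ : 0 < τ.im) :
    eisTwo (-1 / τ) = τ ^ 2 * eisTwo τ - 6 * I / π * τ := by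
  have h1 := E2_slash_eq ModularGroup.S ⟨τ, hτ⟩
  have hτ0 : τ ≠ 0 := by rintro rfl; simp at hτ
  rw [ModularForm.SL_slash_apply, ModularGroup.denom_S, modular_S_smul, E2_eq_sigmaSeries,
    E2_eq_sigmaSeries] at h1
  simp only [show (ModularGroup.S 1 0 : ℤ) = 1 by simp [ModularGroup.S]] at h1
  rw [eisTwo, eisTwo, neg_div, one_div, ← inv_neg]
  field_simp at h1 ⊢
  linear_combination h1

lemma sigma_two_pow_succ (k a : ℕ) : σ k (2 ^ (a + 1)) = 1 + 2 ^ k * σ k (2 ^ a) := by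
  rw [ArithmeticFunction.sigma_apply_prime_pow Nat.prime_two,
    ArithmeticFunction.sigma_apply_prime_pow Nat.prime_two, Finset.sum_range_succ', Finset.mul_sum,
    add_comm]
  congr 1
  · simp
  · refine Finset.sum_congr rfl fun i _ ↦ ?_
    ring

lemma sigma_two_mul_of_odd (k : ℕ) {n : ℕ} (hn : Odd n) : σ k (2 * n) = (1 + 2 ^ k) * σ k n := by
  rw [ArithmeticFunction.isMultiplicative_sigma.map_mul_of_coprime
    (Nat.coprime_two_left.mpr hn)]
  congr 1
  simpa using sigma_two_pow_succ k 0

lemma sigma_four_mul (k n : ℕ) :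
    σ k (2 * (2 * n)) + 2 ^ k * σ k n = (1 + 2 ^ k) * σ k (2 * n) := by
  rcases Nat.eq_zero_or_pos n with rfl | hn
  · simp
  obtain ⟨a, m, hm, rfl⟩ := Nat.exists_eq_two_pow_mul_odd hn.ne'
  have hmul (b : ℕ) : σ k (2 ^ b * m) = σ k (2 ^ b) * σ k m :=
    ArithmeticFunction.isMultiplicative_sigma.map_mul_of_coprime
      ((Nat.coprime_two_left.mpr hm).pow_left b)
  rw [show 2 * (2 ^ a * m) = 2 ^ (a + 1) * m by ring,
    show 2 * (2 ^ (a + 1) * m) = 2 ^ (a + 2) * m by ring, hmul, hmul, hmul,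
    sigma_two_pow_succ k (a + 1), sigma_two_pow_succ k a]
  ring

lemma tsum_add_tsum_neg_eq {a : ℕ → ℂ} {r : ℂ} (h : Summable fun n ↦ a n * r ^ n)
    (h' : Summable fun n ↦ a n * (-r) ^ n) :
    ∑' n, a n * r ^ n + ∑' n, a n * (-r) ^ n = 2 * ∑' n, a (2 * n) * (r ^ 2) ^ n := by
  rw [← h.tsum_add h', ← tsum_mul_left]
  have h2 : Function.Injective fun n : ℕ ↦ 2 * n := fun a b hab ↦ by simpa using hab
  rw [← h2.tsum_eq (f := fun n ↦ a n * r ^ n + a n * (-r) ^ n)]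
  · refine tsum_congr fun n ↦ ?_
    rw [pow_mul, pow_mul, neg_sq]
    ring
  · intro n hn
    rcases Nat.even_or_odd n with he | ho
    · exact ⟨n / 2, by simpa using Nat.two_mul_div_two_of_even he⟩
    · simp [ho.neg_pow] at hn

/-- The Hecke operator `T₂` on `sigmaSeries`. -/
lemma sigmaSeries_half_add (k j : ℕ) {τ : ℂ} (hτ : 0 < τ.im) :
    sigmaSeries k j (τ / 2) + sigmaSeries k j ((τ + 1) / 2) =
      2 ^ (j + 1) * (1 + 2 ^ k) * sigmaSeries k j τ -
        2 ^ (k + 2 * j + 1) * sigmaSeries k j (2 * τ) := by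
  set r := cexp (2 * π * I * (τ / 2)) with hr
  have hr1 : ‖r‖ < 1 := norm_cexp_two_pi_I_mul_lt_one (by simpa using hτ)
  have hneg : cexp (2 * π * I * ((τ + 1) / 2)) = -r := by
    rw [hr, show 2 * π * I * ((τ + 1) / 2) = 2 * π * I * (τ / 2) + π * I by ring,
      Complex.exp_add, Complex.exp_pi_mul_I]
    ring
  have hsq : cexp (2 * π * I * τ) = r ^ 2 := by
    rw [hr, ← Complex.exp_nat_mul]
    congr 1
    push_cast
    ring
  have hfour : cexp (2 * π * I * (2 * τ)) = (r ^ 2) ^ 2 := by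
    rw [← hsq, ← Complex.exp_nat_mul]
    congr 1
    push_cast
    ring
  have hq1 : ‖r ^ 2‖ < 1 := hsq ▸ norm_cexp_two_pi_I_mul_lt_one hτ
  have hs := summable_sigmaSeries_term k j hq1
  have hb : Function.support (fun n : ℕ ↦
      if Even n then (n : ℂ) ^ j * (σ k (n / 2) : ℂ) * (r ^ 2) ^ n else 0) ⊆
      Set.range fun n : ℕ ↦ 2 * n := by
    intro n hn
    have he : Even n := by
      by_contra hne
      simp [hne] at hn
    exact ⟨n / 2, by simpa using Nat.two_mul_div_two_of_even he⟩
  have h2 : Function.Injective fun n : ℕ ↦ 2 * n := fun a b hab ↦ by simpa using hab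
  have hs2 : Summable fun n : ℕ ↦
      if Even n then (n : ℂ) ^ j * (σ k (n / 2) : ℂ) * (r ^ 2) ^ n else 0 := by
    rw [← h2.summable_iff fun n hn ↦ Function.notMem_support.mp fun h ↦ hn (hb h)]
    refine ((summable_sigmaSeries_term k j (q := (r ^ 2) ^ 2) ?_).mul_left (2 ^ j : ℂ)).congr
      fun n ↦ ?_
    · rw [norm_pow]
      exact pow_lt_one₀ (norm_nonneg _) hq1 two_ne_zero
    · simp [mul_pow, pow_mul]
      ring
  have hb2 : ∑' n : ℕ, (if Even n then (n : ℂ) ^ j * (σ k (n / 2) : ℂ) * (r ^ 2) ^ n else 0) =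
      2 ^ j * sigmaSeries k j (2 * τ) := by
    rw [← h2.tsum_eq hb, sigmaSeries, hfour, ← tsum_mul_left]
    refine tsum_congr fun n ↦ ?_
    simp [mul_pow, pow_mul]
    ring
  have hterm (n : ℕ) : ((2 * n : ℕ) : ℂ) ^ j * (σ k (2 * n) : ℂ) * (r ^ 2) ^ n =
      2 ^ j * (1 + 2 ^ k) * ((n : ℂ) ^ j * (σ k n : ℂ) * (r ^ 2) ^ n) - 2 ^ j * 2 ^ k *
        (if Even n then (n : ℂ) ^ j * (σ k (n / 2) : ℂ) * (r ^ 2) ^ n else 0) := by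
    rcases Nat.even_or_odd' n with ⟨m, rfl | rfl⟩
    · have := congrArg (fun x : ℕ ↦ (x : ℂ)) (sigma_four_mul k m)
      push_cast at this
      simp only [even_two_mul, if_true, Nat.mul_div_cancel_left _ two_pos]
      push_cast
      rw [mul_pow]
      linear_combination 2 ^ j * (2 * m : ℂ) ^ j * (r ^ 2) ^ (2 * m) * this
    · rw [sigma_two_mul_of_odd k (odd_two_mul_add_one m)]
      simp [mul_pow]
      ring
  have key := tsum_add_tsum_neg_eq (summable_sigmaSeries_term k j hr1)
    (summable_sigmaSeries_term k j (by rwa [norm_neg]))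
  rw [sigmaSeries, sigmaSeries, hneg, key, tsum_congr hterm,
    (hs.mul_left _).tsum_sub (hs2.mul_left _), tsum_mul_left, tsum_mul_left, hb2, ← hsq]
  change 2 * (2 ^ j * (1 + 2 ^ k) * sigmaSeries k j τ - _) = _
  ring

lemma neg_one_div_I : -1 / I = I := by
  rw [div_eq_iff I_ne_zero, I_mul_I]

lemma eisSix_I : eisSix I = 0 := by
  have h := eisSix_neg_one_div (τ := I) (by simp)
  rw [neg_one_div_I, show I ^ 6 = (I ^ 2) ^ 3 by ring, I_sq] at h
  linear_combination h / 2

lemma eisTwo_I : eisTwo I = 3 / π := by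
  have h := eisTwo_neg_one_div (τ := I) (by simp)
  rw [neg_one_div_I, I_sq] at h
  linear_combination h / 2 - 3 / π * I_sq

lemma eisTwo_I_div_two : eisTwo (I / 2) = -4 * eisTwo (2 * I) + 12 / π := by
  have h := eisTwo_neg_one_div (τ := 2 * I) (by simp)
  rw [show -1 / (2 * I) = I / 2 by field_simp; simp] at h
  linear_combination h + (4 * eisTwo (2 * I) - 12 / π) * I_sq

lemma eisFour_I_div_two : eisFour (I / 2) = 16 * eisFour (2 * I) := by
  have h := eisFour_neg_one_div (τ := 2 * I) (by simp)
  rw [show -1 / (2 * I) = I / 2 by field_simp; simp, show (2 * I) ^ 4 = 16 * (I ^ 2) ^ 2 by ring,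
    I_sq] at h
  linear_combination h

lemma eisSix_I_div_two : eisSix (I / 2) = -64 * eisSix (2 * I) := by
  have h := eisSix_neg_one_div (τ := 2 * I) (by simp)
  rw [show -1 / (2 * I) = I / 2 by field_simp; simp, show (2 * I) ^ 6 = 64 * (I ^ 2) ^ 3 by ring,
    I_sq] at h
  linear_combination h

lemma neg_one_div_I_sub_one : -1 / (I - 1) = (I + 1) / 2 := by
  have h : I - 1 ≠ 0 := fun h ↦ by simpa using congrArg Complex.im h
  rw [div_eq_div_iff h two_ne_zero]
  linear_combination -I_sq

lemma eisTwo_I_add_one_div_two : eisTwo ((I + 1) / 2) = 6 / π := by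
  have h := eisTwo_neg_one_div (τ := I - 1) (by simp)
  have h1 := eisTwo_add_one (I - 1)
  rw [sub_add_cancel] at h1
  rw [neg_one_div_I_sub_one, ← h1, eisTwo_I] at h
  linear_combination h - 3 / π * I_sq

lemma eisFour_I_add_one_div_two : eisFour ((I + 1) / 2) = -4 * eisFour I := by
  have h := eisFour_neg_one_div (τ := I - 1) (by simp)
  have h1 := eisFour_add_one (I - 1)
  rw [sub_add_cancel] at h1
  rw [neg_one_div_I_sub_one, ← h1] at h
  linear_combination h + (I ^ 2 - 4 * I + 5) * eisFour I * I_sq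

lemma eisSix_I_add_one_div_two : eisSix ((I + 1) / 2) = 0 := by
  have h := eisSix_neg_one_div (τ := I - 1) (by simp)
  have h1 := eisSix_add_one (I - 1)
  rw [sub_add_cancel] at h1
  rw [neg_one_div_I_sub_one, ← h1, eisSix_I, mul_zero] at h
  exact h

lemma eisFour_two_mul_I : eisFour (2 * I) = 11 / 16 * eisFour I := by
  have h := sigmaSeries_half_add 3 0 (τ := I) (by simp)
  have h1 := eisFour_I_div_two
  have h2 := eisFour_I_add_one_div_two
  rw [eisFour] at h1 h2
  have h3 : eisFour I = 1 + 240 * sigmaSeries 3 0 I := rfl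
  have h4 : eisFour (2 * I) = 1 + 240 * sigmaSeries 3 0 (2 * I) := rfl
  linear_combination (-(h1 + h2) + 240 * h - 18 * h3 + 16 * h4) / 32

lemma sq_two_mul_eisTwo_sub : (2 * eisTwo (2 * I) - 3 / π) ^ 2 = 3 / 4 * eisFour I := by
  have h := sigmaSeries_half_add 1 1 (τ := I) (by simp)
  rw [sigmaSeries_one_one (by simp), sigmaSeries_one_one (by simp), sigmaSeries_one_one (by simp),
    sigmaSeries_one_one (by simp), eisTwo_I, eisTwo_I_div_two, eisTwo_I_add_one_div_two,
    eisFour_I_div_two, eisFour_I_add_one_div_two, eisFour_two_mul_I] at h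
  linear_combination (-36) * h

lemma eisSix_mul_two_mul_eisTwo_sub :
    eisSix (2 * I) * (2 * eisTwo (2 * I) - 3 / π) = 63 / 128 * eisFour I ^ 2 := by
  have h := sigmaSeries_half_add 5 1 (τ := I) (by simp)
  rw [sigmaSeries_five_one (by simp), sigmaSeries_five_one (by simp),
    sigmaSeries_five_one (by simp), sigmaSeries_five_one (by simp), eisTwo_I, eisTwo_I_div_two,
    eisTwo_I_add_one_div_two, eisFour_I_div_two, eisFour_I_add_one_div_two, eisFour_two_mul_I,
    eisSix_I, eisSix_I_div_two, eisSix_I_add_one_div_two] at h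
  linear_combination (-63 / 16) * h

/-- The combination `σ₁, σ₃, σ₅` of `q`-series attached to the fifth power of the hyperbolic
secant. -/
noncomputable def sechSeries (τ : ℂ) : ℂ :=
  sigmaSeries 1 4 τ - 10 * sigmaSeries 3 2 τ + 9 * sigmaSeries 5 0 τ

lemma sechSeries_neg_one_div {w : ℂ} (hw : 0 < w.im) (h2 : eisTwo w = eisTwo (2 * I))
    (h4 : eisFour w = eisFour (2 * I)) (h6 : eisSix w = eisSix (2 * I)) {P Q R : ℂ}
    (hP : P = w ^ 2 * eisTwo (2 * I) - 6 * I / π * w) (hQ : Q = w ^ 4 * eisFour (2 * I))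
    (hR : R = w ^ 6 * eisSix (2 * I)) :
    sechSeries (-1 / w) = -(P ^ 5 - 10 * P ^ 3 * Q + 20 * P ^ 2 * R - 15 * P * Q ^ 2 + 4 * Q * R) /
      20736 - 5 / 864 * (P ^ 2 * Q - 2 * P * R + Q ^ 2) + (1 - R) / 56 := by
  have him : 0 < (-1 / w).im := by
    have := UpperHalfPlane.im_pnat_div_pos 1 ⟨w, hw⟩
    simpa using this
  have e6 : sigmaSeries 5 0 (-1 / w) = (1 - eisSix (-1 / w)) / 504 := by
    rw [eisSix]; ring
  rw [sechSeries, sigmaSeries_one_four him, sigmaSeries_three_two him, e6, eisTwo_neg_one_div hw,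
    eisFour_neg_one_div hw, eisSix_neg_one_div hw, h2, h4, h6, ← hP, ← hQ, ← hR]
  ring

lemma sechSeries_sub {A : ℂ} (hA : A = 2 * eisTwo (2 * I) - 3 / π) (hA0 : A ≠ 0) :
    -I / 24 * (sechSeries ((I + 1) / 4) - sechSeries ((I - 1) / 4)) =
      5 / 3 * A * (1 / π) ^ 4 - 40 / 27 * A ^ 3 * (1 / π) ^ 2 + 200 / 81 * A ^ 3 * (1 / π)
        - 2 / 3 * A ^ 3 + 16 / 729 * A ^ 5 := by
  have hg : eisFour I = 4 / 3 * A ^ 2 := by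
    have := sq_two_mul_eisTwo_sub
    rw [← hA] at this
    linear_combination -4 / 3 * this
  have hQ : eisFour (2 * I) = 11 / 12 * A ^ 2 := by
    rw [eisFour_two_mul_I, hg]; ring
  have hR : eisSix (2 * I) = 7 / 8 * A ^ 3 := by
    have := eisSix_mul_two_mul_eisTwo_sub
    rw [← hA, hg] at this
    refine mul_right_cancel₀ hA0 ?_
    linear_combination this
  have hP : eisTwo (2 * I) = (A + 3 / π) / 2 := by
    rw [hA]; ring
  have hne (x : ℂ) (hx : x.im ≠ 0) : x ≠ 0 := fun h ↦ hx (by simp [h])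
  have hp : (I + 1) / 4 = -1 / (2 * I - 1 - 1) := by
    rw [div_eq_div_iff (by norm_num) (hne _ (by simp))]
    linear_combination 2 * I_sq
  have hm : (I - 1) / 4 = -1 / (2 * I + 1 + 1) := by
    rw [div_eq_div_iff (by norm_num) (hne _ (by simp))]
    linear_combination 2 * I_sq
  have hp2 : (2 * I - 1 - 1) ^ 2 = -8 * I := by linear_combination 4 * I_sq
  have hm2 : (2 * I + 1 + 1) ^ 2 = 8 * I := by linear_combination 4 * I_sq
  have hp4 : (2 * I - 1 - 1) ^ 4 = -64 := by
    linear_combination ((2 * I - 1 - 1) ^ 2 - 8 * I) * hp2 + 64 * I_sq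
  have hm4 : (2 * I + 1 + 1) ^ 4 = -64 := by
    linear_combination ((2 * I + 1 + 1) ^ 2 + 8 * I) * hm2 + 64 * I_sq
  have hp6 : (2 * I - 1 - 1) ^ 6 = 512 * I := by
    linear_combination (2 * I - 1 - 1) ^ 4 * hp2 - 8 * I * hp4
  have hm6 : (2 * I + 1 + 1) ^ 6 = -512 * I := by
    linear_combination (2 * I + 1 + 1) ^ 4 * hm2 + 8 * I * hm4
  have hsub (f : ℂ → ℂ) (hf : ∀ τ, f (τ + 1) = f τ) : f (2 * I - 1 - 1) = f (2 * I) := by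
    rw [← hf (2 * I - 1 - 1), ← hf (2 * I - 1 - 1 + 1)]
    ring_nf
  have hadd (f : ℂ → ℂ) (hf : ∀ τ, f (τ + 1) = f τ) : f (2 * I + 1 + 1) = f (2 * I) := by
    rw [hf, hf]
  rw [hp, hm, sechSeries_neg_one_div (P := -4 * I * A + 12 / π) (Q := -176 / 3 * A ^ 2)
      (R := 448 * I * A ^ 3) (by simp) (hsub _ eisTwo_add_one) (hsub _ eisFour_add_one)
      (hsub _ eisSix_add_one) ?_ ?_ ?_,
    sechSeries_neg_one_div (P := 4 * I * A + 12 / π) (Q := -176 / 3 * A ^ 2)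
      (R := -448 * I * A ^ 3) (by simp) (hadd _ eisTwo_add_one) (hadd _ eisFour_add_one)
      (hadd _ eisSix_add_one) ?_ ?_ ?_]
  · have h4 : I ^ 4 = 1 := by rw [show I ^ 4 = (I ^ 2) ^ 2 by ring, I_sq]; norm_num
    have h6 : I ^ 6 = -1 := by rw [show I ^ 6 = (I ^ 2) ^ 3 by ring, I_sq]; norm_num
    ring_nf
    simp only [I_sq, h4, h6]
    ring
  · rw [hm2, hP]
    linear_combination (12 / π) * I_sq
  · rw [hm4, hQ]; ring
  · rw [hm6, hR]; ring
  · rw [hp2, hP]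
    linear_combination (12 / π) * I_sq
  · rw [hp4, hQ]; ring
  · rw [hp6, hR]; ring

lemma two_mul_sigma_le_sigma_two_mul (k n : ℕ) (hk : k ≠ 0) : 2 * σ k n ≤ σ k (2 * n) := by
  rcases Nat.eq_zero_or_pos n with rfl | hn
  · simp
  obtain ⟨a, m, hm, rfl⟩ := Nat.exists_eq_two_pow_mul_odd hn.ne'
  have hmul (b : ℕ) : σ k (2 ^ b * m) = σ k (2 ^ b) * σ k m :=
    ArithmeticFunction.isMultiplicative_sigma.map_mul_of_coprime
      ((Nat.coprime_two_left.mpr hm).pow_left b)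
  rw [show 2 * (2 ^ a * m) = 2 ^ (a + 1) * m by ring, hmul, hmul, ← mul_assoc,
    sigma_two_pow_succ k a]
  gcongr
  have := Nat.pow_le_pow_right two_pos (Nat.one_le_iff_ne_zero.mpr hk)
  nlinarith

lemma exists_pos_two_mul_eisTwo_sub : ∃ a : ℝ, 0 < a ∧ 2 * eisTwo (2 * I) - 3 / π = a := by
  set r : ℝ := rexp (-(2 * π))
  have hr0 : 0 < r := Real.exp_pos _
  have hr1 : r < 1 := by
    rw [Real.exp_lt_one_iff]; linarith [Real.pi_pos]
  have hq1 : cexp (2 * π * I * I) = (r : ℂ) := by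
    rw [mul_assoc, I_mul_I, show (r : ℂ) = cexp (-(2 * π)) by simp [r]]
    ring_nf
  have hq2 : cexp (2 * π * I * (2 * I)) = ((r ^ 2 : ℝ) : ℂ) := by
    rw [show 2 * π * I * (2 * I) = 2 * π * I * I + 2 * π * I * I by ring, Complex.exp_add, hq1]
    push_cast
    ring
  have hs (x : ℝ) (hx0 : 0 ≤ x) (hx1 : x < 1) : Summable fun n : ℕ ↦ (σ 1 n : ℝ) * x ^ n := by
    have := summable_sigmaSeries_term 1 0 (q := (x : ℂ)) (by rwa [norm_real, norm_of_nonneg hx0])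
    rw [← Complex.summable_ofReal]
    simpa using this
  have h1 : sigmaSeries 1 0 I = ((∑' n : ℕ, (σ 1 n : ℝ) * r ^ n : ℝ) : ℂ) := by
    rw [sigmaSeries, hq1]
    push_cast
    simp
  have h2 : sigmaSeries 1 0 (2 * I) = ((∑' n : ℕ, (σ 1 n : ℝ) * (r ^ 2) ^ n : ℝ) : ℂ) := by
    rw [sigmaSeries, hq2]
    push_cast
    simp
  have hle : 2 * ∑' n : ℕ, (σ 1 n : ℝ) * (r ^ 2) ^ n ≤ ∑' n : ℕ, (σ 1 n : ℝ) * r ^ n := by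
    rw [← tsum_mul_left]
    refine Summable.tsum_le_tsum_of_inj (fun n ↦ 2 * n) (fun a b hab ↦ by simpa using hab)
      (fun n _ ↦ by positivity) (fun n ↦ ?_)
      ((hs _ (by positivity) (pow_lt_one₀ hr0.le hr1 two_ne_zero)).mul_left 2) (hs r hr0.le hr1)
    rw [← mul_assoc, pow_mul]
    gcongr
    exact_mod_cast two_mul_sigma_le_sigma_two_mul 1 n one_ne_zero
  refine ⟨1 + 24 * (∑' n : ℕ, (σ 1 n : ℝ) * r ^ n - 2 * ∑' n : ℕ, (σ 1 n : ℝ) * (r ^ 2) ^ n),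
    by linarith, ?_⟩
  rw [← eisTwo_I, eisTwo, eisTwo, h1, h2]
  push_cast
  ring

lemma integral_beta_one_quarter_one_half :
    ∫ x in Ioo (0 : ℝ) 1, x ^ (-(3 / 4) : ℝ) * (1 - x) ^ (-(1 / 2) : ℝ) =
      Real.Gamma (1 / 4) ^ 2 / √(2 * π) := by
  have h := ProbabilityTheory.beta_eq_betaIntegralReal (1 / 4) (1 / 2) (by norm_num) (by norm_num)
  have hint : ((∫ x in Ioo (0 : ℝ) 1, x ^ (-(3 / 4) : ℝ) * (1 - x) ^ (-(1 / 2) : ℝ) : ℝ) : ℂ) =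
      Complex.betaIntegral (1 / 4 : ℝ) (1 / 2 : ℝ) := by
    rw [Complex.betaIntegral, intervalIntegral.integral_of_le zero_le_one,
      ← integral_Ioc_eq_integral_Ioo, ← integral_complex_ofReal, integral_Ioc_eq_integral_Ioo,
      integral_Ioc_eq_integral_Ioo]
    refine setIntegral_congr_fun measurableSet_Ioo fun x hx ↦ ?_
    push_cast
    rw [ofReal_cpow hx.1.le, ofReal_cpow (sub_nonneg.mpr hx.2.le)]
    push_cast
    norm_num
  have hrefl := Real.Gamma_mul_Gamma_one_sub (1 / 4)
  have h0 : 0 < Real.Gamma (1 / 4) := Real.Gamma_pos_of_pos (by norm_num)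
  rw [← hint, ofReal_re, ProbabilityTheory.beta, Real.Gamma_one_half_eq] at h
  rw [← h]
  rw [show π * (1 / 4) = π / 4 by ring, Real.sin_pi_div_four, show (1 : ℝ) - 1 / 4 = 3 / 4 by ring]
    at hrefl
  have h34 : 0 < Real.Gamma (3 / 4) := Real.Gamma_pos_of_pos (by norm_num)
  have h2 : √2 ^ 2 = 2 := Real.sq_sqrt two_pos.le
  have hp : √π ^ 2 = π := Real.sq_sqrt Real.pi_pos.le
  rw [show (1 : ℝ) / 4 + 1 / 2 = 3 / 4 by ring, Real.sqrt_mul two_pos.le]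
  field_simp at hrefl ⊢
  linear_combination √2 * hp - √2 / 2 * hrefl +
    Real.Gamma (1 / 4) * Real.Gamma (3 / 4) / 2 * h2

lemma sqrt_eq_of_weierstrass_ode {f d : ℝ → ℝ} {e : ℝ} (he : 0 < e)
    (hf : ∀ x ∈ Ioo (0 : ℝ) 1, HasDerivAt f (d x) x)
    (hd : ∀ x ∈ Ioo (0 : ℝ) 1, HasDerivAt d (6 * f x ^ 2 - 2 * e ^ 2) x)
    (hode : ∀ x ∈ Ioo (0 : ℝ) 1, d x ^ 2 = 4 * f x * (f x ^ 2 - e ^ 2))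
    (h0 : Tendsto f (𝓝[>] 0) atTop) (hhalf : d (1 / 2) = 0) :
    2 * √e = Real.Gamma (1 / 4) ^ 2 / √(2 * π) := by
  have hfc : ContinuousOn f (Ioo 0 1) := fun x hx ↦ (hf x hx).continuousAt.continuousWithinAt
  have hdc : ContinuousOn d (Ioo 0 1) := fun x hx ↦ (hd x hx).continuousAt.continuousWithinAt
  have hge : ∀ x ∈ Ioo (0 : ℝ) 1, e ≤ f x := by
    intro x hx
    by_contra! hlt
    obtain ⟨y, hyx, hy⟩ := ((h0.eventually_gt_atTop e).and (Ioo_mem_nhdsGT hx.1)).exists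
    obtain ⟨c, hc1, hc2⟩ := exists_between (max_lt hlt he)
    obtain ⟨hc3, hc4⟩ := max_lt_iff.mp hc1
    obtain ⟨z, hz, rfl⟩ := intermediate_value_Icc' hy.2.le
      (hfc.mono fun t ht ↦ ⟨hy.1.trans_le ht.1, ht.2.trans_lt hx.2⟩) ⟨hc3.le, (hc2.trans hyx).le⟩
    have h1 := hode z ⟨hy.1.trans_le hz.1, hz.2.trans_lt hx.2⟩
    have h2 : f z ^ 2 - e ^ 2 < 0 := by nlinarith
    nlinarith [sq_nonneg (d z), mul_pos hc4 (neg_pos.mpr h2)]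
  have hdmono : StrictMonoOn d (Ioo 0 1) := by
    refine strictMonoOn_of_deriv_pos (convex_Ioo 0 1) hdc fun x hx ↦ ?_
    rw [interior_Ioo] at hx
    rw [(hd x hx).deriv]
    nlinarith [hge x hx]
  have hsub : ∀ x ∈ Ioo (0 : ℝ) (1 / 2), x ∈ Ioo (0 : ℝ) 1 := fun x hx ↦ ⟨hx.1, by linarith [hx.2]⟩
  have hhalfmem : (1 / 2 : ℝ) ∈ Ioo (0 : ℝ) 1 := by norm_num
  have hdneg : ∀ x ∈ Ioo (0 : ℝ) (1 / 2), d x < 0 := fun x hx ↦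
    hhalf ▸ hdmono (hsub x hx) hhalfmem hx.2
  have hgt : ∀ x ∈ Ioo (0 : ℝ) (1 / 2), e < f x := fun x hx ↦
    (hge x (hsub x hx)).lt_of_ne fun h ↦ by
      have := hode x (hsub x hx)
      rw [← h] at this
      nlinarith [hdneg x hx]
  have hfhalf : f (1 / 2) = e := by
    have h1 := hode _ hhalfmem
    have h2 := hge _ hhalfmem
    rw [hhalf] at h1
    by_contra hne
    have hlt := h2.lt_of_ne' hne
    have : 0 < 4 * f (1 / 2) * (f (1 / 2) ^ 2 - e ^ 2) :=
      mul_pos (by linarith) (by nlinarith)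
    linarith
  set h : ℝ → ℝ := fun x ↦ e ^ 2 / f x ^ 2 with hh
  have hder : ∀ x ∈ Ioo (0 : ℝ) 1, HasDerivAt h (-2 * e ^ 2 * d x / f x ^ 3) x := by
    intro x hx
    have hfx : f x ≠ 0 := (he.trans_le (hge x hx)).ne'
    refine (((hf x hx).fun_pow 2).fun_inv (pow_ne_zero 2 hfx) |>.const_mul (e ^ 2)).congr_deriv ?_
    field_simp
    push_cast
    ring
  have hmono : StrictMonoOn h (Ioc 0 (1 / 2)) := by
    refine strictMonoOn_of_deriv_pos (convex_Ioc 0 (1 / 2)) (fun x hx ↦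
      (hder x ⟨hx.1, by linarith [hx.2]⟩).continuousAt.continuousWithinAt) fun x hx ↦ ?_
    rw [interior_Ioc] at hx
    rw [(hder x (hsub x hx)).deriv]
    have := he.trans (hgt x hx)
    have := hdneg x hx
    apply div_pos _ (by positivity)
    nlinarith [pow_pos he 2]
  have himg : h '' Ioo 0 (1 / 2) = Ioo 0 1 := by
    have hlim : Tendsto h (𝓝[>] 0) (𝓝 0) :=
      ((tendsto_pow_atTop two_ne_zero).comp h0).const_div_atTop _
    have hh1 : h (1 / 2) = 1 := by simp only [hh, hfhalf]; field_simp
    apply Subset.antisymm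
    · rintro _ ⟨x, hx, rfl⟩
      have := he.trans (hgt x hx)
      refine ⟨by simp only [hh]; positivity, ?_⟩
      rw [← hh1]
      exact hmono ⟨hx.1, hx.2.le⟩ (by norm_num) hx.2
    · rintro u ⟨hu0, hu1⟩
      obtain ⟨y, hyu, hy⟩ := ((hlim.eventually_lt_const hu0).and
        (Ioo_mem_nhdsGT (show (0 : ℝ) < 1 / 2 by norm_num))).exists
      obtain ⟨z, hz, rfl⟩ := intermediate_value_Icc hy.2.le
        (fun x hx ↦
          (hder x ⟨hy.1.trans_le hx.1, by linarith [hx.2]⟩).continuousAt.continuousWithinAt)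
        ⟨hyu.le, hh1.symm ▸ hu1.le⟩
      refine ⟨z, ⟨hy.1.trans_le hz.1, hz.2.lt_of_ne ?_⟩, rfl⟩
      rintro rfl
      exact hu1.ne hh1
  rw [← integral_beta_one_quarter_one_half, ← himg,
    integral_image_eq_integral_abs_deriv_smul measurableSet_Ioo
      (fun x hx ↦ (hder x (hsub x hx)).hasDerivWithinAt)
      (hmono.injOn.mono Ioo_subset_Ioc_self)]
  have hconst : ∀ x ∈ Ioo (0 : ℝ) (1 / 2), |-2 * e ^ 2 * d x / f x ^ 3| •
      (h x ^ (-(3 / 4) : ℝ) * (1 - h x) ^ (-(1 / 2) : ℝ)) = 4 * √e := by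
    intro x hx
    have hfx := hgt x hx
    have hfp := he.trans hfx
    have hdx := hdneg x hx
    have hp : 0 < h x := by simp only [hh]; positivity
    have hp1 : 1 - h x = (f x ^ 2 - e ^ 2) / f x ^ 2 := by simp only [hh]; field_simp
    have hfe : 0 < f x ^ 2 - e ^ 2 := by nlinarith
    have hp1' : 0 < 1 - h x := by rw [hp1]; positivity
    refine (pow_left_inj₀ (by positivity) (by positivity) (four_ne_zero)).mp ?_
    have e1 : (h x ^ (-(3 / 4) : ℝ)) ^ 4 = (h x ^ 3)⁻¹ := by
      rw [← rpow_natCast, ← rpow_mul hp.le, ← rpow_natCast, ← Real.rpow_neg hp.le]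
      norm_num
    have e2 : ((1 - h x) ^ (-(1 / 2) : ℝ)) ^ 4 = ((1 - h x) ^ 2)⁻¹ := by
      rw [← rpow_natCast, ← rpow_mul hp1'.le, ← rpow_natCast, ← Real.rpow_neg hp1'.le]
      norm_num
    have e3 : √e ^ 4 = e ^ 2 := by
      rw [show 4 = 2 * 2 by rfl, pow_mul, Real.sq_sqrt he.le]
    have e4 : d x ^ 4 = (4 * f x * (f x ^ 2 - e ^ 2)) ^ 2 := by
      rw [← hode x (hsub x hx)]; ring
    rw [smul_eq_mul, mul_pow, mul_pow, mul_pow, e1, e2, e3, Even.pow_abs (by decide), div_pow,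
      mul_pow, e4, hp1]
    simp only [hh]
    field_simp
    ring
  rw [setIntegral_congr_fun measurableSet_Ioo hconst]
  simp
  ring

lemma PeriodPair.exists_derivWeierstrassP_ne_zero (L : PeriodPair) :
    ∃ z ∉ L.lattice, L.derivWeierstrassP z ≠ 0 := by
  by_contra! h
  have h0 (z : ℂ) : L.derivWeierstrassP z = 0 := by
    by_cases hz : z ∈ L.lattice
    · exact L.derivWeierstrassP_coe ⟨z, hz⟩
    · exact h z hz
  have hc := (L.analyticAt_derivWeierstrassPExcept 0).continuousAt.tendsto
  have h1 := ((continuous_pow 3).tendsto (0 : ℂ)).mul hc |>.mono_left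
    (nhdsWithin_le_nhds (s := {0}ᶜ))
  have h2 : Tendsto (fun z : ℂ ↦ z ^ 3 * L.derivWeierstrassPExcept 0 z) (𝓝[≠] 0) (𝓝 2) := by
    refine tendsto_const_nhds.congr' ?_
    filter_upwards [self_mem_nhdsWithin] with z hz
    have hz : z ≠ 0 := hz
    have := L.derivWeierstrassPExcept_def 0 z
    rw [h0, ZeroMemClass.coe_zero] at this
    rw [this]
    field_simp
    ring
  simpa using tendsto_nhds_unique h1 h2

lemma PeriodPair.hasDerivAt_weierstrassP (L : PeriodPair) {z : ℂ} (hz : z ∉ L.lattice) :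
    HasDerivAt L.weierstrassP (L.derivWeierstrassP z) z := by
  rw [← L.deriv_weierstrassP]
  exact (L.analyticOnNhd_weierstrassP z hz).differentiableAt.hasDerivAt

lemma PeriodPair.hasDerivAt_derivWeierstrassP (L : PeriodPair) {z : ℂ} (hz : z ∉ L.lattice) :
    HasDerivAt L.derivWeierstrassP (6 * L.weierstrassP z ^ 2 - L.g₂ / 2) z := by
  have hP := L.analyticOnNhd_weierstrassP
  have hP' := L.analyticOnNhd_derivWeierstrassP
  have hopen : IsOpen ((L.lattice : Set ℂ)ᶜ) := L.isClosed_lattice.isOpen_compl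
  have hd : ∀ w ∉ L.lattice, HasDerivAt L.derivWeierstrassP (deriv L.derivWeierstrassP w) w :=
    fun w hw ↦ (hP' w hw).differentiableAt.hasDerivAt
  have hmul : ∀ w ∈ (L.lattice : Set ℂ)ᶜ, L.derivWeierstrassP w •
      (2 * deriv L.derivWeierstrassP w - (12 * L.weierstrassP w ^ 2 - L.g₂)) = 0 := by
    intro w hw
    have h1 := (hd w hw).fun_pow 2
    have h2 := (((L.hasDerivAt_weierstrassP hw).fun_pow 3).const_mul 4).sub
      ((L.hasDerivAt_weierstrassP hw).const_mul L.g₂) |>.sub_const L.g₃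
    have h3 := h1.unique (h2.congr_of_eventuallyEq (by
      filter_upwards [hopen.mem_nhds hw] with u hu
      simpa using L.derivWeierstrassP_sq u hu))
    push_cast at h3
    rw [smul_eq_mul]
    linear_combination h3
  have hcount : (L.lattice : Set ℂ).Countable := by
    have : Countable L.lattice := L.latticeEquivProd.toEquiv.countable_iff.mpr inferInstance
    exact Set.countable_coe_iff.mp this
  have hconn : IsPreconnected ((L.lattice : Set ℂ)ᶜ) :=
    (hcount.isPathConnected_compl_of_one_lt_rank (by simp)).isConnected.isPreconnected
  have han : AnalyticOnNhd ℂ (fun w ↦ 2 * deriv L.derivWeierstrassP w -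
      (12 * L.weierstrassP w ^ 2 - L.g₂)) (L.lattice : Set ℂ)ᶜ := by
    intro w hw
    have h1 := (hP' w hw).deriv
    have h2 := hP w hw
    fun_prop
  rcases AnalyticOnNhd.eq_zero_or_eq_zero_of_smul_eq_zero hP' han hmul hconn with h | h
  · obtain ⟨w, hw, hw0⟩ := L.exists_derivWeierstrassP_ne_zero
    exact absurd (h w hw) hw0
  · refine (hd z hz).congr_deriv ?_
    linear_combination h z hz / 2

/-- The period pair `(i, 1)` of the lattice of Gaussian integers. -/
noncomputable def gaussianPeriodPair : PeriodPair where
  ω₁ := I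
  ω₂ := 1
  indep := by
    rw [LinearIndependent.pair_iff]
    intro s t h
    have h1 := congrArg Complex.re h
    have h2 := congrArg Complex.im h
    simp at h1 h2
    exact ⟨h2, h1⟩

lemma gaussian_lattice_symm_apply (x : ℤ × ℤ) :
    ((gaussianPeriodPair.latticeEquivProd.symm x : gaussianPeriodPair.lattice) : ℂ) =
      x.1 * I + x.2 := by
  rw [PeriodPair.latticeEquiv_symm_apply]
  simp [gaussianPeriodPair]

lemma tsum_gaussian_lattice (f : ℂ → ℂ) :
    ∑' l : gaussianPeriodPair.lattice, f l = ∑' x : ℤ × ℤ, f (x.1 * I + x.2) := by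
  rw [← gaussianPeriodPair.latticeEquivProd.symm.toEquiv.tsum_eq]
  exact tsum_congr fun x ↦ congrArg f (gaussian_lattice_symm_apply x)

lemma gaussian_G_six : gaussianPeriodPair.G 6 = 0 := by
  rw [← CharZero.eq_neg_self_iff, PeriodPair.G, tsum_gaussian_lattice fun l ↦ (l ^ 6)⁻¹,
    ← tsum_neg, ← ((Equiv.prodComm ℤ ℤ).trans ((Equiv.neg ℤ).prodCongr (Equiv.refl ℤ))).tsum_eq]
  refine tsum_congr fun x ↦ ?_
  rw [neg_inv]
  congr 1
  simp
  rw [show -((x.2 : ℂ) * I) + x.1 = -I * (x.1 * I + x.2) by linear_combination x.1 * I_sq, mul_pow,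
    show (-I) ^ 6 = -1 by linear_combination (I ^ 4 - I ^ 2 + 1) * I_sq]
  ring

lemma gaussian_G_four : gaussianPeriodPair.G 4 = π ^ 4 / 45 * eisFour I := by
  have h := _root_.tsum_eisSummand_eq_tsum_sigma_mul_cexp_pow (k := 4) (by norm_num)
    ⟨2, rfl⟩ UpperHalfPlane.I
  rw [show (4 - 1 : ℕ) = 3 from rfl, tsum_pnat_sigma_eq_sigmaSeries] at h
  rw [PeriodPair.G, tsum_gaussian_lattice fun l ↦ (l ^ 4)⁻¹,
    ← (finTwoArrowEquiv ℤ).tsum_eq]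
  trans ∑' v, EisensteinSeries.eisSummand (4 : ℕ) v UpperHalfPlane.I
  · refine tsum_congr fun v ↦ ?_
    simp [EisensteinSeries.eisSummand, zpow_neg]
  · rw [h, eisFour]
    push_cast
    rw [riemannZeta_four, mul_pow, I_pow_four]
    simp [Nat.factorial]
    ring

lemma ofReal_notMem_gaussian_lattice {x : ℝ} (hx : x ∈ Ioo (0 : ℝ) 1) :
    (x : ℂ) ∉ gaussianPeriodPair.lattice := by
  rw [PeriodPair.mem_lattice]
  rintro ⟨m, n, h⟩
  have h1 := congrArg Complex.re h
  simp [gaussianPeriodPair] at h1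
  have h2 : 0 < n := by exact_mod_cast h1 ▸ hx.1
  have h3 : n < 1 := by exact_mod_cast h1 ▸ hx.2
  omega

lemma gaussian_weierstrassP_ofReal (x : ℝ) :
    gaussianPeriodPair.weierstrassP x = (((gaussianPeriodPair.weierstrassP x).re : ℝ) : ℂ) := by
  symm
  rw [← Complex.conj_eq_iff_re, PeriodPair.weierstrassP,
    tsum_gaussian_lattice fun l ↦ 1 / (x - l) ^ 2 - 1 / l ^ 2, Complex.conj_tsum,
    ← ((Equiv.neg ℤ).prodCongr (Equiv.refl ℤ)).tsum_eq]
  exact tsum_congr fun y ↦ by simp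

lemma sqrt_eq_of_g_two {e : ℝ} (he : 0 < e) (hg : gaussianPeriodPair.g₂ = 4 * e ^ 2) :
    2 * √e = Real.Gamma (1 / 4) ^ 2 / √(2 * π) := by
  have hP {x : ℝ} (hx : x ∈ Ioo (0 : ℝ) 1) :=
    (gaussianPeriodPair.hasDerivAt_weierstrassP (ofReal_notMem_gaussian_lattice hx)).real_of_complex
  have hP' {x : ℝ} (hx : x ∈ Ioo (0 : ℝ) 1) :=
    (gaussianPeriodPair.hasDerivAt_derivWeierstrassP
      (ofReal_notMem_gaussian_lattice hx)).real_of_complex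
  have hre (x : ℝ) (hx : x ∈ Ioo (0 : ℝ) 1) :
      gaussianPeriodPair.derivWeierstrassP x =
        (((gaussianPeriodPair.derivWeierstrassP x).re : ℝ) : ℂ) := by
    have h1 := (gaussianPeriodPair.hasDerivAt_weierstrassP
      (ofReal_notMem_gaussian_lattice hx)).comp_ofReal
    have h2 := (hP hx).ofReal_comp
    refine h1.unique (h2.congr_of_eventuallyEq (Eventually.of_forall fun y ↦ ?_))
    exact gaussian_weierstrassP_ofReal y
  refine sqrt_eq_of_weierstrass_ode (f := fun x ↦ (gaussianPeriodPair.weierstrassP x).re)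
    (d := fun x ↦ (gaussianPeriodPair.derivWeierstrassP x).re) he (fun x hx ↦ hP hx) (fun x hx ↦ ?_)
    (fun x hx ↦ ?_) ?_ ?_
  · refine (hP' hx).congr_deriv ?_
    rw [hg, gaussian_weierstrassP_ofReal]
    norm_cast
    ring
  · have := gaussianPeriodPair.derivWeierstrassP_sq x (ofReal_notMem_gaussian_lattice hx)
    rw [hg, PeriodPair.g₃, gaussian_G_six, hre x hx, gaussian_weierstrassP_ofReal] at this
    norm_cast at this
    linear_combination this
  · have hc := ((gaussianPeriodPair.analyticAt_weierstrassPExcept 0).continuousAt.tendsto.comp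
      (continuous_ofReal.tendsto' 0 0 rfl))
    have hc' := (Complex.continuous_re.tendsto _).comp hc |>.mono_left
      (nhdsWithin_le_nhds (s := Ioi 0))
    have h2 : Tendsto (fun x : ℝ ↦ (x ^ 2)⁻¹) (𝓝[>] 0) atTop := by
      have := (tendsto_pow_atTop (α := ℝ) two_ne_zero).comp tendsto_inv_nhdsGT_zero
      simpa [Function.comp_def] using this
    refine (hc'.add_atTop h2).congr fun x ↦ ?_
    have := gaussianPeriodPair.weierstrassPExcept_def 0 x
    simp only [Function.comp_apply]
    simp at this
    rw [this, ← ofReal_pow, ← ofReal_inv, ← ofReal_neg, add_re, ofReal_re]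
    ring
  · have h1 := gaussianPeriodPair.derivWeierstrassP_sub_coe (1 / 2)
      ⟨_, gaussianPeriodPair.ω₂_mem_lattice⟩
    rw [show (1 / 2 : ℂ) - gaussianPeriodPair.ω₂ = -(1 / 2) by simp [gaussianPeriodPair]; norm_num,
      gaussianPeriodPair.derivWeierstrassP_neg] at h1
    have h2 : gaussianPeriodPair.derivWeierstrassP (1 / 2) = 0 := by
      linear_combination -h1 / 2
    push_cast
    rw [h2, zero_re]

lemma two_mul_eisTwo_sub :
    2 * eisTwo (2 * I) - 3 / π = 3 * Real.Gamma (1 / 4) ^ 4 / (16 * π ^ 3) := by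
  obtain ⟨a, ha, h⟩ := exists_pos_two_mul_eisTwo_sub
  have hsq := sq_two_mul_eisTwo_sub
  have he : 0 < 2 * π ^ 2 * a / 3 := by positivity
  have hG := sqrt_eq_of_g_two he (by
    rw [PeriodPair.g₂, gaussian_G_four]
    rw [h] at hsq
    push_cast
    linear_combination -(16 * (π : ℂ) ^ 4 / 9) * hsq)
  rw [h]
  have h4 := congrArg (fun x ↦ x ^ 2) hG
  simp only [mul_pow, div_pow] at h4
  rw [Real.sq_sqrt he.le, Real.sq_sqrt (by positivity)] at h4
  have : a = 3 * Real.Gamma (1 / 4) ^ 4 / (16 * π ^ 3) := by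
    field_simp at h4 ⊢
    linear_combination h4
  rw [this]
  push_cast
  rfl

lemma hasSum_prod_pow_mul_pow (k j : ℕ) {q : ℂ} (hq : ‖q‖ < 1) :
    HasSum (fun c : ℕ+ × ℕ+ ↦ ((c.1 * c.2 : ℕ) : ℂ) ^ j * (c.1 : ℂ) ^ k * q ^ (c.1 * c.2 : ℕ))
      (∑' n : ℕ, (n : ℂ) ^ j * (σ k n : ℂ) * q ^ n) := by
  set f : ℕ+ × ℕ+ → ℂ :=
    fun c ↦ ((c.1 * c.2 : ℕ) : ℂ) ^ j * (c.1 : ℂ) ^ k * q ^ (c.1 * c.2 : ℕ) with hf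
  have hfe (n : ℕ+) (x : Nat.divisorsAntidiagonal n) : f (sigmaAntidiagonalEquivProd ⟨n, x⟩) =
      (x.1.1 : ℂ) ^ k * ((n : ℂ) ^ j * q ^ (n : ℕ)) := by
    have h1 : x.1.1 * x.1.2 = n := (Nat.mem_divisorsAntidiagonal.mp x.2).1
    simp only [hf, sigmaAntidiagonalEquivProd, divisorsAntidiagonalFactors, Equiv.coe_fn_mk,
      PNat.mk_coe, h1]
    ring
  have hsig (n : ℕ+) : ∑ x : Nat.divisorsAntidiagonal n, x.1.1 ^ k = σ k n := by
    rw [ArithmeticFunction.sigma_apply, ← Nat.sum_divisorsAntidiagonal fun i _ ↦ i ^ k]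
    exact Finset.sum_coe_sort (Nat.divisorsAntidiagonal n) fun x ↦ x.1 ^ k
  have hs := summable_sigmaSeries_term k j hq
  have hsum : Summable (f ∘ sigmaAntidiagonalEquivProd) := by
    refine Summable.of_norm ((summable_sigma_of_nonneg fun _ ↦ norm_nonneg _).mpr
      ⟨fun n ↦ (hasSum_fintype _).summable, ?_⟩)
    refine (hs.norm.comp_injective PNat.coe_injective).congr fun n ↦ ?_
    simp only [tsum_fintype, Function.comp_apply, hfe, norm_mul, norm_pow, Complex.norm_natCast,
      ← Finset.sum_mul]
    rw [← hsig n]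
    push_cast
    ring
  rw [← sigmaAntidiagonalEquivProd.hasSum_iff]
  convert hsum.hasSum using 1
  rw [hsum.tsum_sigma, ← tsum_zero_pnat_eq_tsum_nat hs]
  simp only [tsum_fintype, Function.comp_apply, hfe, ← Finset.sum_mul]
  simp only [ArithmeticFunction.map_zero, Nat.cast_zero, mul_zero, zero_mul, zero_add]
  refine tsum_congr fun n ↦ ?_
  rw [← hsig n]
  push_cast
  ring

lemma hasSum_sechSeries {τ : ℂ} (hτ : 0 < τ.im) :
    HasSum (fun c : ℕ+ × ℕ+ ↦ (c.1 : ℂ) ^ 5 * ((c.2 : ℂ) ^ 4 - 10 * (c.2 : ℂ) ^ 2 + 9) *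
      cexp (2 * π * I * τ) ^ (c.1 * c.2 : ℕ)) (sechSeries τ) := by
  have hq := norm_cexp_two_pi_I_mul_lt_one hτ
  refine (((hasSum_prod_pow_mul_pow 1 4 hq).sub ((hasSum_prod_pow_mul_pow 3 2 hq).mul_left 10)).add
    ((hasSum_prod_pow_mul_pow 5 0 hq).mul_left 9)).congr_fun fun c ↦ ?_
  push_cast
  ring

lemma I_pow_sub_neg_I_pow (n : ℕ) : I ^ n - (-I) ^ n = 2 * I * (ZMod.χ₄ n : ℤ) := by
  rw [ZMod.χ₄_nat_mod_four]
  obtain ⟨m, hm⟩ : ∃ m, n = 4 * m + n % 4 := ⟨n / 4, (Nat.div_add_mod n 4).symm⟩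
  have h4 : (-I) ^ 4 = 1 := by rw [Even.neg_pow (by decide), I_pow_four]
  have hr : n % 4 < 4 := Nat.mod_lt _ (by norm_num)
  generalize n % 4 = r at hm hr
  rw [hm, pow_add, pow_add, pow_mul, pow_mul, I_pow_four, h4, one_pow, one_mul, one_mul]
  interval_cases r
  · simp
  · rw [show ZMod.χ₄ (1 : ℕ) = 1 by decide]; push_cast; ring
  · rw [show ZMod.χ₄ (2 : ℕ) = 0 by decide]; push_cast; ring
  · rw [show ZMod.χ₄ (3 : ℕ) = -1 by decide]; push_cast; linear_combination 2 * I * I_sq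

lemma tsum_χ₄_mul (f : ℕ → ℂ) :
    ∑' n : ℕ+, (ZMod.χ₄ (n : ℕ) : ℂ) * f n = ∑' n : ℕ, (-1) ^ n * f (2 * n + 1) := by
  have hodd (n : ℕ) : (ZMod.χ₄ ((2 * n + 1 : ℕ) : ZMod 4) : ℂ) = (-1) ^ n := by
    rw [ZMod.χ₄_eq_neg_one_pow (by omega), show (2 * n + 1) / 2 = n by omega]
    simp
  have hinj : Function.Injective fun n : ℕ ↦ (2 * n).succPNat := fun a b hab ↦ by
    simpa using hab
  rw [← hinj.tsum_eq]
  · refine tsum_congr fun n ↦ ?_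
    rw [Nat.succPNat_coe, Nat.succ_eq_add_one, hodd]
  · intro n hn
    have hn' : (ZMod.χ₄ (n : ℕ) : ℤ) ≠ 0 := fun h ↦ hn (by simp [h])
    rw [ZMod.χ₄_nat_eq_if_mod_four] at hn'
    refine ⟨(n : ℕ) / 2, PNat.coe_injective ?_⟩
    have : (n : ℕ) % 2 ≠ 0 := by grind
    simp only [Nat.succPNat_coe]
    omega

lemma tsum_χ₄_mul_pow {x : ℂ} (hx : ‖x‖ < 1) :
    ∑' m : ℕ+, (ZMod.χ₄ (m : ℕ) : ℂ) * (((m : ℕ) : ℂ) ^ 4 - 10 * ((m : ℕ) : ℂ) ^ 2 + 9) *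
      x ^ (m : ℕ) = 384 * (x / (1 + x ^ 2)) ^ 5 := by
  have hx2 : ‖-x ^ 2‖ < 1 := by
    rw [norm_neg, norm_pow]
    exact pow_lt_one₀ (norm_nonneg x) hx two_ne_zero
  have h := ((hasSum_choose_mul_geometric_of_norm_lt_one 4 hx2).mul_left (384 * x ^ 5))
  simp_rw [mul_assoc]
  rw [tsum_χ₄_mul fun m ↦ ((m : ℂ) ^ 4 - 10 * (m : ℂ) ^ 2 + 9) * x ^ m]
  refine (hasSum_nat_add_iff' 2).mp ?_ |>.tsum_eq
  have hterm (n : ℕ) : (-1 : ℂ) ^ (n + 2) * ((((2 * (n + 2) + 1 : ℕ) : ℂ) ^ 4 -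
      10 * ((2 * (n + 2) + 1 : ℕ) : ℂ) ^ 2 + 9) * x ^ (2 * (n + 2) + 1)) =
      384 * x ^ 5 * (((n + 4).choose 4 : ℕ) * (-x ^ 2) ^ n) := by
    have hch : (((n + 4).choose 4 : ℕ) : ℂ) * 24 = (n + 1) * (n + 2) * (n + 3) * (n + 4) := by
      have h1 := Nat.ascFactorial_eq_factorial_mul_choose n 4
      simp only [Nat.ascFactorial, Nat.factorial] at h1
      have h2 : (n + 4).choose 4 * 24 = (n + 1) * (n + 2) * (n + 3) * (n + 4) := by linarith
      exact_mod_cast h2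
    rw [neg_pow (x ^ 2) n, ← pow_mul]
    push_cast
    linear_combination (-16) * (-1) ^ n * x ^ 5 * x ^ (2 * n) * hch
  simp_rw [hterm]
  have hval : 384 * (x / (1 + x ^ 2)) ^ 5 - ∑ n ∈ Finset.range 2, (-1 : ℂ) ^ n *
      ((((2 * n + 1 : ℕ) : ℂ) ^ 4 - 10 * ((2 * n + 1 : ℕ) : ℂ) ^ 2 + 9) * x ^ (2 * n + 1)) =
      384 * x ^ 5 * (1 / (1 - -x ^ 2) ^ (4 + 1)) := by
    rw [Finset.sum_range_succ, Finset.sum_range_one, sub_neg_eq_add, div_pow]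
    push_cast
    ring
  rw [hval]
  exact h

lemma tsum_sech_fifth {q : ℝ} (hq0 : 0 < q) (hq1 : q < 1) {τ τ' : ℂ} (hτ : 0 < τ.im)
    (hτ' : 0 < τ'.im) (h : cexp (2 * π * I * τ) = I * q) (h' : cexp (2 * π * I * τ') = -I * q) :
    ∑' n : ℕ, (-1 : ℂ) ^ n * ((2 * n + 1 : ℕ) : ℂ) ^ 5 *
      (2 * (q : ℂ) ^ (2 * n + 1) / (1 + ((q : ℂ) ^ (2 * n + 1)) ^ 2)) ^ 5 =
      -I / 24 * (sechSeries τ - sechSeries τ') := by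
  have hs := ((hasSum_sechSeries hτ).sub (hasSum_sechSeries hτ')).mul_left (-I / 24)
  have hterm (c : ℕ+ × ℕ+) : -I / 24 * ((c.1 : ℂ) ^ 5 * ((c.2 : ℂ) ^ 4 - 10 * (c.2 : ℂ) ^ 2 + 9) *
        cexp (2 * π * I * τ) ^ (c.1 * c.2 : ℕ) - (c.1 : ℂ) ^ 5 *
        ((c.2 : ℂ) ^ 4 - 10 * (c.2 : ℂ) ^ 2 + 9) * cexp (2 * π * I * τ') ^ (c.1 * c.2 : ℕ)) =
      (ZMod.χ₄ (c.1 : ℕ) : ℂ) * ((c.1 : ℂ) ^ 5 / 12) * ((ZMod.χ₄ (c.2 : ℕ) : ℂ) *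
        ((c.2 : ℂ) ^ 4 - 10 * (c.2 : ℂ) ^ 2 + 9) * ((q : ℂ) ^ (c.1 : ℕ)) ^ (c.2 : ℕ)) := by
    have hI := I_pow_sub_neg_I_pow (c.1 * c.2)
    rw [Nat.cast_mul, map_mul] at hI
    push_cast at hI
    rw [h, h', mul_pow, mul_pow, ← pow_mul]
    linear_combination -I / 24 * (c.1 : ℂ) ^ 5 * ((c.2 : ℂ) ^ 4 - 10 * (c.2 : ℂ) ^ 2 + 9) *
      (q : ℂ) ^ (c.1 * c.2 : ℕ) * hI - (ZMod.χ₄ (c.1 : ℕ) : ℂ) * ((c.1 : ℂ) ^ 5 / 12) *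
      ((ZMod.χ₄ (c.2 : ℕ) : ℂ) * ((c.2 : ℂ) ^ 4 - 10 * (c.2 : ℂ) ^ 2 + 9) *
      (q : ℂ) ^ (c.1 * c.2 : ℕ)) * I_sq
  simp_rw [hterm] at hs
  have hinner (n : ℕ+) : ∑' m : ℕ+, (ZMod.χ₄ (n : ℕ) : ℂ) * ((n : ℂ) ^ 5 / 12) *
      ((ZMod.χ₄ (m : ℕ) : ℂ) * ((m : ℂ) ^ 4 - 10 * (m : ℂ) ^ 2 + 9) *
        ((q : ℂ) ^ (n : ℕ)) ^ (m : ℕ)) = (ZMod.χ₄ (n : ℕ) : ℂ) * (((n : ℕ) : ℂ) ^ 5 *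
        (2 * (q : ℂ) ^ (n : ℕ) / (1 + ((q : ℂ) ^ (n : ℕ)) ^ 2)) ^ 5) := by
    have hn : ‖(q : ℂ) ^ (n : ℕ)‖ < 1 := by
      rw [norm_pow, norm_real, Real.norm_of_nonneg hq0.le]
      exact pow_lt_one₀ hq0.le hq1 n.ne_zero
    rw [tsum_mul_left, tsum_χ₄_mul_pow hn]
    ring
  rw [← hs.tsum_eq, hs.summable.tsum_prod]
  simp_rw [hinner]
  rw [tsum_χ₄_mul fun n ↦ (n : ℂ) ^ 5 * (2 * (q : ℂ) ^ n / (1 + ((q : ℂ) ^ n) ^ 2)) ^ 5]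
  simp_rw [mul_assoc]

lemma cexp_two_pi_I_mul_I_add (w : ℂ) :
    cexp (2 * π * I * ((I + w) / 4)) = cexp (π / 2 * I * w) * (rexp (-(π / 2)) : ℝ) := by
  rw [ofReal_exp, ← Complex.exp_add]
  congr 1
  push_cast
  linear_combination (π : ℂ) / 2 * I_sq

lemma ofReal_pow_div_cosh (n : ℕ) :
    (((-1 : ℝ) ^ n * (2 * (n : ℝ) + 1) ^ 5 / Real.cosh ((2 * (n : ℝ) + 1) * π / 2) ^ 5 : ℝ) : ℂ) =
      (-1 : ℂ) ^ n * ((2 * n + 1 : ℕ) : ℂ) ^ 5 * (2 * ((rexp (-(π / 2)) : ℝ) : ℂ) ^ (2 * n + 1) /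
        (1 + (((rexp (-(π / 2)) : ℝ) : ℂ) ^ (2 * n + 1)) ^ 2)) ^ 5 := by
  have hq : rexp (-(π / 2)) ^ (2 * n + 1) = rexp (-((2 * (n : ℝ) + 1) * π / 2)) := by
    rw [← Real.exp_nat_mul]
    push_cast
    ring_nf
  have hcosh (y : ℝ) : (Real.cosh y)⁻¹ = 2 * rexp (-y) / (1 + rexp (-y) ^ 2) := by
    rw [Real.cosh_eq, Real.exp_neg]
    have := Real.exp_pos y
    field_simp
  rw [← ofReal_pow, hq, div_eq_mul_inv, ← inv_pow, hcosh]
  push_cast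
  ring

end

theorem sum_odd_fifth_cosh_fifth :
    (∑' n : ℕ, (-1 : ℝ) ^ n * (2*(n:ℝ)+1) ^ 5 / Real.cosh ((2*(n:ℝ)+1) * π / 2) ^ 5) =
      5 * Real.Gamma (1/4) ^ 4 / (2 ^ 4 * π ^ 7)
    - 5 * Real.Gamma (1/4) ^ 12 / (2 ^ 9 * π ^ 11)
    + 25 * Real.Gamma (1/4) ^ 12 / (3 * 2 ^ 9 * π ^ 10)
    - 9 * Real.Gamma (1/4) ^ 12 / (2 ^ 11 * π ^ 9)
    + Real.Gamma (1/4) ^ 20 / (3 * 2 ^ 16 * π ^ 15) := by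
  have hπ : (π : ℂ) ≠ 0 := Complex.ofReal_ne_zero.mpr pi_ne_zero
  have hΓ : (Real.Gamma (1 / 4) : ℂ) ≠ 0 :=
    Complex.ofReal_ne_zero.mpr (Real.Gamma_pos_of_pos (by norm_num)).ne'
  have hA := two_mul_eisTwo_sub.symm
  have hA0 : 3 * (Real.Gamma (1 / 4) : ℂ) ^ 4 / (16 * (π : ℂ) ^ 3) ≠ 0 :=
    div_ne_zero (mul_ne_zero three_ne_zero (pow_ne_zero 4 hΓ))
      (mul_ne_zero (by norm_num) (pow_ne_zero 3 hπ))
  have hsum := tsum_sech_fifth (q := rexp (-(π / 2))) (τ := (Complex.I + 1) / 4)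
    (τ' := (Complex.I - 1) / 4) (Real.exp_pos _)
    (Real.exp_lt_one_iff.mpr (by linarith [pi_pos])) (by simp) (by simp)
    (by rw [cexp_two_pi_I_mul_I_add, mul_one, Complex.exp_pi_div_two_mul_I])
    (by rw [sub_eq_add_neg, cexp_two_pi_I_mul_I_add, mul_neg_one, Complex.exp_neg,
      Complex.exp_pi_div_two_mul_I, Complex.inv_I])
  rw [sechSeries_sub hA hA0] at hsum
  apply Complex.ofReal_injective
  rw [Complex.ofReal_tsum]
  simp_rw [ofReal_pow_div_cosh]
  rw [hsum]
  push_cast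
  field_simp
  ring
end
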